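/- Let M = (A, <, P₁, …, Pₙ) be a labelled linear ordering such that (A, <) contains an order-connected subset order-isomorphic to ℕ or to ℕ with the reversed order (an interval of order type ω or −ω). Then there exists a set Q ⊆ A such that Q is not MSO-definable in M and the MSO theory of the expansion M' = (A, <, P₁, …, Pₙ, Q) is recursive in (Turing reducible to) the MSO theory of M. In particular, if MSO(M) is decidable, then MSO(M') is decidable. -/

import Mathlib

namespace Paper

/-! ## Syntax and semantics of monadic second-order logic over labelled linear orders

A labelled linear ordering `M = (A, <, P₁, …, Pₙ)` is represented by a type `A`,
a binary relation `r : A → A → Prop` (the order) and `P : Fin n → Set A`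
(the unary predicates). -/

/-- MSO formulas over the signature `{<, P₀, …, P_{n-1}}`.  First-order
variables and second-order (set) variables are both indexed by `ℕ`. -/
inductive MSO (n : ℕ) : Type
  | lt (i j : ℕ) : MSO n
  | pred (k : Fin n) (i : ℕ) : MSO n
  | mem (i j : ℕ) : MSO n
  | not (φ : MSO n) : MSO n
  | and (φ ψ : MSO n) : MSO n
  | ex1 (i : ℕ) (φ : MSO n) : MSO n
  | ex2 (j : ℕ) (φ : MSO n) : MSO n

namespace MSO

variable {n : ℕ}

/-- Satisfaction of an MSO formula in the structure `(A, r, P)` under the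
first-order assignment `v` and the second-order assignment `V`. -/
def Sat {A : Type} (r : A → A → Prop) (P : Fin n → Set A)
    (v : ℕ → A) (V : ℕ → Set A) : MSO n → Prop
  | lt i j => r (v i) (v j)
  | pred k i => v i ∈ P k
  | mem i j => v i ∈ V j
  | not φ => ¬ Sat r P v V φ
  | and φ ψ => Sat r P v V φ ∧ Sat r P v V ψ
  | ex1 i φ => ∃ a : A, Sat r P (Function.update v i a) V φ
  | ex2 j φ => ∃ S : Set A, Sat r P v (Function.update V j S) φ

/-- Quantifier depth of an MSO formula. -/
def qd : MSO n → ℕ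
  | lt _ _ => 0
  | pred _ _ => 0
  | mem _ _ => 0
  | not φ => qd φ
  | and φ ψ => max (qd φ) (qd ψ)
  | ex1 _ φ => qd φ + 1
  | ex2 _ φ => qd φ + 1

/-- Free first-order variables of an MSO formula. -/
def fv1 : MSO n → Finset ℕ
  | lt i j => {i, j}
  | pred _ i => {i}
  | mem i _ => {i}
  | not φ => fv1 φ
  | and φ ψ => fv1 φ ∪ fv1 ψ
  | ex1 i φ => fv1 φ \ {i}
  | ex2 _ φ => fv1 φ

/-- Free second-order variables of an MSO formula. -/
def fv2 : MSO n → Finset ℕ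
  | lt _ _ => ∅
  | pred _ _ => ∅
  | mem _ j => {j}
  | not φ => fv2 φ
  | and φ ψ => fv2 φ ∪ fv2 ψ
  | ex1 _ φ => fv2 φ
  | ex2 j φ => fv2 φ \ {j}

/-- A sentence is a formula with no free variables. -/
def IsSentence (φ : MSO n) : Prop := fv1 φ = ∅ ∧ fv2 φ = ∅

/-- A sentence `φ` is true in the structure `(A, r, P)`. -/
def TrueIn {A : Type} (r : A → A → Prop) (P : Fin n → Set A) (φ : MSO n) : Prop :=
  ∀ (v : ℕ → A) (V : ℕ → Set A), Sat r P v V φ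

/-- `Q ⊆ A` is MSO-definable in `(A, r, P)`: there is a formula `φ(x)` whose only
free variable is the first-order variable `0` defining `Q`. -/
def Definable {A : Type} (r : A → A → Prop) (P : Fin n → Set A) (Q : Set A) : Prop :=
  ∃ φ : MSO n, fv1 φ ⊆ {0} ∧ fv2 φ = ∅ ∧
    ∀ a : A, a ∈ Q ↔ ∀ (v : ℕ → A) (V : ℕ → Set A), Sat r P (Function.update v 0 a) V φ

/-- A Gödel numbering of MSO formulas. -/
def encode : MSO n → ℕ
  | lt i j => Nat.pair 0 (Nat.pair i j)
  | pred k i => Nat.pair 1 (Nat.pair k i)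
  | mem i j => Nat.pair 2 (Nat.pair i j)
  | not φ => Nat.pair 3 (encode φ)
  | and φ ψ => Nat.pair 4 (Nat.pair (encode φ) (encode ψ))
  | ex1 i φ => Nat.pair 5 (Nat.pair i (encode φ))
  | ex2 j φ => Nat.pair 6 (Nat.pair j (encode φ))

/-- The MSO theory of the structure `(A, r, P)`, as a set of Gödel codes of the true
sentences. -/
def TheoryCodes {A : Type} (r : A → A → Prop) (P : Fin n → Set A) : Set ℕ :=
  {c | ∃ φ : MSO n, IsSentence φ ∧ encode φ = c ∧ TrueIn r P φ}

/-- Two structures have the same `k`-type: they satisfy the same MSO sentences of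
quantifier depth `≤ k`. -/
def EquivType (k : ℕ) {A B : Type} (r : A → A → Prop) (P : Fin n → Set A)
    (s : B → B → Prop) (Q : Fin n → Set B) : Prop :=
  ∀ φ : MSO n, IsSentence φ → qd φ ≤ k → (TrueIn r P φ ↔ TrueIn s Q φ)

/-- The `k`-type of a structure, as the set of Gödel codes of the true sentences
of quantifier depth `≤ k`. -/
def TypeSet (k : ℕ) {A : Type} (r : A → A → Prop) (P : Fin n → Set A) : Set ℕ :=
  {c | ∃ φ : MSO n, IsSentence φ ∧ qd φ ≤ k ∧ encode φ = c ∧ TrueIn r P φ}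

end MSO

/-- The order relation of the substructure with domain `S`. -/
def subRel {A : Type} (r : A → A → Prop) (S : Set A) : S → S → Prop :=
  fun x y => r x y

/-- The predicates of the substructure with domain `S`. -/
def subPred {A : Type} {n : ℕ} (P : Fin n → Set A) (S : Set A) : Fin n → Set S :=
  fun k => {x : S | (x : A) ∈ P k}

/-! ## Relative computability -/

/-- Partial recursiveness relative to an oracle `O` (Kleene-style, following
the definition of `Nat.Partrec`, with an extra base case for the oracle). -/
inductive RecursiveIn (O : ℕ →. ℕ) : (ℕ →. ℕ) → Prop
  | zero : RecursiveIn O (pure 0)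
  | succ : RecursiveIn O ↑Nat.succ
  | left : RecursiveIn O ↑fun n : ℕ => n.unpair.1
  | right : RecursiveIn O ↑fun n : ℕ => n.unpair.2
  | oracle : RecursiveIn O O
  | pair {f g} : RecursiveIn O f → RecursiveIn O g →
      RecursiveIn O fun n => Nat.pair <$> f n <*> g n
  | comp {f g} : RecursiveIn O f → RecursiveIn O g →
      RecursiveIn O fun n => g n >>= f
  | prec {f g} : RecursiveIn O f → RecursiveIn O g →
      RecursiveIn O (Nat.unpaired fun a m =>
        m.rec (f a) fun y IH => do let i ← IH; g (Nat.pair a (Nat.pair y i)))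
  | rfind {f} : RecursiveIn O f →
      RecursiveIn O fun a => Nat.rfind fun m => (fun x => x = 0) <$> f (Nat.pair a m)

/-- The characteristic (partial) function of a set of naturals. -/
noncomputable def chi (S : Set ℕ) : ℕ →. ℕ :=
  fun m => Part.some (S.indicator (fun _ => 1) m)

/-- `S` is recursive in (Turing reducible to) `T`. -/
def TuringRed (S T : Set ℕ) : Prop := RecursiveIn (chi T) (chi S)

/-- The (recursive) join of a finite family of sets of naturals. -/
def finJoin {m : ℕ} (P : Fin m → Set ℕ) : Set ℕ :=
  {c | ∃ i : Fin m, ∃ x : ℕ, c = Nat.pair i x ∧ x ∈ P i}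

/-- The (recursive) join of two sets of naturals. -/
def setJoin (S T : Set ℕ) : Set ℕ :=
  {c | (∃ a, c = 2 * a ∧ a ∈ S) ∨ (∃ a, c = 2 * a + 1 ∧ a ∈ T)}

/-- A set of naturals is decidable (computable). -/
def DecidableSet (S : Set ℕ) : Prop := ComputablePred (· ∈ S)

/-! ## Homogeneous sets for labelled orderings of the naturals -/

/-- `H = {h 0 < h 1 < ⋯}` is `k`-homogeneous for `(ℕ, <, P)`:
all substructures `M_{[h i, h j)}`, `i < j`, have the same `k`-type. -/
def KHomogeneous {n : ℕ} (P : Fin n → Set ℕ) (h : ℕ → ℕ) (k : ℕ) : Prop :=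
  ∀ i j i' j' : ℕ, i < j → i' < j' →
    MSO.EquivType k
      (subRel (· < ·) (Set.Ico (h i) (h j))) (subPred P (Set.Ico (h i) (h j)))
      (subRel (· < ·) (Set.Ico (h i') (h j'))) (subPred P (Set.Ico (h i') (h j')))

/-- `H = {h 0 < h 1 < ⋯}` is uniformly homogeneous for `(ℕ, <, P)`:
for each `k`, the set `{h k < h (k+1) < ⋯}` is `k`-homogeneous. -/
def UniformlyHomogeneous {n : ℕ} (P : Fin n → Set ℕ) (h : ℕ → ℕ) : Prop :=
  StrictMono h ∧
  ∀ k : ℕ, KHomogeneous P (fun i => h (k + i)) k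

/-! ## ℤ-words -/

/-- The finite word `u` occurs at position `i` in the `ℤ`-word `w`. -/
def OccursAt {σ : Type} (w : ℤ → σ) (u : List σ) (i : ℤ) : Prop :=
  ∀ k : Fin u.length, w (i + (k : ℕ)) = u.get k

/-- The finite word `u` occurs in the `ℤ`-word `w`. -/
def OccursIn {σ : Type} (w : ℤ → σ) (u : List σ) : Prop :=
  ∃ i : ℤ, OccursAt w u i

/-- `u` occurs in every prefix of `w`. -/
def InEveryPrefix {σ : Type} (w : ℤ → σ) (u : List σ) : Prop :=
  ∀ n : ℤ, ∃ i : ℤ, i + u.length ≤ n ∧ OccursAt w u i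

/-- `u` occurs in every suffix of `w`. -/
def InEverySuffix {σ : Type} (w : ℤ → σ) (u : List σ) : Prop :=
  ∀ n : ℤ, ∃ i : ℤ, n ≤ i ∧ OccursAt w u i

/-- A `ℤ`-word `w` is recurrent: for every regular language `X`, either no element
of `X` occurs in `w`, or every prefix and every suffix of `w` contains an
occurrence of some element of `X`. -/
def Recurrent {σ : Type} (w : ℤ → σ) : Prop :=
  ∀ X : Language σ, X.IsRegular →
    (∀ u ∈ X, ¬ OccursIn w u) ∨
    (∀ n : ℤ, (∃ u ∈ X, ∃ i : ℤ, i + u.length ≤ n ∧ OccursAt w u i) ∧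
              (∃ u ∈ X, ∃ i : ℤ, n ≤ i ∧ OccursAt w u i))

/-- The `ℤ`-word `w(M)` over the alphabet `{0,1}ⁿ` associated with the labelled
linear ordering `M = (ℤ, <, P₁, …, Pₙ)`. -/
def wordOf {n : ℕ} (P : Fin n → Set ℤ) : ℤ → (Fin n → Prop) :=
  fun i k => i ∈ P k

end Paper

open Paper

namespace Paper

open MSO

/-! ## Types of labelled linear orderings and their ordered sums -/

/-- The finite set of possible `k`-types of a linear ordering carrying `m` labels.  An atomic type
records which labels meet (`false`) and which labels contain an increasing pair (`true`); a
`(k + 1)`-type is the set of `k`-types obtained by adding one more label. -/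
def Ty : ℕ → ℕ → Type
  | 0, m => Set (Bool × Fin m × Fin m)
  | k + 1, m => Set (Ty k (m + 1))

instance Ty.finite : ∀ k m, Finite (Ty k m)
  | 0, m => inferInstanceAs (Finite (Set (Bool × Fin m × Fin m)))
  | k + 1, m =>
    haveI := Ty.finite k (m + 1)
    inferInstanceAs (Finite (Set (Ty k (m + 1))))

instance {m : ℕ} : Membership (Bool × Fin m × Fin m) (Ty 0 m) :=
  inferInstanceAs (Membership _ (Set (Bool × Fin m × Fin m)))

instance {k m : ℕ} : Membership (Ty k (m + 1)) (Ty (k + 1) m) :=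
  inferInstanceAs (Membership _ (Set (Ty k (m + 1))))

theorem Ty.ext_zero {m : ℕ} {s t : Ty 0 m} (h : ∀ b i j, (b, i, j) ∈ s ↔ (b, i, j) ∈ t) : s = t :=
  Set.ext fun ⟨b, i, j⟩ => h b i j

theorem Ty.ext_succ {k m : ℕ} {s t : Ty (k + 1) m} (h : ∀ x : Ty k (m + 1), x ∈ s ↔ x ∈ t) :
    s = t :=
  Set.ext h

/-- The `k`-type of the restriction to `C` of a linear ordering labelled by `U 0, …, U (m - 1)`. -/
def tp {A : Type} [LT A] : (k m : ℕ) → Set A → (ℕ → Set A) → Ty k m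
  | 0, m, C, U => show Set (Bool × Fin m × Fin m) from
      {a | (a.1 = false ∧ ∃ x ∈ C, x ∈ U a.2.1 ∧ x ∈ U a.2.2) ∨
        (a.1 = true ∧ ∃ x ∈ C, ∃ y ∈ C, x ∈ U a.2.1 ∧ y ∈ U a.2.2 ∧ x < y)}
  | k + 1, m, C, U => show Set (Ty k (m + 1)) from
      Set.range fun S => tp k (m + 1) C (Function.update U m S)

/-- The type of an ordered sum, computed from the types of the summands. -/
def Ty.sum {J : Type} [LT J] : (k m : ℕ) → (J → Ty k m) → Ty k m
  | 0, m, t => show Set (Bool × Fin m × Fin m) from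
      {a | (∃ q, a ∈ t q) ∨ (a.1 = true ∧ ∃ q q', q < q' ∧
        (false, a.2.1, a.2.1) ∈ t q ∧
        (false, a.2.2, a.2.2) ∈ t q')}
  | k + 1, m, t => show Set (Ty k (m + 1)) from
      {x | ∃ s : J → Ty k (m + 1), (∀ q, s q ∈ t q) ∧ Ty.sum k (m + 1) s = x}

section tp

variable {A : Type} [LinearOrder A]

theorem tp_congr {k m : ℕ} {C : Set A} {U U' : ℕ → Set A}
    (h : ∀ i < m, ∀ x ∈ C, x ∈ U i ↔ x ∈ U' i) : tp k m C U = tp k m C U' := by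
  induction k generalizing m U U' with
  | zero =>
    refine Set.ext fun ⟨b, i, j⟩ => ?_
    have h1 := fun x hx => h i i.2 x hx
    have h2 := fun x hx => h j j.2 x hx
    refine or_congr (and_congr Iff.rfl (exists_congr fun x => and_congr_right fun hx => ?_))
      (and_congr Iff.rfl (exists_congr fun x => and_congr_right fun hx =>
        exists_congr fun y => and_congr_right fun hy => ?_))
    · rw [h1 x hx, h2 x hx]
    · rw [h1 x hx, h2 y hy]
  | succ k ih =>
    refine congrArg Set.range (funext fun S => ih fun i hi x hx => ?_)
    rcases eq_or_ne i m with rfl | hne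
    · simp
    · simpa [hne] using h i (by omega) x hx

theorem tp_eq_sum {J : Type} [PartialOrder J] (π : A → J) {k m : ℕ} {C : Set A} (U : ℕ → Set A)
    (hπ : ∀ x ∈ C, ∀ y ∈ C, x < y → π x ≤ π y) :
    tp k m C U = Ty.sum k m fun q => tp k m {x | x ∈ C ∧ π x = q} U := by
  induction k generalizing m U with
  | zero =>
    refine Set.ext fun ⟨b, i, j⟩ => ?_
    constructor
    · rintro (⟨hb, x, hx, hi, hj⟩ | ⟨hb, x, hx, y, hy, hi, hj, hlt⟩)
      · exact Or.inl ⟨π x, Or.inl ⟨hb, x, ⟨hx, rfl⟩, hi, hj⟩⟩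
      · rcases (hπ x hx y hy hlt).eq_or_lt with he | hl
        · exact Or.inl ⟨π x, Or.inr ⟨hb, x, ⟨hx, rfl⟩, y, ⟨hy, he.symm⟩, hi, hj, hlt⟩⟩
        · exact Or.inr ⟨hb, π x, π y, hl, Or.inl ⟨rfl, x, ⟨hx, rfl⟩, hi, hi⟩,
            Or.inl ⟨rfl, y, ⟨hy, rfl⟩, hj, hj⟩⟩
    · rintro (⟨q, ⟨hb, x, ⟨hx, -⟩, hi, hj⟩ | ⟨hb, x, ⟨hx, -⟩, y, ⟨hy, -⟩, hi, hj, hlt⟩⟩ |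
        ⟨hb, q, q', hq, ⟨-, x, ⟨hx, rfl⟩, hi, -⟩ | ⟨h, -⟩,
          ⟨-, y, ⟨hy, rfl⟩, hj, -⟩ | ⟨h, -⟩⟩)
      · exact Or.inl ⟨hb, x, hx, hi, hj⟩
      · exact Or.inr ⟨hb, x, hx, y, hy, hi, hj, hlt⟩
      · refine Or.inr ⟨hb, x, hx, y, hy, hi, hj, ?_⟩
        rcases lt_trichotomy x y with h | rfl | h
        · exact h
        · exact absurd hq (lt_irrefl _)
        · exact absurd (hπ y hy x hx h) hq.not_ge
      all_goals exact absurd h (by simp)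
  | succ k ih =>
    refine Set.ext fun t => ?_
    constructor
    · rintro ⟨S, rfl⟩
      exact ⟨_, fun q => ⟨S, rfl⟩, (ih _).symm⟩
    · rintro ⟨s, hs, rfl⟩
      choose S hS using hs
      refine ⟨{x | x ∈ S (π x)}, ?_⟩
      refine (ih _).trans (congrArg _ (funext fun q => ?_))
      rw [← hS q]
      refine tp_congr fun i _ x hx => ?_
      rcases eq_or_ne i m with rfl | hne
      · simp [hx.2]
      · simp [hne]

theorem tp_iUnion {J : Type} [LinearOrder J] [Nonempty J] (C : J → Set A) {k m : ℕ}
    (U : ℕ → Set A) (hC : ∀ i j, i < j → ∀ x ∈ C i, ∀ y ∈ C j, x < y) :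
    tp k m (⋃ j, C j) U = Ty.sum k m fun j => tp k m (C j) U := by
  classical
  let π : A → J := fun x => if h : ∃ j, x ∈ C j then h.choose else Classical.arbitrary J
  have hπ : ∀ j, ∀ x ∈ C j, π x = j := by
    intro j x hx
    have h : ∃ j, x ∈ C j := ⟨j, hx⟩
    have h1 : x ∈ C (π x) := by simp only [π, dif_pos h]; exact h.choose_spec
    rcases lt_trichotomy (π x) j with h2 | h2 | h2
    · exact absurd (hC _ _ h2 x h1 x hx) (lt_irrefl _)
    · exact h2
    · exact absurd (hC _ _ h2 x hx x h1) (lt_irrefl _)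
  rw [tp_eq_sum π]
  · refine congrArg _ (funext fun q => congrArg (tp k m · U) (Set.ext fun x => ?_))
    constructor
    · rintro ⟨hx, rfl⟩
      obtain ⟨j, hj⟩ := Set.mem_iUnion.1 hx
      rwa [hπ j x hj]
    · exact fun hx => ⟨Set.mem_iUnion.2 ⟨q, hx⟩, hπ q x hx⟩
  · intro x hx y hy hxy
    obtain ⟨i, hi⟩ := Set.mem_iUnion.1 hx
    obtain ⟨j, hj⟩ := Set.mem_iUnion.1 hy
    rw [hπ i x hi, hπ j y hj]
    by_contra hlt
    exact absurd (hC j i (not_le.1 hlt) y hj x hi) hxy.not_gt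

/-- If two labellings give the same type to each class of a convex equivalence relation, they give
the same type to the whole ordering. -/
theorem tp_univ_congr_of_classes (s : Setoid A) (hs : ∀ x y z, x ≤ y → y ≤ z → s x z → s x y)
    {k m : ℕ} {U U' : ℕ → Set A} (h : ∀ x, tp k m {y | s y x} U = tp k m {y | s y x} U') :
    tp k m Set.univ U = tp k m Set.univ U' := by
  let π : A → A := fun x => (Quotient.mk s x).out
  have hπ : ∀ x, s (π x) x := fun x => Quotient.exact (Quotient.out_eq _)
  have hπ' : ∀ x y, s x y → π x = π y := fun x y hxy => congrArg Quotient.out (Quotient.sound hxy)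
  have mono : ∀ x ∈ (Set.univ : Set A), ∀ y ∈ (Set.univ : Set A), x < y → π x ≤ π y := by
    intro x _ y _ hxy
    by_contra hlt
    rw [not_le] at hlt
    refine absurd hlt (not_lt.2 (le_of_eq (hπ' x y ?_)))
    rcases le_total (π y) x with hyx | hyx
    · exact s.symm (s.trans (s.symm (hπ y)) (hs _ _ _ hyx hxy.le (hπ y)))
    · exact s.trans (hs _ _ _ hyx hlt.le (s.symm (hπ x))) (hπ y)
  rw [tp_eq_sum π U mono, tp_eq_sum π U' mono]
  refine congrArg _ (funext fun q => ?_)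
  by_cases hq : ∃ x, π x = q
  · obtain ⟨x, rfl⟩ := hq
    have : {y | y ∈ Set.univ ∧ π y = π x} = {y | s y x} := by
      ext y
      refine ⟨fun hy => ?_, fun hy => ⟨trivial, hπ' y x hy⟩⟩
      have h1 := s.symm (hπ y)
      rw [hy.2] at h1
      exact s.trans h1 (hπ x)
    rw [this, h]
  · have : {y | y ∈ Set.univ ∧ π y = q} = (∅ : Set A) := by
      ext y
      simp only [Set.mem_univ, true_and, Set.mem_ofPred_eq, Set.mem_empty_iff_false, iff_false]
      exact fun hy => hq ⟨y, hy⟩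
    rw [this]
    exact tp_congr fun i _ x hx => hx.elim

/-- Types determine the atomic relations between the labels. -/
theorem atoms_of_tp_eq {k m : ℕ} {C C' : Set A} {U U' : ℕ → Set A}
    (h : tp k m C U = tp k m C' U') {i j : ℕ} (hi : i < m) (hj : j < m) :
    ((∃ x ∈ C, x ∈ U i ∧ x ∈ U j) ↔ ∃ x ∈ C', x ∈ U' i ∧ x ∈ U' j) ∧
    ((∃ x ∈ C, ∃ y ∈ C, x ∈ U i ∧ y ∈ U j ∧ x < y) ↔
      ∃ x ∈ C', ∃ y ∈ C', x ∈ U' i ∧ y ∈ U' j ∧ x < y) := by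
  induction k generalizing m U U' with
  | zero =>
    have h1 := Set.ext_iff.1 h (false, ⟨i, hi⟩, ⟨j, hj⟩)
    have h2 := Set.ext_iff.1 h (true, ⟨i, hi⟩, ⟨j, hj⟩)
    simp only [tp] at h1 h2
    constructor
    · simpa using h1
    · simpa using h2
  | succ k ih =>
    have h1 : tp k (m + 1) C (Function.update U m ∅) ∈ tp (k + 1) m C U := ⟨∅, rfl⟩
    rw [h] at h1
    obtain ⟨S, hS⟩ := h1
    have := ih hS.symm (by omega) (by omega)
    simpa [hi.ne, hj.ne] using this

theorem exists_tp_eq_of_tp_succ_eq {k m : ℕ} {C C' : Set A} {U U' : ℕ → Set A}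
    (h : tp (k + 1) m C U = tp (k + 1) m C' U') (S : Set A) :
    ∃ S', tp k (m + 1) C (Function.update U m S) = tp k (m + 1) C' (Function.update U' m S') := by
  have h1 : tp k (m + 1) C (Function.update U m S) ∈ tp (k + 1) m C U := ⟨S, rfl⟩
  rw [h] at h1
  obtain ⟨S', hS'⟩ := h1
  exact ⟨S', hS'.symm⟩

theorem tp_succ_eq_iff {k m : ℕ} {C C' : Set A} {U U' : ℕ → Set A} :
    tp (k + 1) m C U = tp (k + 1) m C' U' ↔
      (∀ S, ∃ S', tp k (m + 1) C (Function.update U m S) =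
        tp k (m + 1) C' (Function.update U' m S')) ∧
      ∀ S', ∃ S, tp k (m + 1) C (Function.update U m S) =
        tp k (m + 1) C' (Function.update U' m S') := by
  refine ⟨fun h => ⟨exists_tp_eq_of_tp_succ_eq h, fun S' => ?_⟩, fun ⟨h1, h2⟩ => ?_⟩
  · obtain ⟨S, hS⟩ := exists_tp_eq_of_tp_succ_eq h.symm S'
    exact ⟨S, hS.symm⟩
  · refine Set.ext fun t => ⟨?_, ?_⟩
    · rintro ⟨S, rfl⟩
      obtain ⟨S', hS'⟩ := h1 S
      exact ⟨S', hS'.symm⟩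
    · rintro ⟨S', rfl⟩
      obtain ⟨S, hS⟩ := h2 S'
      exact ⟨S, hS⟩

theorem tp_zero_eq_iff {m : ℕ} {C C' : Set A} {U U' : ℕ → Set A} :
    tp 0 m C U = tp 0 m C' U' ↔ ∀ i < m, ∀ j < m,
      ((∃ x ∈ C, x ∈ U i ∧ x ∈ U j) ↔ ∃ x ∈ C', x ∈ U' i ∧ x ∈ U' j) ∧
      ((∃ x ∈ C, ∃ y ∈ C, x ∈ U i ∧ y ∈ U j ∧ x < y) ↔
        ∃ x ∈ C', ∃ y ∈ C', x ∈ U' i ∧ y ∈ U' j ∧ x < y) := by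
  refine ⟨fun h i hi j hj => atoms_of_tp_eq h hi hj, fun h => Set.ext fun ⟨b, i, j⟩ => ?_⟩
  exact or_congr (and_congr Iff.rfl (h i i.2 j j.2).1) (and_congr Iff.rfl (h i i.2 j j.2).2)

end tp

/-! ## The algebra of types -/

namespace Ty

variable {k m : ℕ}

/-- Concatenation of types. -/
def mul (s t : Ty k m) : Ty k m := sum k m fun b : Bool => cond b t s

theorem mem_mul_succ {s t : Ty (k + 1) m} {x : Ty k (m + 1)} :
    x ∈ mul s t ↔
      ∃ a ∈ s, ∃ b ∈ t, mul a b = x := by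
  constructor
  · rintro ⟨f, hf, rfl⟩
    refine ⟨f false, hf false, f true, hf true, congrArg _ (funext fun b => ?_)⟩
    cases b <;> rfl
  · rintro ⟨a, ha, b, hb, rfl⟩
    refine ⟨fun c => cond c b a, fun c => ?_, rfl⟩
    cases c
    exacts [ha, hb]

theorem mem_sum_zero {J : Type} [LT J] {t : J → Ty 0 m} {b : Bool} {i j : Fin m} :
    (b, i, j) ∈ sum 0 m t ↔
      (∃ q, (b, i, j) ∈ t q) ∨ (b = true ∧ ∃ q q', q < q' ∧
        (false, i, i) ∈ t q ∧
        (false, j, j) ∈ t q') :=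
  Iff.rfl

theorem mem_mul_zero {s t : Ty 0 m} {b : Bool} {i j : Fin m} :
    (b, i, j) ∈ mul s t ↔
      ((b, i, j) ∈ s ∨
        (b, i, j) ∈ t) ∨
      (b = true ∧ (false, i, i) ∈ s ∧
        (false, j, j) ∈ t) := by
  rw [mul, mem_sum_zero]
  simp [Bool.exists_bool, show ¬ (true < false) by decide]

theorem mul_assoc (a b c : Ty k m) : mul (mul a b) c = mul a (mul b c) := by
  induction k generalizing m with
  | zero =>
    refine ext_zero fun d i j => ?_
    simp only [mem_mul_zero]
    simp only [Bool.false_eq_true, false_and, or_false]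
    tauto
  | succ k ih =>
    refine ext_succ fun x => ?_
    constructor
    · intro hx
      obtain ⟨y, hy, c', hc, rfl⟩ := mem_mul_succ.1 hx
      obtain ⟨a', ha, b', hb, rfl⟩ := mem_mul_succ.1 hy
      exact mem_mul_succ.2 ⟨a', ha, _, mem_mul_succ.2 ⟨b', hb, c', hc, rfl⟩, (ih _ _ _).symm⟩
    · intro hx
      obtain ⟨a', ha, y, hy, rfl⟩ := mem_mul_succ.1 hx
      obtain ⟨b', hb, c', hc, rfl⟩ := mem_mul_succ.1 hy
      exact mem_mul_succ.2 ⟨_, mem_mul_succ.2 ⟨a', ha, b', hb, rfl⟩, c', hc, ih _ _ _⟩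

theorem sum_nat_mul (a b : ℕ → Ty k m) :
    sum k m (fun i => mul (a i) (b i)) = mul (a 0) (sum k m fun i => mul (b i) (a (i + 1))) := by
  induction k generalizing m with
  | zero =>
    refine ext_zero fun d i j => ?_
    simp only [mem_mul_zero, mem_sum_zero]
    simp only [Bool.false_eq_true, false_and, or_false]
    constructor
    · rintro (⟨q, (h | h) | ⟨hd, h1, h2⟩⟩ | ⟨hd, q, q', hq, h1 | h1, h2 | h2⟩)
      · rcases q with _ | q
        exacts [.inl (.inl h), .inl (.inr (.inl ⟨q, .inl (.inr h)⟩))]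
      · exact .inl (.inr (.inl ⟨q, .inl (.inl h)⟩))
      · rcases q with _ | q
        · exact .inr ⟨hd, h1, 0, .inl h2⟩
        · exact .inl (.inr (.inr ⟨hd, q, q + 1, by omega, .inr h1, .inl h2⟩))
      · obtain ⟨r, rfl⟩ : ∃ r, q' = r + 1 := ⟨q' - 1, by omega⟩
        rcases q with _ | q
        · exact .inr ⟨hd, h1, r, .inr h2⟩
        · exact .inl (.inr (.inr ⟨hd, q, r, by omega, .inr h1, .inr h2⟩))
      · rcases q with _ | q
        · exact .inr ⟨hd, h1, q', .inl h2⟩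
        · exact .inl (.inr (.inr ⟨hd, q, q', by omega, .inr h1, .inl h2⟩))
      · obtain ⟨r, rfl⟩ : ∃ r, q' = r + 1 := ⟨q' - 1, by omega⟩
        rcases Nat.lt_or_ge q r with hqr | hqr
        · exact .inl (.inr (.inr ⟨hd, q, r, hqr, .inl h1, .inr h2⟩))
        · obtain rfl : q = r := by omega
          exact .inl (.inr (.inl ⟨q, .inr ⟨hd, h1, h2⟩⟩))
      · exact .inl (.inr (.inr ⟨hd, q, q', hq, .inl h1, .inl h2⟩))
    · rintro ((h | (⟨q, (h | h) | ⟨hd, h1, h2⟩⟩ | ⟨hd, q, q', hq, h1 | h1, h2 | h2⟩)) |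
        ⟨hd, h1, q, h2 | h2⟩)
      · exact .inl ⟨0, .inl (.inl h)⟩
      · exact .inl ⟨q, .inl (.inr h)⟩
      · exact .inl ⟨q + 1, .inl (.inl h)⟩
      · exact .inr ⟨hd, q, q + 1, by omega, .inr h1, .inl h2⟩
      · exact .inr ⟨hd, q, q', hq, .inr h1, .inr h2⟩
      · exact .inr ⟨hd, q, q' + 1, by omega, .inr h1, .inl h2⟩
      · rcases Nat.lt_or_ge (q + 1) q' with hqr | hqr
        · exact .inr ⟨hd, q + 1, q', hqr, .inl h1, .inr h2⟩
        · obtain rfl : q' = q + 1 := by omega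
          exact .inl ⟨q + 1, .inr ⟨hd, h1, h2⟩⟩
      · exact .inr ⟨hd, q + 1, q' + 1, by omega, .inl h1, .inl h2⟩
      · rcases q with _ | q
        · exact .inl ⟨0, .inr ⟨hd, h1, h2⟩⟩
        · exact .inr ⟨hd, 0, q + 1, by omega, .inl h1, .inr h2⟩
      · exact .inr ⟨hd, 0, q + 1, by omega, .inl h1, .inl h2⟩
  | succ k ih =>
    refine ext_succ fun x => ?_
    constructor
    · rintro ⟨s, hs, rfl⟩
      choose a' ha b' hb hab using fun q => mem_mul_succ.1 (hs q)
      obtain rfl : (fun q => mul (a' q) (b' q)) = s := funext hab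
      exact mem_mul_succ.2 ⟨a' 0, ha 0, _,
        ⟨_, fun q => mem_mul_succ.2 ⟨b' q, hb q, a' (q + 1), ha (q + 1), rfl⟩, rfl⟩, (ih _ _).symm⟩
    · intro hx
      obtain ⟨a0, ha0, y, ⟨s, hs, rfl⟩, rfl⟩ := mem_mul_succ.1 hx
      choose b' hb a' ha hab using fun q => mem_mul_succ.1 (hs q)
      obtain rfl : (fun q => mul (b' q) (a' q)) = s := funext hab
      let a'' : ℕ → Ty k (m + 1) := fun i => Nat.casesOn i a0 a'
      refine ⟨fun i => mul (a'' i) (b' i), fun q => mem_mul_succ.2 ⟨a'' q, ?_, b' q, hb q, rfl⟩,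
        ih a'' b'⟩
      rcases q with _ | q
      exacts [ha0, ha q]

theorem sum_natDual_mul (a b : ℕ → Ty k m) :
    sum k m (fun i : ℕᵒᵈ => mul (b (OrderDual.ofDual i)) (a (OrderDual.ofDual i))) =
      mul (sum k m fun i : ℕᵒᵈ => mul (a (OrderDual.ofDual i + 1)) (b (OrderDual.ofDual i)))
        (a 0) := by
  induction k generalizing m with
  | zero =>
    refine ext_zero fun d i j => ?_
    simp only [mem_mul_zero, mem_sum_zero]
    simp only [Bool.false_eq_true, false_and, or_false, OrderDual.exists, OrderDual.ofDual_toDual,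
      OrderDual.toDual_lt_toDual]
    constructor
    · rintro (⟨q, (h | h) | ⟨hd, h1, h2⟩⟩ | ⟨hd, q, q', hq, h1 | h1, h2 | h2⟩)
      · exact .inl (.inl (.inl ⟨q, .inl (.inr h)⟩))
      · rcases q with _ | q
        exacts [.inl (.inr h), .inl (.inl (.inl ⟨q, .inl (.inl h)⟩))]
      · rcases q with _ | q
        · exact .inr ⟨hd, ⟨0, .inr h1⟩, h2⟩
        · exact .inl (.inl (.inr ⟨hd, q + 1, q, by omega, .inr h1, .inl h2⟩))
      · exact .inl (.inl (.inr ⟨hd, q, q', by omega, .inr h1, .inr h2⟩))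
      · rcases q' with _ | q'
        · exact .inr ⟨hd, ⟨q, .inr h1⟩, h2⟩
        · exact .inl (.inl (.inr ⟨hd, q, q', by omega, .inr h1, .inl h2⟩))
      · obtain ⟨r, rfl⟩ : ∃ r, q = r + 1 := ⟨q - 1, by omega⟩
        rcases Nat.lt_or_ge q' r with hqr | hqr
        · exact .inl (.inl (.inr ⟨hd, r, q', hqr, .inl h1, .inr h2⟩))
        · obtain rfl : q' = r := by omega
          exact .inl (.inl (.inl ⟨q', .inr ⟨hd, h1, h2⟩⟩))
      · obtain ⟨r, rfl⟩ : ∃ r, q = r + 1 := ⟨q - 1, by omega⟩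
        rcases q' with _ | q'
        · exact .inr ⟨hd, ⟨r, .inl h1⟩, h2⟩
        · exact .inl (.inl (.inr ⟨hd, r, q', by omega, .inl h1, .inl h2⟩))
    · rintro (((⟨q, (h | h) | ⟨hd, h1, h2⟩⟩ | ⟨hd, q, q', hq, h1 | h1, h2 | h2⟩) | h) |
        ⟨hd, ⟨q, h1 | h1⟩, h2⟩)
      · exact .inl ⟨q + 1, .inl (.inr h)⟩
      · exact .inl ⟨q, .inl (.inl h)⟩
      · exact .inr ⟨hd, q + 1, q, by omega, .inr h1, .inl h2⟩
      · exact .inr ⟨hd, q + 1, q' + 1, by omega, .inr h1, .inr h2⟩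
      · exact .inr ⟨hd, q + 1, q', by omega, .inr h1, .inl h2⟩
      · rcases Nat.lt_or_ge (q' + 1) q with hqr | hqr
        · exact .inr ⟨hd, q, q' + 1, hqr, .inl h1, .inr h2⟩
        · obtain rfl : q = q' + 1 := by omega
          exact .inl ⟨q' + 1, .inr ⟨hd, h1, h2⟩⟩
      · exact .inr ⟨hd, q, q', hq, .inl h1, .inl h2⟩
      · exact .inl ⟨0, .inl (.inr h)⟩
      · exact .inr ⟨hd, q + 1, 0, by omega, .inr h1, .inr h2⟩
      · rcases q with _ | q
        · exact .inl ⟨0, .inr ⟨hd, h1, h2⟩⟩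
        · exact .inr ⟨hd, q + 1, 0, by omega, .inl h1, .inr h2⟩
  | succ k ih =>
    refine ext_succ fun x => ?_
    constructor
    · rintro ⟨s, hs, rfl⟩
      choose b' hb a' ha hab using fun q => mem_mul_succ.1 (hs q)
      obtain rfl : (fun q => mul (b' q) (a' q)) = s := funext hab
      exact mem_mul_succ.2 ⟨_, ⟨_, fun q => mem_mul_succ.2
        ⟨_, ha (OrderDual.toDual (OrderDual.ofDual q + 1)), _, hb q, rfl⟩, rfl⟩, _,
        ha (OrderDual.toDual 0),
        (ih (fun i => a' (OrderDual.toDual i)) fun i => b' (OrderDual.toDual i)).symm⟩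
    · intro hx
      obtain ⟨y, ⟨s, hs, rfl⟩, a0, ha0, rfl⟩ := mem_mul_succ.1 hx
      choose a' ha b' hb hab using fun q => mem_mul_succ.1 (hs q)
      obtain rfl : (fun q => mul (a' q) (b' q)) = s := funext hab
      let a'' : ℕ → Ty k (m + 1) := fun i => Nat.casesOn i a0 fun j => a' (OrderDual.toDual j)
      refine ⟨fun i => mul (b' i) (a'' (OrderDual.ofDual i)), fun q =>
        mem_mul_succ.2 ⟨b' q, hb q, a'' (OrderDual.ofDual q), ?_, rfl⟩,
        ih a'' fun i => b' (OrderDual.toDual i)⟩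
      rcases hq : OrderDual.ofDual q with _ | r
      exacts [ha0, ha (OrderDual.toDual r)]

end Ty

section

variable {A : Type} [LinearOrder A]

theorem tp_union {k m : ℕ} {C D : Set A} (U : ℕ → Set A) (h : ∀ x ∈ C, ∀ y ∈ D, x < y) :
    tp k m (C ∪ D) U = Ty.mul (tp k m C U) (tp k m D U) := by
  have h1 : C ∪ D = ⋃ b : Bool, cond b D C := by
    ext x
    simp [Set.mem_iUnion, Bool.exists_bool]
  rw [h1, tp_iUnion (J := Bool)]
  · refine congrArg _ (funext fun b => ?_)
    cases b <;> rfl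
  · intro i j hij
    cases i <;> cases j
    · exact absurd hij (by decide)
    · exact h
    · exact absurd hij (by decide)
    · exact absurd hij (by decide)

theorem tp_Ico_mul {k m : ℕ} (U : ℕ → Set A) {x y z : A} (hxy : x ≤ y) (hyz : y ≤ z) :
    tp k m (Set.Ico x z) U = Ty.mul (tp k m (Set.Ico x y) U) (tp k m (Set.Ico y z) U) := by
  rw [← tp_union U fun a ha b hb => lt_of_lt_of_le ha.2 hb.1, Set.Ico_union_Ico_eq_Ico hxy hyz]

end

/-! ## Types determine satisfaction -/

section satisfaction

variable {A : Type} [LinearOrder A]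

theorem eq_singleton_of_tp_eq {k m : ℕ} {U U' : ℕ → Set A}
    (h : tp k m Set.univ U = tp k m Set.univ U') {i : ℕ} (hi : i < m) {x : A} (hx : U i = {x}) :
    ∃ x', U' i = {x'} := by
  obtain ⟨h1, h2⟩ := atoms_of_tp_eq h hi hi
  simp only [Set.mem_univ, true_and, hx, Set.mem_singleton_iff, and_self] at h1 h2
  obtain ⟨x', hx'⟩ := h1.1 ⟨x, rfl⟩
  refine ⟨x', Set.eq_singleton_iff_unique_mem.2 ⟨hx', fun y hy => ?_⟩⟩
  have hno : ¬ ∃ x ∈ U' i, ∃ y ∈ U' i, x < y := by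
    rintro ⟨a, ha, b, hb, hab⟩
    obtain ⟨c, d, rfl, rfl, hlt⟩ := h2.2 ⟨a, b, ha, hb, hab⟩
    exact absurd hlt (lt_irrefl _)
  rcases lt_trichotomy y x' with hlt | heq | hlt
  · exact absurd ⟨y, hy, x', hx', hlt⟩ hno
  · exact heq
  · exact absurd ⟨x', hx', y, hy, hlt⟩ hno

theorem sat_iff_of_tp_eq {N : ℕ} {r : A → A → Prop}
    (hr : (∀ x y, r x y ↔ x < y) ∨ ∀ x y, r x y ↔ y < x) (φ : MSO N) {k m : ℕ}
    {U U' : ℕ → Set A} (h : tp k m Set.univ U = tp k m Set.univ U') (hk : qd φ ≤ k)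
    {P P' : Fin N → Set A} {v v' : ℕ → A} {V V' : ℕ → Set A} (a b : ℕ → ℕ) (c : Fin N → ℕ)
    (ha : ∀ i ∈ fv1 φ, a i < m ∧ U (a i) = {v i} ∧ U' (a i) = {v' i})
    (hb : ∀ j ∈ fv2 φ, b j < m ∧ U (b j) = V j ∧ U' (b j) = V' j)
    (hc : ∀ l, c l < m ∧ U (c l) = P l ∧ U' (c l) = P' l) :
    Sat r P v V φ ↔ Sat r P' v' V' φ := by
  induction φ generalizing k m U U' v v' V V' a b with
  | lt i j =>
    obtain ⟨him, hi, hi'⟩ := ha i (by simp [fv1])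
    obtain ⟨hjm, hj, hj'⟩ := ha j (by simp [fv1])
    rcases hr with hr | hr
    · simpa [Sat, hr, hi, hi', hj, hj'] using (atoms_of_tp_eq h him hjm).2
    · simpa [Sat, hr, hi, hi', hj, hj'] using (atoms_of_tp_eq h hjm him).2
  | pred l i =>
    obtain ⟨him, hi, hi'⟩ := ha i (by simp [fv1])
    obtain ⟨hlm, hl, hl'⟩ := hc l
    simpa [Sat, hi, hi', hl, hl'] using (atoms_of_tp_eq h him hlm).1
  | mem i j =>
    obtain ⟨him, hi, hi'⟩ := ha i (by simp [fv1])
    obtain ⟨hlm, hl, hl'⟩ := hb j (by simp [fv2])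
    simpa [Sat, hi, hi', hl, hl'] using (atoms_of_tp_eq h him hlm).1
  | not φ ih => exact not_congr (ih h hk a b ha hb hc)
  | and φ ψ ih1 ih2 =>
    simp only [qd, max_le_iff] at hk
    simp only [fv1, fv2, Finset.mem_union] at ha hb
    exact and_congr (ih1 h hk.1 a b (fun i hi => ha i (.inl hi)) (fun i hi => hb i (.inl hi)) hc)
      (ih2 h hk.2 a b (fun i hi => ha i (.inr hi)) (fun i hi => hb i (.inr hi)) hc)
  | ex1 i φ ih =>
    obtain ⟨k, rfl⟩ : ∃ l, k = l + 1 := ⟨k - 1, by simp only [qd] at hk; omega⟩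
    simp only [qd, add_le_add_iff_right] at hk
    have key : ∀ x x', tp k (m + 1) Set.univ (Function.update U m {x}) =
        tp k (m + 1) Set.univ (Function.update U' m {x'}) →
        (Sat r P (Function.update v i x) V φ ↔ Sat r P' (Function.update v' i x') V' φ) := by
      intro x x' hxx
      refine ih hxx hk (Function.update a i m) b (fun j hj => ?_) (fun j hj => ?_) fun l => ?_
      · rcases eq_or_ne j i with rfl | hji
        · simp
        · obtain ⟨h1, h2, h3⟩ := ha j (by simp [fv1, hj, hji])
          simp [hji, h1.ne, h2, h3, h1.le]
      · obtain ⟨h1, h2, h3⟩ := hb j hj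
        simp [h1.ne, h2, h3, Nat.lt_succ_of_lt h1]
      · obtain ⟨h1, h2, h3⟩ := hc l
        simp [h1.ne, h2, h3, Nat.lt_succ_of_lt h1]
    obtain ⟨h1, h2⟩ := tp_succ_eq_iff.1 h
    constructor
    · rintro ⟨x, hx⟩
      obtain ⟨S', hS'⟩ := h1 {x}
      obtain ⟨x', hx'⟩ := eq_singleton_of_tp_eq hS' (Nat.lt_succ_self m) (x := x) (by simp)
      obtain rfl : S' = {x'} := by simpa using hx'
      exact ⟨x', (key x x' hS').1 hx⟩
    · rintro ⟨x', hx'⟩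
      obtain ⟨S, hS⟩ := h2 {x'}
      obtain ⟨x, hx⟩ := eq_singleton_of_tp_eq hS.symm (Nat.lt_succ_self m) (x := x') (by simp)
      obtain rfl : S = {x} := by simpa using hx
      exact ⟨x, (key x x' hS).2 hx'⟩
  | ex2 j φ ih =>
    obtain ⟨k, rfl⟩ : ∃ l, k = l + 1 := ⟨k - 1, by simp only [qd] at hk; omega⟩
    simp only [qd, add_le_add_iff_right] at hk
    have key : ∀ S S', tp k (m + 1) Set.univ (Function.update U m S) =
        tp k (m + 1) Set.univ (Function.update U' m S') →
        (Sat r P v (Function.update V j S) φ ↔ Sat r P' v' (Function.update V' j S') φ) := by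
      intro x x' hxx
      refine ih hxx hk a (Function.update b j m) (fun i hi => ?_) (fun i hi => ?_) fun l => ?_
      · obtain ⟨h1, h2, h3⟩ := ha i hi
        simp [h1.ne, h2, h3, Nat.lt_succ_of_lt h1]
      · rcases eq_or_ne i j with rfl | hji
        · simp
        · obtain ⟨h1, h2, h3⟩ := hb i (by simp [fv2, hi, hji])
          simp [hji, h1.ne, h2, h3, h1.le]
      · obtain ⟨h1, h2, h3⟩ := hc l
        simp [h1.ne, h2, h3, Nat.lt_succ_of_lt h1]
    obtain ⟨h1, h2⟩ := tp_succ_eq_iff.1 h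
    constructor
    · rintro ⟨S, hS⟩
      obtain ⟨S', hS'⟩ := h1 S
      exact ⟨S', (key S S' hS').1 hS⟩
    · rintro ⟨S', hS'⟩
      obtain ⟨S, hS⟩ := h2 S'
      exact ⟨S, (key S S' hS).2 hS'⟩

/-- The labels `P`, followed by the label `X`. -/
def lab {n : ℕ} (P : Fin n → Set A) (X : Set A) (i : ℕ) : Set A :=
  if h : i < n then P ⟨i, h⟩ else X

theorem trueIn_iff_of_tp_eq {n : ℕ} {r : A → A → Prop}
    (hr : (∀ x y, r x y ↔ x < y) ∨ ∀ x y, r x y ↔ y < x) {P : Fin n → Set A} {X Y : Set A}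
    {φ : MSO (n + 1)} (hφ : IsSentence φ) {k : ℕ} (hk : qd φ ≤ k)
    (h : tp k (n + 1) Set.univ (lab P X) = tp k (n + 1) Set.univ (lab P Y))
    (v v' : ℕ → A) (V V' : ℕ → Set A) :
    Sat r (Fin.snoc P X : Fin (n + 1) → Set A) v V φ ↔
      Sat r (Fin.snoc P Y : Fin (n + 1) → Set A) v' V' φ := by
  refine sat_iff_of_tp_eq hr φ h hk id id Fin.val (by simp [hφ.1]) (by simp [hφ.2]) fun l => ?_
  refine Fin.lastCases ?_ (fun l => ?_) l
  · simp [lab]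
  · simp [lab, Nat.lt_succ_of_lt l.2]

theorem not_definable_of_tp_eq {n : ℕ} {r : A → A → Prop}
    (hr : (∀ x y, r x y ↔ x < y) ∨ ∀ x y, r x y ↔ y < x) {P : Fin n → Set A} {Q : Set A}
    (h : ∀ k, ∃ X ≠ Q, tp k (n + 1) Set.univ (lab P X) = tp k (n + 1) Set.univ (lab P Q)) :
    ¬ Definable r P Q := by
  rintro ⟨φ, h1, h2, h3⟩
  obtain ⟨X, hne, hX⟩ := h (qd φ + 1)
  refine hne (Set.ext fun a => ?_)
  obtain ⟨S, hS⟩ := exists_tp_eq_of_tp_succ_eq hX {a}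
  obtain ⟨a', ha'⟩ := eq_singleton_of_tp_eq hS (Nat.lt_succ_self _) (x := a) (by simp)
  obtain rfl : S = {a'} := by simpa using ha'
  have e1 : a ∈ X ↔ a' ∈ Q := by
    simpa [lab] using (atoms_of_tp_eq hS (show n + 1 < n + 1 + 1 by omega)
      (show n < n + 1 + 1 by omega)).1
  rw [e1, h3, h3]
  refine forall_congr' fun v => forall_congr' fun V => ?_
  refine (sat_iff_of_tp_eq hr φ hS le_rfl (fun _ => n + 1) id Fin.val (fun i hi => ?_)
    (by simp [h2]) fun l => ?_).symm
  · obtain rfl : i = 0 := by simpa using h1 hi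
    simp
  · have := l.2
    have h4 : (l : ℕ) ≠ n + 1 := by omega
    simp [lab, h4]
    omega

end satisfaction

/-! ## Many-one reductions -/

theorem RecursiveIn.of_partrec {O f : ℕ →. ℕ} (hf : Nat.Partrec f) : RecursiveIn O f := by
  induction hf with
  | zero => exact .zero
  | succ => exact .succ
  | left => exact .left
  | right => exact .right
  | pair _ _ h1 h2 => exact .pair h1 h2
  | comp _ _ h1 h2 => exact .comp h1 h2
  | prec _ _ h1 h2 => exact .prec h1 h2
  | rfind _ h => exact .rfind h

theorem TuringRed.of_preimage {S T : Set ℕ} {f : ℕ → ℕ} (hf : Primrec f)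
    (h : ∀ c, c ∈ S ↔ f c ∈ T) : TuringRed S T := by
  have h1 := RecursiveIn.comp (O := chi T) .oracle (.of_partrec (Partrec.nat_iff.1 hf.to_comp))
  have h2 : chi S = fun c => (f : ℕ →. ℕ) c >>= chi T := by
    funext c
    refine Eq.trans ?_ (Part.bind_some (f c) (chi T)).symm
    by_cases hc : f c ∈ T
    · simp [chi, hc, (h c).2 hc]
    · simp [chi, hc, mt (h c).1 hc]
  rw [TuringRed, h2]
  exact h1

theorem DecidableSet.of_preimage {S T : Set ℕ} {f : ℕ → ℕ} (hf : Primrec f)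
    (h : ∀ c, c ∈ S ↔ f c ∈ T) (hT : DecidableSet T) : DecidableSet S :=
  ComputablePred.computable_of_manyOneReducible ⟨f, hf.to_comp, h⟩ hT

namespace MSO

variable {n : ℕ}

/-! ## Codes of formulas -/

theorem encode_injective : Function.Injective (encode : MSO n → ℕ) := by
  intro φ
  induction φ with
  | lt i j => intro ψ h; cases ψ <;> simp_all [encode]
  | pred l i => intro ψ h; cases ψ <;> simp_all [encode, Fin.ext_iff]
  | mem i j => intro ψ h; cases ψ <;> simp_all [encode]
  | not φ ih =>
    intro ψ h
    cases ψ <;> simp [encode] at h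
    rw [ih h]
  | and φ ψ ih1 ih2 =>
    intro ψ h
    cases ψ <;> simp [encode] at h
    rw [ih1 h.1, ih2 h.2]
  | ex1 i φ ih =>
    intro ψ h
    cases ψ <;> simp [encode] at h
    rw [h.1, ih h.2]
  | ex2 i φ ih =>
    intro ψ h
    cases ψ <;> simp [encode] at h
    rw [h.1, ih h.2]

theorem qd_le_encode (φ : MSO n) : qd φ ≤ encode φ := by
  induction φ with
  | lt i j => exact Nat.zero_le _
  | pred l i => exact Nat.zero_le _
  | mem i j => exact Nat.zero_le _
  | not φ ih => exact ih.trans (Nat.right_le_pair _ _)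
  | and φ ψ ih1 ih2 =>
    have h := Nat.right_le_pair 4 (Nat.pair (encode φ) (encode ψ))
    exact max_le ((ih1.trans (Nat.left_le_pair _ _)).trans h)
      ((ih2.trans (Nat.right_le_pair _ _)).trans h)
  | ex1 i φ ih =>
    have h := Nat.add_le_pair 5 (Nat.pair i (encode φ))
    have h' := Nat.right_le_pair i (encode φ)
    simp only [qd, encode]
    omega
  | ex2 i φ ih =>
    have h := Nat.add_le_pair 6 (Nat.pair i (encode φ))
    have h' := Nat.right_le_pair i (encode φ)
    simp only [qd, encode]
    omega

theorem le_encode_of_mem_fv (φ : MSO n) :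
    (∀ i ∈ fv1 φ, i ≤ encode φ) ∧ ∀ j ∈ fv2 φ, j ≤ encode φ := by
  induction φ with
  | lt i j =>
    have h := Nat.right_le_pair 0 (Nat.pair i j)
    have h1 := Nat.left_le_pair i j
    have h2 := Nat.right_le_pair i j
    simp only [fv1, fv2, encode, Finset.mem_insert, Finset.mem_singleton, Finset.notMem_empty]
    exact ⟨by rintro _ (rfl | rfl) <;> omega, by simp⟩
  | pred l i =>
    have h := Nat.right_le_pair 1 (Nat.pair l i)
    have h2 := Nat.right_le_pair l i
    simp only [fv1, fv2, encode, Finset.mem_singleton, Finset.notMem_empty]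
    exact ⟨by rintro _ rfl; omega, by simp⟩
  | mem i j =>
    have h := Nat.right_le_pair 2 (Nat.pair i j)
    have h1 := Nat.left_le_pair i j
    have h2 := Nat.right_le_pair i j
    simp only [fv1, fv2, encode, Finset.mem_singleton]
    exact ⟨by rintro _ rfl; omega, by rintro _ rfl; omega⟩
  | not φ ih =>
    have h := Nat.right_le_pair 3 (encode φ)
    exact ⟨fun i hi => (ih.1 i hi).trans h, fun i hi => (ih.2 i hi).trans h⟩
  | and φ ψ ih1 ih2 =>
    have h := Nat.right_le_pair 4 (Nat.pair (encode φ) (encode ψ))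
    have h1 := (Nat.left_le_pair _ _).trans h
    have h2 := (Nat.right_le_pair _ _).trans h
    simp only [fv1, fv2, Finset.mem_union]
    exact ⟨fun i hi => hi.elim (fun hi => (ih1.1 i hi).trans h1) fun hi => (ih2.1 i hi).trans h2,
      fun i hi => hi.elim (fun hi => (ih1.2 i hi).trans h1) fun hi => (ih2.2 i hi).trans h2⟩
  | ex1 i φ ih =>
    have h := (Nat.right_le_pair i (encode φ)).trans (Nat.right_le_pair 5 (Nat.pair i (encode φ)))
    simp only [fv1, fv2, Finset.mem_sdiff]
    exact ⟨fun i hi => (ih.1 i hi.1).trans h, fun i hi => (ih.2 i hi).trans h⟩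
  | ex2 i φ ih =>
    have h := (Nat.right_le_pair i (encode φ)).trans (Nat.right_le_pair 6 (Nat.pair i (encode φ)))
    simp only [fv1, fv2, Finset.mem_sdiff]
    exact ⟨fun i hi => (ih.1 i hi).trans h, fun i hi => (ih.2 i hi.1).trans h⟩

/-! ## Replacing the last predicate by a set variable -/

/-- Replace the last predicate by the set variable `0`, shifting all other set variables. -/
def unlabel : MSO (n + 1) → MSO n
  | lt i j => lt i j
  | pred l i => if h : (l : ℕ) < n then pred ⟨l, h⟩ i else mem i 0
  | mem i j => mem i (j + 1)
  | not φ => not (unlabel φ)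
  | and φ ψ => and (unlabel φ) (unlabel ψ)
  | ex1 i φ => ex1 i (unlabel φ)
  | ex2 j φ => ex2 (j + 1) (unlabel φ)

theorem sat_unlabel {A : Type} {r : A → A → Prop} {P : Fin n → Set A} (φ : MSO (n + 1))
    (v : ℕ → A) (V : ℕ → Set A) : Sat r P v V (unlabel φ) ↔
      Sat r (Fin.snoc P (V 0) : Fin (n + 1) → Set A) v (fun j => V (j + 1)) φ := by
  induction φ generalizing v V with
  | lt i j => rfl
  | pred l i =>
    refine Fin.lastCases ?_ (fun l => ?_) l
    · simp [unlabel, Sat]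
    · simp [unlabel, Sat]
  | mem i j => rfl
  | not φ ih => exact not_congr (ih v V)
  | and φ ψ ih1 ih2 => exact and_congr (ih1 v V) (ih2 v V)
  | ex1 i φ ih => exact exists_congr fun x => ih _ V
  | ex2 j φ ih =>
    refine exists_congr fun S => (ih v _).trans ?_
    have : (fun i => Function.update V (j + 1) S (i + 1)) =
        Function.update (fun i => V (i + 1)) j S := by
      funext i
      simp [Function.update_apply]
    rw [this, Function.update_of_ne (by omega)]

theorem fv1_unlabel (φ : MSO (n + 1)) : fv1 (unlabel φ) = fv1 φ := by
  induction φ with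
  | lt i j => rfl
  | pred l i => by_cases h : (l : ℕ) < n <;> simp [unlabel, h, fv1]
  | mem i j => rfl
  | not φ ih => exact ih
  | and φ ψ ih1 ih2 => simp [unlabel, fv1, ih1, ih2]
  | ex1 i φ ih => simp [unlabel, fv1, ih]
  | ex2 j φ ih => exact ih

theorem mem_fv2_unlabel (φ : MSO (n + 1)) (i : ℕ) : i + 1 ∈ fv2 (unlabel φ) ↔ i ∈ fv2 φ := by
  induction φ with
  | lt i j => simp [unlabel, fv2]
  | pred l i => by_cases h : (l : ℕ) < n <;> simp [unlabel, h, fv2]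
  | mem i j => simp [unlabel, fv2]
  | not φ ih => exact ih
  | and φ ψ ih1 ih2 => simp [unlabel, fv2, ih1, ih2]
  | ex1 i φ ih => exact ih
  | ex2 j φ ih => simp [unlabel, fv2, ih]

/-- The action of `unlabel` on codes, sending numbers that are not codes to such numbers. -/
def unlabelCode (n : ℕ) (c : ℕ) : ℕ :=
  if c.unpair.1 = 0 then c
  else if c.unpair.1 = 1 then
    if c.unpair.2.unpair.1 < n then c
    else if c.unpair.2.unpair.1 = n then Nat.pair 2 (Nat.pair c.unpair.2.unpair.2 0)
    else Nat.pair 7 0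
  else if c.unpair.1 = 2 then
    Nat.pair 2 (Nat.pair c.unpair.2.unpair.1 (c.unpair.2.unpair.2 + 1))
  else if h : 3 ≤ c.unpair.1 then
    have hlt : c.unpair.2 < c := by
      have := Nat.add_le_pair c.unpair.1 c.unpair.2
      rw [Nat.pair_unpair] at this
      omega
    have hlt1 : c.unpair.2.unpair.1 < c := (Nat.unpair_left_le _).trans_lt hlt
    have hlt2 : c.unpair.2.unpair.2 < c := (Nat.unpair_right_le _).trans_lt hlt
    if c.unpair.1 = 3 then Nat.pair 3 (unlabelCode n c.unpair.2)
    else if c.unpair.1 = 4 then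
      Nat.pair 4 (Nat.pair (unlabelCode n c.unpair.2.unpair.1) (unlabelCode n c.unpair.2.unpair.2))
    else if c.unpair.1 = 5 then
      Nat.pair 5 (Nat.pair c.unpair.2.unpair.1 (unlabelCode n c.unpair.2.unpair.2))
    else if c.unpair.1 = 6 then
      Nat.pair 6 (Nat.pair (c.unpair.2.unpair.1 + 1) (unlabelCode n c.unpair.2.unpair.2))
    else Nat.pair 7 0
  else Nat.pair 7 0
termination_by c

theorem encode_unlabel (φ : MSO (n + 1)) : encode (unlabel φ) = unlabelCode n (encode φ) := by
  induction φ with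
  | lt i j => rw [unlabelCode]; simp [unlabel, encode]
  | pred l i =>
    rw [unlabelCode]
    by_cases h : (l : ℕ) < n
    · simp [unlabel, encode, h]
    · have h' : (l : ℕ) = n := by omega
      simp [unlabel, encode, h']
  | mem i j => rw [unlabelCode]; simp [unlabel, encode]
  | not φ ih => rw [encode, unlabelCode]; simp [unlabel, encode, ih]
  | and φ ψ ih1 ih2 => rw [encode, unlabelCode]; simp [unlabel, encode, ih1, ih2]
  | ex1 i φ ih => rw [encode, unlabelCode]; simp [unlabel, encode, ih]
  | ex2 j φ ih => rw [encode, unlabelCode]; simp [unlabel, encode, ih]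

theorem exists_of_encode_eq_unlabelCode (c : ℕ) (ψ : MSO n) (h : encode ψ = unlabelCode n c) :
    ∃ φ : MSO (n + 1), encode φ = c := by
  induction c using Nat.strong_induction_on generalizing ψ with
  | _ c ih =>
  obtain ⟨t, x, rfl⟩ : ∃ t x, c = Nat.pair t x := ⟨_, _, (Nat.pair_unpair c).symm⟩
  obtain ⟨i, j, rfl⟩ : ∃ i j, x = Nat.pair i j := ⟨_, _, (Nat.pair_unpair x).symm⟩
  have hlt := Nat.add_le_pair t (Nat.pair i j)
  have hlt1 := Nat.left_le_pair i j
  have hlt2 := Nat.right_le_pair i j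
  rw [unlabelCode] at h
  simp only [Nat.unpair_pair] at h
  have invalid : encode ψ ≠ Nat.pair 7 0 := by cases ψ <;> simp [encode]
  split_ifs at h with h0 h1 h2 h2 h2 h3 h3 h4 h5 h6
  · exact ⟨lt i j, by simp [encode, h0]⟩
  · exact ⟨pred ⟨i, by omega⟩ j, by simp [encode, h1]⟩
  · exact ⟨pred ⟨i, by omega⟩ j, by simp [encode, h1]⟩
  · exact absurd h invalid
  · exact ⟨mem i j, by simp [encode, h2]⟩
  · cases ψ <;> simp [encode] at h
    obtain ⟨φ, hφ⟩ := ih _ (by omega) _ h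
    exact ⟨not φ, by simp [encode, hφ, h3]⟩
  · cases ψ <;> simp [encode] at h
    obtain ⟨φ, hφ⟩ := ih _ (by omega) _ h.1
    obtain ⟨φ', hφ'⟩ := ih _ (by omega) _ h.2
    exact ⟨and φ φ', by simp [encode, hφ, hφ', h4]⟩
  · cases ψ <;> simp [encode] at h
    obtain ⟨φ, hφ⟩ := ih _ (by omega) _ h.2
    exact ⟨ex1 i φ, by simp [encode, hφ, h5]⟩
  · cases ψ <;> simp [encode] at h
    obtain ⟨φ, hφ⟩ := ih _ (by omega) _ h.2
    exact ⟨ex2 i φ, by simp [encode, hφ, h6]⟩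
  · exact absurd h invalid
  · exact absurd h invalid

theorem primrec_unlabelCode (n : ℕ) : Primrec (unlabelCode n) := by
  let g : List ℕ → ℕ := fun l =>
    let c := l.length
    if c.unpair.1 = 0 then c
    else if c.unpair.1 = 1 then
      if c.unpair.2.unpair.1 < n then c
      else if c.unpair.2.unpair.1 = n then Nat.pair 2 (Nat.pair c.unpair.2.unpair.2 0)
      else Nat.pair 7 0
    else if c.unpair.1 = 2 then
      Nat.pair 2 (Nat.pair c.unpair.2.unpair.1 (c.unpair.2.unpair.2 + 1))
    else if c.unpair.1 = 3 then Nat.pair 3 (l.getD c.unpair.2 0)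
    else if c.unpair.1 = 4 then
      Nat.pair 4 (Nat.pair (l.getD c.unpair.2.unpair.1 0) (l.getD c.unpair.2.unpair.2 0))
    else if c.unpair.1 = 5 then
      Nat.pair 5 (Nat.pair c.unpair.2.unpair.1 (l.getD c.unpair.2.unpair.2 0))
    else if c.unpair.1 = 6 then
      Nat.pair 6 (Nat.pair (c.unpair.2.unpair.1 + 1) (l.getD c.unpair.2.unpair.2 0))
    else Nat.pair 7 0
  have hg : Primrec g := by
    have hc : Primrec fun l : List ℕ => l.length := Primrec.list_length
    have h1 : Primrec fun l : List ℕ => l.length.unpair.1 :=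
      Primrec.fst.comp (Primrec.unpair.comp hc)
    have h2 : Primrec fun l : List ℕ => l.length.unpair.2 :=
      Primrec.snd.comp (Primrec.unpair.comp hc)
    have h21 : Primrec fun l : List ℕ => l.length.unpair.2.unpair.1 :=
      Primrec.fst.comp (Primrec.unpair.comp h2)
    have h22 : Primrec fun l : List ℕ => l.length.unpair.2.unpair.2 :=
      Primrec.snd.comp (Primrec.unpair.comp h2)
    have hget {f : List ℕ → ℕ} (hf : Primrec f) : Primrec fun l : List ℕ => l.getD (f l) 0 :=
      (Primrec.list_getD 0).comp Primrec.id hf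
    have heq (t : ℕ) : PrimrecPred fun l : List ℕ => l.length.unpair.1 = t :=
      Primrec.eq.comp h1 (Primrec.const t)
    have hp (t : ℕ) {f : List ℕ → ℕ} (hf : Primrec f) : Primrec fun l => Nat.pair t (f l) :=
      Primrec₂.natPair.comp (Primrec.const t) hf
    have hpp (t : ℕ) {f f' : List ℕ → ℕ} (hf : Primrec f) (hf' : Primrec f') :
        Primrec fun l => Nat.pair t (Nat.pair (f l) (f' l)) :=
      hp t (Primrec₂.natPair.comp hf hf')
    refine .ite (heq 0) hc (.ite (heq 1) (.ite (Primrec.nat_lt.comp h21 (.const n)) hc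
      (.ite (Primrec.eq.comp h21 (.const n)) (hpp 2 h22 (.const 0)) (.const _)))
      (.ite (heq 2) (hpp 2 h21 (Primrec.succ.comp h22)) (.ite (heq 3) (hp 3 (hget h2))
      (.ite (heq 4) (hpp 4 (hget h21) (hget h22)) (.ite (heq 5) (hpp 5 h21 (hget h22))
      (.ite (heq 6) (hpp 6 (Primrec.succ.comp h21) (hget h22)) (.const _)))))))
  have key := Primrec.nat_strong_rec (α := Unit) (fun _ => unlabelCode n)
    (g := fun _ l => some (g l)) (Primrec.option_some.comp (hg.comp Primrec.snd)) (fun _ c => by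
      have hget : ∀ x < c, ((List.range c).map (unlabelCode n)).getD x 0 = unlabelCode n x := by
        intro x hx
        simp [List.getD, hx]
      have hlt := Nat.add_le_pair c.unpair.1 c.unpair.2
      rw [Nat.pair_unpair] at hlt
      have hlt1 := Nat.unpair_left_le c.unpair.2
      have hlt2 := Nat.unpair_right_le c.unpair.2
      rw [unlabelCode]
      simp only [g, List.length_map, List.length_range, Option.some.injEq]
      split_ifs <;> first | rfl | omega | skip
      · rw [hget _ (by omega)]
      · rw [hget _ (by omega), hget _ (by omega)]
      · rw [hget _ (by omega)]
      · rw [hget _ (by omega)])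
  exact key.comp (Primrec.const ()) Primrec.id

end MSO

/-! ## Uniformly definable families of relations -/

/-- The family of relations `R a`, with `a` in a coded type, is defined by formulas whose codes
depend primitive recursively on `a`. -/
def CD {A : Type} {n : ℕ} (r : A → A → Prop) (P : Fin n → Set A) {α : Type} [Primcodable α]
    (R : α → (ℕ → A) → (ℕ → Set A) → Prop) : Prop :=
  ∃ f : α → MSO n, Primrec (fun a => encode (f a)) ∧ ∀ a v V, Sat r P v V (f a) ↔ R a v V

namespace CD

variable {A : Type} {n : ℕ} {r : A → A → Prop} {P : Fin n → Set A} {α β : Type} [Primcodable α]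
  [Primcodable β] {R R' : α → (ℕ → A) → (ℕ → Set A) → Prop}

theorem primrec_tag {f : α → ℕ} (t : ℕ) (hf : Primrec f) : Primrec fun a => Nat.pair t (f a) :=
  Primrec₂.natPair.comp (Primrec.const t) hf

theorem primrec_tag₂ {f g : α → ℕ} (t : ℕ) (hf : Primrec f) (hg : Primrec g) :
    Primrec fun a => Nat.pair t (Nat.pair (f a) (g a)) :=
  primrec_tag t (Primrec₂.natPair.comp hf hg)

theorem congr (h : CD r P R) (h' : ∀ a v V, R a v V ↔ R' a v V) : CD r P R' :=
  let ⟨f, hf, H⟩ := h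
  ⟨f, hf, fun a v V => (H a v V).trans (h' a v V)⟩

theorem comp (h : CD r P R) {g : β → α} (hg : Primrec g) : CD r P fun b => R (g b) :=
  let ⟨f, hf, H⟩ := h
  ⟨fun b => f (g b), hf.comp hg, fun b => H (g b)⟩

theorem not (h : CD r P R) : CD r P fun a v V => ¬ R a v V :=
  let ⟨f, hf, H⟩ := h
  ⟨fun a => .not (f a), primrec_tag 3 hf, fun a v V => not_congr (H a v V)⟩

theorem and (h : CD r P R) (h' : CD r P R') : CD r P fun a v V => R a v V ∧ R' a v V :=
  let ⟨f, hf, H⟩ := h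
  let ⟨f', hf', H'⟩ := h'
  ⟨fun a => .and (f a) (f' a), primrec_tag₂ 4 hf hf', fun a v V => and_congr (H a v V) (H' a v V)⟩

theorem imp (h : CD r P R) (h' : CD r P R') : CD r P fun a v V => R a v V → R' a v V :=
  (h.and h'.not).not.congr fun a v V => by tauto

theorem or (h : CD r P R) (h' : CD r P R') : CD r P fun a v V => R a v V ∨ R' a v V :=
  (h.not.imp h').congr fun a v V => by tauto

theorem iff (h : CD r P R) (h' : CD r P R') : CD r P fun a v V => (R a v V ↔ R' a v V) :=
  ((h.imp h').and (h'.imp h)).congr fun a v V => by tauto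

theorem ex1 (i : ℕ) (h : CD r P R) : CD r P fun a v V => ∃ x, R a (Function.update v i x) V :=
  let ⟨f, hf, H⟩ := h
  ⟨fun a => .ex1 i (f a), primrec_tag₂ 5 (.const i) hf, fun a _ V => exists_congr fun _ => H a _ V⟩

theorem ex2 (j : ℕ) (h : CD r P R) : CD r P fun a v V => ∃ S, R a v (Function.update V j S) :=
  let ⟨f, hf, H⟩ := h
  ⟨fun a => .ex2 j (f a), primrec_tag₂ 6 (.const j) hf, fun a v _ => exists_congr fun _ => H a v _⟩

theorem all1 (i : ℕ) (h : CD r P R) : CD r P fun a v V => ∀ x, R a (Function.update v i x) V :=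
  (h.not.ex1 i).not.congr fun a v V => by simp

theorem all2 (j : ℕ) (h : CD r P R) : CD r P fun a v V => ∀ S, R a v (Function.update V j S) :=
  (h.not.ex2 j).not.congr fun a v V => by simp

theorem rel (i j : ℕ) : CD r P fun (_ : α) v _ => r (v i) (v j) :=
  ⟨fun _ => .lt i j, .const _, fun _ _ _ => Iff.rfl⟩

theorem mem (i j : ℕ) : CD r P fun (_ : α) v V => v i ∈ V j :=
  ⟨fun _ => .mem i j, .const _, fun _ _ _ => Iff.rfl⟩

theorem true : CD r P fun (_ : α) _ _ => True :=
  ((mem (r := r) (P := P) 0 0).and (mem 0 0).not).not.congr fun a v V => by tauto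

/-- Membership in the `l`-th label, where labels with index at least `n` are set variables. -/
theorem mem_lab {l j : α → ℕ} (hl : Primrec l) (i : ℕ) (hj : Primrec j) :
    CD r P fun a v V => v i ∈ if h : l a < n then P ⟨l a, h⟩ else V (j a) := by
  refine ⟨fun a => if h : l a < n then .pred ⟨l a, h⟩ i else .mem i (j a), ?_, ?_⟩
  · refine (Primrec.ite (Primrec.nat_lt.comp hl (.const n)) (primrec_tag₂ 1 hl (.const i))
      (primrec_tag₂ 2 (.const i) hj)).of_eq fun a => ?_
    by_cases h : l a < n <;> simp [h, encode]
  · intro a v V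
    by_cases h : l a < n <;> simp [h, Sat]

theorem subst2 (i j : ℕ) (h : CD r P R) :
    CD r P fun a v V => R a v (Function.update V i (V j)) := by
  rcases eq_or_ne i j with rfl | hij
  · simpa using h
  · refine (((((mem 0 i).iff (mem 0 j)).all1 0).and h).ex2 i).congr fun a v V => ?_
    simp [hij.symm, ← Set.ext_iff]

/-- Primitive recursion on formulas. -/
theorem natRec {R : α → ℕ → (ℕ → A) → (ℕ → Set A) → Prop} {d : α → ℕ} (hd : Primrec d)
    (h0 : CD r P fun a => R a 0) (T : α → ℕ → MSO n → MSO n) (t : α → ℕ × ℕ → ℕ)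
    (ht : Primrec₂ t) (hT : ∀ a k φ, encode (T a k φ) = t a (k, encode φ))
    (hR : ∀ a k φ, k < d a → (∀ v V, Sat r P v V φ ↔ R a k v V) →
      ∀ v V, Sat r P v V (T a k φ) ↔ R a (k + 1) v V) :
    CD r P fun a => R a (d a) := by
  obtain ⟨f, hf, H⟩ := h0
  refine ⟨fun a => (d a).rec (f a) (T a), ?_, fun a => ?_⟩
  · refine (Primrec.nat_rec' hd hf ht).of_eq fun a => ?_
    beta_reduce
    generalize d a = e
    induction e with
    | zero => rfl
    | succ k ih => exact (congrArg (fun c => t a (k, c)) ih).trans (hT a k _).symm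
  · have key : ∀ k ≤ d a, ∀ v V, Sat r P v V (Nat.rec (f a) (T a) k) ↔ R a k v V := by
      intro k
      induction k with
      | zero => exact fun _ => H a
      | succ k ih => exact fun hk => hR a k _ hk (ih (by omega))
    exact key _ le_rfl

theorem ball {R : α × ℕ → (ℕ → A) → (ℕ → Set A) → Prop} (h : CD r P R) {d : α → ℕ}
    (hd : Primrec d) : CD r P fun a v V => ∀ i < d a, R (a, i) v V := by
  obtain ⟨f, hf, H⟩ := h
  refine natRec (R := fun a k v V => ∀ i < k, R (a, i) v V) hd (true.congr (by simp))
    (fun a k φ => .and φ (f (a, k)))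
    (fun a p => Nat.pair 4 (Nat.pair p.2 (encode (f (a, p.1)))))
    (primrec_tag₂ 4 (Primrec.snd.comp Primrec.snd)
      (hf.comp (Primrec.pair Primrec.fst (Primrec.fst.comp Primrec.snd))))
    (fun _ _ _ => rfl) fun a k φ _ hφ v V => ?_
  rw [Sat, hφ, H, Nat.forall_lt_succ_right]

end CD

/-! ## From definable families to expansions with the same theory -/

/-- Quantify out the first-order variables below `d` and the set variables in `[1, d]`. -/
def MSO.close {n : ℕ} (φ : MSO n) (d : ℕ) : MSO n :=
  d.rec φ fun i ψ => .ex1 i (.ex2 (i + 1) ψ)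

theorem MSO.encode_close {n : ℕ} (φ : MSO n) (d : ℕ) : encode (close φ d) =
    d.rec (encode φ) fun i c => Nat.pair 5 (Nat.pair i (Nat.pair 6 (Nat.pair (i + 1) c))) := by
  induction d with
  | zero => rfl
  | succ d ih =>
    exact congrArg (fun c => Nat.pair 5 (Nat.pair d (Nat.pair 6 (Nat.pair (d + 1) c)))) ih

theorem MSO.fv_close {n : ℕ} (φ : MSO n) (d : ℕ) :
    (∀ i ∈ fv1 (close φ d), d ≤ i ∧ i ∈ fv1 φ) ∧
      ∀ j ∈ fv2 (close φ d), (j = 0 ∨ d < j) ∧ j ∈ fv2 φ := by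
  induction d with
  | zero => exact ⟨fun i hi => ⟨Nat.zero_le _, hi⟩, fun j hj => ⟨Nat.eq_zero_or_pos j, hj⟩⟩
  | succ d ih =>
    change (∀ i ∈ fv1 (.ex1 d (.ex2 (d + 1) (close φ d)) : MSO n), _) ∧
      (∀ i ∈ fv2 (.ex1 d (.ex2 (d + 1) (close φ d)) : MSO n), _)
    simp only [fv1, fv2, Finset.mem_sdiff, Finset.mem_singleton]
    refine ⟨fun i hi => ?_, fun j hj => ?_⟩
    · have := ih.1 i hi.1
      exact ⟨by omega, this.2⟩
    · have := ih.2 j hj.1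
      exact ⟨by omega, this.2⟩

theorem MSO.sat_close {A : Type} [Nonempty A] {n : ℕ} {r : A → A → Prop} {P : Fin n → Set A}
    {φ : MSO n} {R : Set A → Prop} (h : ∀ v V, Sat r P v V φ ↔ R (V 0)) (d : ℕ) :
    ∀ v V, Sat r P v V (close φ d) ↔ R (V 0) := by
  induction d with
  | zero => exact h
  | succ d ih =>
    intro v V
    change (∃ x, ∃ S, Sat r P _ _ (close φ d)) ↔ _
    simp only [ih]
    simp

theorem exists_expansion {A : Type} [LinearOrder A] [Nonempty A] {n : ℕ} {r : A → A → Prop}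
    (hr : (∀ x y, r x y ↔ x < y) ∨ ∀ x y, r x y ↔ y < x) {P : Fin n → Set A} {Q : Set A}
    {Ψ : ℕ → Set A → Prop} (hΨ : CD r P fun k _ V => Ψ k (V 0)) (hex : ∀ k, ∃ X, Ψ k X)
    (htp : ∀ k X, Ψ k X → tp k (n + 1) Set.univ (lab P X) = tp k (n + 1) Set.univ (lab P Q))
    (hne : ∀ k, ∃ X ≠ Q, tp k (n + 1) Set.univ (lab P X) = tp k (n + 1) Set.univ (lab P Q)) :
    ¬ Definable r P Q ∧ TuringRed (TheoryCodes r (Fin.snoc P Q)) (TheoryCodes r P) ∧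
      (DecidableSet (TheoryCodes r P) → DecidableSet (TheoryCodes r (Fin.snoc P Q))) := by
  obtain ⟨g, hg, H⟩ := hΨ
  let g' : ℕ → MSO n := fun k => close (g k) (encode (g k) + 1)
  have hg' : Primrec fun k => encode (g' k) := by
    refine (Primrec.nat_rec' (Primrec.succ.comp hg) hg (h := fun _ p =>
      Nat.pair 5 (Nat.pair p.1 (Nat.pair 6 (Nat.pair (p.1 + 1) p.2)))) ?_).of_eq fun k => ?_
    · have h1 : Primrec fun q : ℕ × ℕ × ℕ => q.2.1 := Primrec.fst.comp Primrec.snd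
      have h2 : Primrec fun q : ℕ × ℕ × ℕ => q.2.2 := Primrec.snd.comp Primrec.snd
      exact CD.primrec_tag₂ 5 h1 (CD.primrec_tag₂ 6 (Primrec.succ.comp h1) h2)
    · exact (encode_close (g k) (encode (g k) + 1)).symm
  have H' : ∀ k v V, Sat r P v V (g' k) ↔ Ψ k (V 0) := fun k => sat_close (H k) _
  have f1 : ∀ k, fv1 (g' k) = ∅ := by
    intro k
    refine Finset.eq_empty_of_forall_notMem fun i hi => ?_
    have h1 := (fv_close _ _).1 i hi
    have h2 := (le_encode_of_mem_fv _).1 i h1.2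
    omega
  have f2 : ∀ k, ∀ j ∈ fv2 (g' k), j = 0 := by
    intro k j hj
    have h1 := (fv_close _ _).2 j hj
    have h2 := (le_encode_of_mem_fv _).2 j h1.2
    omega
  let f : ℕ → ℕ := fun c =>
    Nat.pair 6 (Nat.pair 0 (Nat.pair 4 (Nat.pair (encode (g' c)) (unlabelCode n c))))
  have hf : Primrec f :=
    CD.primrec_tag₂ 6 (.const 0) (CD.primrec_tag₂ 4 hg' (primrec_unlabelCode n))
  have hiff : ∀ c, c ∈ TheoryCodes r (Fin.snoc P Q : Fin (n + 1) → Set A) ↔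
      f c ∈ TheoryCodes r P := by
    intro c
    have sat : ∀ φ : MSO (n + 1), IsSentence φ → encode φ = c →
        (TrueIn r P (.ex2 0 (.and (g' c) (unlabel φ))) ↔
          TrueIn r (Fin.snoc P Q : Fin (n + 1) → Set A) φ) := by
      intro φ hs hc
      have hq : qd φ ≤ c := hc ▸ qd_le_encode φ
      have aux : ∀ v V, Sat r P v V (.ex2 0 (.and (g' c) (unlabel φ))) ↔
          ∃ X, Ψ c X ∧ Sat r (Fin.snoc P X : Fin (n + 1) → Set A) v (fun j => V (j + 1)) φ := by
        intro v V
        simp only [Sat, H', sat_unlabel]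
        simp
      constructor
      · intro h v V
        obtain ⟨X, hX, hsat⟩ := (aux v V).1 (h v V)
        exact (trueIn_iff_of_tp_eq hr hs hq (htp c X hX) v v _ V).1 hsat
      · intro h v V
        obtain ⟨X, hX⟩ := hex c
        exact (aux v V).2 ⟨X, hX, (trueIn_iff_of_tp_eq hr hs hq (htp c X hX) v v _ V).2 (h v V)⟩
    constructor
    · rintro ⟨φ, hs, hc, ht⟩
      refine ⟨_, ⟨?_, ?_⟩, ?_, (sat φ hs hc).2 ht⟩
      · simp [fv1, f1, fv1_unlabel, hs.1]
      · refine Finset.eq_empty_of_forall_notMem fun j hj => ?_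
        simp only [fv2, Finset.mem_sdiff, Finset.mem_union, Finset.mem_singleton] at hj
        obtain ⟨j, rfl⟩ : ∃ i, j = i + 1 := ⟨j - 1, by omega⟩
        rcases hj.1 with h | h
        · exact absurd (f2 _ _ h) (by omega)
        · simp [mem_fv2_unlabel, hs.2] at h
      · simp [encode, encode_unlabel, hc, f]
    · rintro ⟨χ, hs, hc, ht⟩
      cases χ with
      | ex2 j χ =>
        cases χ with
        | and φ₁ φ₂ =>
          simp only [encode, f, Nat.pair_eq_pair, true_and] at hc
          obtain ⟨rfl, h1, h2⟩ := hc
          obtain rfl := encode_injective h1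
          obtain ⟨φ, hφ⟩ := exists_of_encode_eq_unlabelCode c φ₂ h2
          rw [← hφ, ← encode_unlabel] at h2
          obtain rfl := encode_injective h2
          have hs' : IsSentence φ := by
            constructor
            · have := hs.1
              simpa [fv1, f1, fv1_unlabel] using this
            · refine Finset.eq_empty_of_forall_notMem fun j hj => ?_
              have h3 : j + 1 ∈ fv2 (.ex2 0 (.and (g' c) (unlabel φ)) : MSO n) := by
                simp [fv2, mem_fv2_unlabel, hj]
              rw [hs.2] at h3
              simp at h3
          exact ⟨φ, hs', hφ, (sat φ hs' hφ).1 ht⟩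
        | _ => simp [encode, f] at hc
      | _ => simp [encode, f] at hc
  exact ⟨not_definable_of_tp_eq hr hne, .of_preimage hf hiff, .of_preimage hf hiff⟩

/-! ## Definability of finite distance and of equality of types of intervals -/

/-- `x ≤ y` are at finite distance. -/
def FinLE {A : Type} [Preorder A] (x y : A) : Prop := x ≤ y ∧ (Set.Icc x y).Finite

/-- `[x, y)` labelled by `S` and `[x', y')` labelled by `S'` have the same `k`-type. -/
def Same {A : Type} [LinearOrder A] {n : ℕ} (P : Fin n → Set A) (k : ℕ) (x y : A) (S : Set A)
    (x' y' : A) (S' : Set A) : Prop :=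
  tp k (n + 1) (Set.Ico x y) (lab P S) = tp k (n + 1) (Set.Ico x' y') (lab P S')

theorem icc_finite_iff {A : Type} [LinearOrder A] {x y : A} : (Set.Icc x y).Finite ↔
    ∀ S : Set A, (∃ z, z ∈ S ∧ x ≤ z ∧ z ≤ y) →
      (∃ z, z ∈ S ∧ x ≤ z ∧ z ≤ y ∧ ∀ w, w ∈ S → x ≤ w → w ≤ y → z ≤ w) ∧
      ∃ z, z ∈ S ∧ x ≤ z ∧ z ≤ y ∧ ∀ w, w ∈ S → x ≤ w → w ≤ y → w ≤ z := by
  constructor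
  · rintro h S ⟨z, hz⟩
    have hfin : (S ∩ Set.Icc x y).Finite := h.subset Set.inter_subset_right
    have hne : (S ∩ Set.Icc x y).Nonempty := ⟨z, hz⟩
    obtain ⟨a, ha, ha'⟩ := hfin.exists_minimal hne
    obtain ⟨b, hb, hb'⟩ := hfin.exists_maximal hne
    refine ⟨⟨a, ha.1, ha.2.1, ha.2.2, fun w h1 h2 h3 => ?_⟩,
      ⟨b, hb.1, hb.2.1, hb.2.2, fun w h1 h2 h3 => ?_⟩⟩
    · exact (le_total a w).elim id fun hw => ha' ⟨h1, h2, h3⟩ hw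
    · exact (le_total w b).elim id fun hw => hb' ⟨h1, h2, h3⟩ hw
  · intro h
    have : WellFoundedLT (Set.Icc x y) := by
      refine ⟨WellFounded.wellFounded_iff_has_min.2 fun s ⟨z, hz⟩ => ?_⟩
      obtain ⟨⟨w, ⟨w', hw, rfl⟩, -, -, hmin⟩, -⟩ :=
        h (Subtype.val '' s) ⟨z, ⟨z, hz, rfl⟩, z.2.1, z.2.2⟩
      exact ⟨w', hw, fun u hu => not_lt.2 (hmin u ⟨u, hu, rfl⟩ u.2.1 u.2.2)⟩
    have : WellFoundedGT (Set.Icc x y) := by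
      refine ⟨WellFounded.wellFounded_iff_has_min.2 fun s ⟨z, hz⟩ => ?_⟩
      obtain ⟨-, ⟨w, ⟨w', hw, rfl⟩, -, -, hmin⟩⟩ :=
        h (Subtype.val '' s) ⟨z, ⟨z, hz, rfl⟩, z.2.1, z.2.2⟩
      exact ⟨w', hw, fun u hu => not_lt.2 (hmin u ⟨u, hu, rfl⟩ u.2.1 u.2.2)⟩
    exact Finite.of_wellFoundedLT_wellFoundedGT _

namespace CD

variable {A : Type} [LinearOrder A] {n : ℕ} {r : A → A → Prop} {P : Fin n → Set A} {α : Type}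
  [Primcodable α] {R : α → (ℕ → A) → (ℕ → Set A) → Prop}

theorem lt (hr : (∀ x y, r x y ↔ x < y) ∨ ∀ x y, r x y ↔ y < x) (i j : ℕ) :
    CD r P fun (_ : α) v _ => v i < v j := by
  rcases hr with hr | hr
  · exact (rel i j).congr fun a v V => hr _ _
  · exact (rel j i).congr fun a v V => hr _ _

theorem le (hr : (∀ x y, r x y ↔ x < y) ∨ ∀ x y, r x y ↔ y < x) (i j : ℕ) :
    CD r P fun (_ : α) v _ => v i ≤ v j :=
  (lt hr j i).not.congr fun _ _ _ => not_lt

theorem eq (hr : (∀ x y, r x y ↔ x < y) ∨ ∀ x y, r x y ↔ y < x) (i j : ℕ) :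
    CD r P fun (_ : α) v _ => v i = v j :=
  ((le hr i j).and (le hr j i)).congr fun _ _ _ => le_antisymm_iff.symm

theorem finLE (hr : (∀ x y, r x y ↔ x < y) ∨ ∀ x y, r x y ↔ y < x) (i j : ℕ)
    (hi : i < 50 := by decide) (hj : j < 50 := by decide) :
    CD r P fun (_ : α) v _ => FinLE (v i) (v j) := by
  refine ((le hr i j).and (all2 50 (((mem 50 50).and ((le hr i 50).and (le hr 50 j))).ex1 50 |>.imp
    ((((mem 50 50).and ((le hr i 50).and ((le hr 50 j).and
      (((mem 51 50).imp ((le hr i 51).imp ((le hr 51 j).imp (le hr 50 51)))).all1 51)))).ex1 50).and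
    (((mem 50 50).and ((le hr i 50).and ((le hr 50 j).and
      (((mem 51 50).imp ((le hr i 51).imp ((le hr 51 j).imp (le hr 51 50)))).all1 51)))).ex1 50)
    )))).congr fun a v V => ?_
  have h1 : i ≠ 50 := by omega
  have h2 : j ≠ 50 := by omega
  have h3 : i ≠ 51 := by omega
  have h4 : j ≠ 51 := by omega
  rw [FinLE, icc_finite_iff]
  simp [h1, h2, h3, h4]

theorem subst1 (hr : (∀ x y, r x y ↔ x < y) ∨ ∀ x y, r x y ↔ y < x) (i j : ℕ) (h : CD r P R) :
    CD r P fun a v V => R a (Function.update v i (v j)) V := by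
  rcases eq_or_ne i j with rfl | hij
  · simpa using h
  · refine (((eq hr i j).and h).ex1 i).congr fun a v V => ?_
    simp [hij.symm]

/-- The labels of the left-hand interval: predicates first, then the set variables of even index. -/
def leftLab (P : Fin n → Set A) (V : ℕ → Set A) (l : ℕ) : Set A :=
  if h : l < n then P ⟨l, h⟩ else V (2 * (l - n))

/-- The labels of the right-hand interval: predicates first, then the set variables of odd index. -/
def rightLab (P : Fin n → Set A) (V : ℕ → Set A) (l : ℕ) : Set A :=
  if h : l < n then P ⟨l, h⟩ else V (2 * (l - n) + 1)

theorem same_base (hr : (∀ x y, r x y ↔ x < y) ∨ ∀ x y, r x y ↔ y < x) :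
    CD r P fun k v V => Same P k (v 0) (v 1) (V 0) (v 2) (v 3) (V 1) := by
  have main : CD r P fun K v V => tp K (n + 1 + K - K) (Set.Ico (v 0) (v 1)) (leftLab P V) =
      tp K (n + 1 + K - K) (Set.Ico (v 2) (v 3)) (rightLab P V) := by
    refine natRec (d := id) (R := fun K k v V =>
      tp k (n + 1 + K - k) (Set.Ico (v 0) (v 1)) (leftLab P V) =
      tp k (n + 1 + K - k) (Set.Ico (v 2) (v 3)) (rightLab P V)) .id ?_
      (fun K k φ => .and (.not (.ex2 (2 * (K - k)) (.not (.ex2 (2 * (K - k) + 1) φ))))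
        (.not (.ex2 (2 * (K - k) + 1) (.not (.ex2 (2 * (K - k)) φ)))))
      (fun K p => Nat.pair 4 (Nat.pair
        (Nat.pair 3 (Nat.pair 6 (Nat.pair (2 * (K - p.1))
          (Nat.pair 3 (Nat.pair 6 (Nat.pair (2 * (K - p.1) + 1) p.2))))))
        (Nat.pair 3 (Nat.pair 6 (Nat.pair (2 * (K - p.1) + 1)
          (Nat.pair 3 (Nat.pair 6 (Nat.pair (2 * (K - p.1)) p.2))))))))
      ?_ (fun _ _ _ => rfl) ?_
    · have hN : Primrec fun K : ℕ => n + 1 + K := Primrec.nat_add.comp (.const _) .id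
      have hi : Primrec fun q : (ℕ × ℕ) × ℕ => q.1.2 := Primrec.snd.comp Primrec.fst
      have hj : Primrec fun q : (ℕ × ℕ) × ℕ => q.2 := Primrec.snd
      have hev {f : (ℕ × ℕ) × ℕ → ℕ} (hf : Primrec f) : Primrec fun q => 2 * (f q - n) :=
        Primrec.nat_mul.comp (.const 2) (Primrec.nat_sub.comp hf (.const n))
      have left {f : (ℕ × ℕ) × ℕ → ℕ} (hf : Primrec f) (i : ℕ) :
          CD r P fun q v V => v i ∈ leftLab P V (f q) := mem_lab hf i (hev hf)
      have right {f : (ℕ × ℕ) × ℕ → ℕ} (hf : Primrec f) (i : ℕ) :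
          CD r P fun q v V => v i ∈ rightLab P V (f q) :=
        mem_lab hf i (Primrec.succ.comp (hev hf))
      have atom : CD r P fun (q : (ℕ × ℕ) × ℕ) v V =>
          ((∃ x ∈ Set.Ico (v 0) (v 1), x ∈ leftLab P V q.1.2 ∧ x ∈ leftLab P V q.2) ↔
            ∃ x ∈ Set.Ico (v 2) (v 3), x ∈ rightLab P V q.1.2 ∧ x ∈ rightLab P V q.2) ∧
          ((∃ x ∈ Set.Ico (v 0) (v 1), ∃ y ∈ Set.Ico (v 0) (v 1),
              x ∈ leftLab P V q.1.2 ∧ y ∈ leftLab P V q.2 ∧ x < y) ↔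
            ∃ x ∈ Set.Ico (v 2) (v 3), ∃ y ∈ Set.Ico (v 2) (v 3),
              x ∈ rightLab P V q.1.2 ∧ y ∈ rightLab P V q.2 ∧ x < y) := by
        have ico (i j l : ℕ) : CD r P fun (_ : (ℕ × ℕ) × ℕ) v _ => v l ∈ Set.Ico (v i) (v j) :=
          (le hr i l).and (lt hr l j)
        refine ((((ico 0 1 4).and ((left hi 4).and (left hj 4))).ex1 4).iff
          (((ico 2 3 4).and ((right hi 4).and (right hj 4))).ex1 4)).and
          ((((ico 0 1 4).and (((ico 0 1 5).and ((left hi 4).and ((left hj 5).and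
            (lt hr 4 5)))).ex1 5)).ex1 4).iff
          (((ico 2 3 4).and (((ico 2 3 5).and ((right hi 4).and ((right hj 5).and
            (lt hr 4 5)))).ex1 5)).ex1 4)) |>.congr fun a v V => ?_
        simp
      refine ((atom.ball (hN.comp Primrec.fst)).ball hN).congr fun K v V => ?_
      exact tp_zero_eq_iff.symm
    · have hk : Primrec fun q : ℕ × ℕ × ℕ => 2 * (q.1 - q.2.1) :=
        Primrec.nat_mul.comp (.const 2) (Primrec.nat_sub.comp Primrec.fst
          (Primrec.fst.comp Primrec.snd))
      have hk' : Primrec fun q : ℕ × ℕ × ℕ => 2 * (q.1 - q.2.1) + 1 := Primrec.succ.comp hk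
      have hc : Primrec fun q : ℕ × ℕ × ℕ => q.2.2 := Primrec.snd.comp Primrec.snd
      exact primrec_tag₂ 4 (primrec_tag 3 (primrec_tag₂ 6 hk (primrec_tag 3
        (primrec_tag₂ 6 hk' hc)))) (primrec_tag 3 (primrec_tag₂ 6 hk' (primrec_tag 3
        (primrec_tag₂ 6 hk hc))))
    · intro K k φ hkK hφ v V
      have hkK : k < K := hkK
      obtain ⟨m, hm⟩ : ∃ m, n + 1 + K - (k + 1) = m := ⟨_, rfl⟩
      have hm' : n + 1 + K - k = m + 1 := by omega
      have hl : ∀ S S' V, leftLab P (Function.update (Function.update V (2 * (K - k)) S)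
          (2 * (K - k) + 1) S') = Function.update (leftLab P V) m S := by
        intro S S' V
        funext l
        by_cases hln : l < n
        · have : l ≠ m := by omega
          simp [leftLab, hln, this]
        · have h2 : 2 * (l - n) ≠ 2 * (K - k) + 1 := by omega
          rcases eq_or_ne l m with rfl | hlm
          · have h1 : 2 * (l - n) = 2 * (K - k) := by omega
            simp [leftLab, hln, h1]
          · have h1 : 2 * (l - n) ≠ 2 * (K - k) := by omega
            rw [Function.update_of_ne hlm, leftLab, dif_neg hln, Function.update_of_ne h2,
              Function.update_of_ne h1, leftLab, dif_neg hln]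
      have hrt : ∀ S S' V, rightLab P (Function.update (Function.update V (2 * (K - k)) S)
          (2 * (K - k) + 1) S') = Function.update (rightLab P V) m S' := by
        intro S S' V
        funext l
        by_cases hln : l < n
        · have : l ≠ m := by omega
          simp [rightLab, hln, this]
        · have h2 : 2 * (l - n) + 1 ≠ 2 * (K - k) := by omega
          rcases eq_or_ne l m with rfl | hlm
          · have h1 : 2 * (l - n) + 1 = 2 * (K - k) + 1 := by omega
            simp [rightLab, hln, h1]
          · have h1 : 2 * (l - n) + 1 ≠ 2 * (K - k) + 1 := by omega
            rw [Function.update_of_ne hlm, rightLab, dif_neg hln, Function.update_of_ne h1,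
              Function.update_of_ne h2, rightLab, dif_neg hln]
      have hcomm : ∀ (S S' : Set A) (V : ℕ → Set A),
          Function.update (Function.update V (2 * (K - k) + 1) S') (2 * (K - k)) S =
          Function.update (Function.update V (2 * (K - k)) S)
          (2 * (K - k) + 1) S' := fun S S' V => Function.update_comm (by omega) _ _ _
      have hφ' : ∀ v V, Sat r P v V φ ↔ tp k (m + 1) (Set.Ico (v 0) (v 1)) (leftLab P V) =
          tp k (m + 1) (Set.Ico (v 2) (v 3)) (rightLab P V) := by
        intro v V
        rw [hφ, hm']
      rw [hm, tp_succ_eq_iff]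
      simp only [Sat, hφ', hcomm, hl, hrt, not_exists, not_not, not_forall]
  refine main.congr fun k v V => ?_
  have e : n + 1 + k - k = n + 1 := by omega
  rw [Same, e]
  have h1 : tp k (n + 1) (Set.Ico (v 0) (v 1)) (leftLab P V) =
      tp k (n + 1) (Set.Ico (v 0) (v 1)) (lab P (V 0)) := by
    refine tp_congr fun i hi x _ => ?_
    by_cases h : i < n
    · simp [leftLab, lab, h]
    · simp [leftLab, lab, h, show i - n = 0 by omega]
  have h2 : tp k (n + 1) (Set.Ico (v 2) (v 3)) (rightLab P V) =
      tp k (n + 1) (Set.Ico (v 2) (v 3)) (lab P (V 1)) := by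
    refine tp_congr fun i hi x _ => ?_
    by_cases h : i < n
    · simp [rightLab, lab, h]
    · simp [rightLab, lab, h, show i - n = 0 by omega]
  rw [h1, h2]

theorem same (hr : (∀ x y, r x y ↔ x < y) ∨ ∀ x y, r x y ↔ y < x) {d : α → ℕ} (hd : Primrec d)
    (i j s i' j' s' : ℕ) (hi : i < 50 := by decide) (hj : j < 50 := by decide)
    (hs : s < 50 := by decide) (hi' : i' < 50 := by decide) :
    CD r P fun a v V => Same P (d a) (v i) (v j) (V s) (v i') (v j') (V s') := by
  have h1 := (same_base (P := P) hr).comp hd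
  have h2 := ((((((h1.subst1 hr 0 50).subst1 hr 1 51).subst1 hr 2 52).subst1 hr 3 53).subst2
    0 50).subst2 1 51)
  refine ((((((h2.subst1 hr 50 i).subst1 hr 51 j).subst1 hr 52 i').subst1 hr 53 j').subst2
    50 s).subst2 51 s').congr fun a v V => ?_
  have f1 : i ≠ 51 := by omega
  have f2 : i ≠ 52 := by omega
  have f3 : i ≠ 53 := by omega
  have f4 : j ≠ 52 := by omega
  have f5 : j ≠ 53 := by omega
  have f6 : i' ≠ 53 := by omega
  have f7 : s ≠ 51 := by omega
  simp [f1, f2, f3, f4, f5, f6, f7]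

end CD

/-! ## Homogeneous sequences -/

theorem exists_homogeneous {κ : Type*} [Finite κ] (c : ℕ → ℕ → κ) :
    ∃ g : ℕ → ℕ, StrictMono g ∧ ∃ e, ∀ i j, i < j → c (g i) (g j) = e := by
  let U : Ultrafilter ℕ := Filter.hyperfilter ℕ
  have key : ∀ d : ℕ → κ, ∃ e, ∀ᶠ y in (U : Filter ℕ), d y = e := by
    intro d
    obtain ⟨e, he⟩ := Ultrafilter.eventually_exists_iff.1
      (Filter.Eventually.of_forall fun y => ⟨d y, rfl⟩ : ∀ᶠ y in (U : Filter ℕ), ∃ e, d y = e)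
    exact ⟨e, he⟩
  choose d hd using fun x => key (c x)
  obtain ⟨e, he⟩ := key d
  obtain ⟨g, -, hg⟩ := exists_seq_of_forall_finset_exists (fun x => d x = e)
    (fun x y => x < y ∧ c x y = e) (by
      intro s hs
      have h1 : ∀ᶠ y in (U : Filter ℕ), ∀ x ∈ s, x < y ∧ c x y = e := by
        refine (Filter.eventually_all_finset s).2 fun x hx => ?_
        have h2 : ∀ᶠ y in (U : Filter ℕ), x < y :=
          (Filter.hyperfilter_le_cofinite.trans Nat.cofinite_eq_atTop.le)
            (Filter.eventually_gt_atTop x)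
        filter_upwards [h2, hd x] with y h3 h4
        exact ⟨h3, h4.trans (hs x hx)⟩
      obtain ⟨y, hy1, hy2⟩ := (he.and h1).exists
      exact ⟨y, hy1, hy2⟩)
  exact ⟨g, strictMono_nat_of_lt_succ fun i => (hg i _ i.lt_succ_self).1, e,
    fun i j h => (hg i j h).2⟩

/-- A nonempty set of sequences of naturals that contains all limits of its elements has a
lexicographically least element. -/
theorem exists_lex_least {S : Set (ℕ → ℕ)} (hne : S.Nonempty)
    (hcl : ∀ g, (∀ N, ∃ h ∈ S, ∀ i < N, h i = g i) → g ∈ S) :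
    ∃ g ∈ S, ∀ h ∈ S, ∀ i, (∀ l < i, h l = g l) → g i ≤ h i := by
  have step : ∀ (N : ℕ) (h : S), ∃ h' : S, (∀ i < N, h'.1 i = h.1 i) ∧
      ∀ u ∈ S, (∀ i < N, u i = h.1 i) → h'.1 N ≤ u N := by
    intro N h
    obtain ⟨m, ⟨u, hu, hu', rfl⟩, hm⟩ := WellFounded.has_min (wellFounded_lt (α := ℕ))
      {m | ∃ u ∈ S, (∀ i < N, u i = h.1 i) ∧ u N = m} ⟨_, h.1, h.2, fun _ _ => rfl, rfl⟩
    exact ⟨⟨u, hu⟩, hu', fun w hw hw' => not_lt.1 (hm _ ⟨w, hw, hw', rfl⟩)⟩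
  choose F hF hF' using step
  obtain ⟨h0, hh0⟩ := hne
  let H : ℕ → S := fun N => Nat.rec ⟨h0, hh0⟩ F N
  have hH : ∀ N, H (N + 1) = F N (H N) := fun _ => rfl
  have agree : ∀ i N, i < N → (H N).1 i = (H (i + 1)).1 i := by
    intro i N hiN
    induction N, hiN using Nat.le_induction with
    | base => rfl
    | succ N hN ih => rw [hH, hF _ _ _ hN, ih]
  refine ⟨fun i => (H (i + 1)).1 i, hcl _ fun N => ⟨(H N).1, (H N).2, fun i hi => agree i N hi⟩,
    fun h hh i hi => ?_⟩
  exact hF' i (H i) h hh fun l hl => (hi l hl).trans (agree l i hl).symm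

section

variable {κ : ℕ → Type} (c : ∀ j, ℕ → ℕ → κ j)

/-- The terms of `g` with index at least `j` are homogeneous for the colouring `c j`, for every
`j ≤ k`. -/
def Hom (k : ℕ) (g : ℕ → ℕ) : Prop :=
  StrictMono g ∧ ∀ j ≤ k, ∀ i₁ i₂ l₁ l₂, j ≤ i₁ → i₁ < i₂ → j ≤ l₁ → l₁ < l₂ →
    c j (g i₁) (g i₂) = c j (g l₁) (g l₂)

/-- `g` is lexicographically least among the sequences satisfying `Hom c k`. -/
def LexHom (k : ℕ) (g : ℕ → ℕ) : Prop :=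
  Hom c k g ∧ ∀ h, Hom c k h → ∀ i, (∀ l < i, h l = g l) → g i ≤ h i

variable {c}

theorem Hom.mono {k l : ℕ} (hkl : k ≤ l) {g : ℕ → ℕ} (h : Hom c l g) : Hom c k g :=
  ⟨h.1, fun j hj => h.2 j (hj.trans hkl)⟩

theorem Hom.comp {k : ℕ} {g : ℕ → ℕ} (h : Hom c k g) {s : ℕ → ℕ} (hs : StrictMono s) :
    Hom c k (g ∘ s) :=
  ⟨h.1.comp hs, fun j hj _ _ _ _ h1 h2 h3 h4 => h.2 j hj _ _ _ _ (h1.trans hs.le_apply) (hs h2)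
    (h3.trans hs.le_apply) (hs h4)⟩

variable [∀ j, Finite (κ j)]

theorem exists_homogeneous_le (k : ℕ) (g : ℕ → ℕ) : ∃ s : ℕ → ℕ, StrictMono s ∧ ∀ j ≤ k,
    ∀ i l i' l', i < l → i' < l' → c j (g (s i)) (g (s l)) = c j (g (s i')) (g (s l')) := by
  obtain ⟨s, hs, e, he⟩ := exists_homogeneous
    (fun x y => fun j : Fin (k + 1) => c j (g x) (g y))
  refine ⟨s, hs, fun j hj i l i' l' h h' => ?_⟩
  have h1 := congrFun ((he i l h).trans (he i' l' h').symm) ⟨j, by omega⟩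
  exact h1

theorem Hom.exists_extension {k l : ℕ} {g : ℕ → ℕ} (h : Hom c k g) :
    ∃ g', Hom c l g' ∧ ∀ i ≤ k, g' i = g i := by
  rcases le_total l k with hlk | hkl
  · exact ⟨g, h.mono hlk, fun _ _ => rfl⟩
  obtain ⟨s, hs, hs'⟩ := exists_homogeneous_le (c := c) l (fun i => g (i + (k + 1)))
  let t : ℕ → ℕ := fun i => if i ≤ k then i else s (i - (k + 1)) + (k + 1)
  have ht : StrictMono t := by
    refine strictMono_nat_of_lt_succ fun i => ?_
    simp only [t]
    split_ifs with h1 h2 h2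
    · omega
    · omega
    · omega
    · have := hs (show i - (k + 1) < i + 1 - (k + 1) by omega)
      omega
  refine ⟨g ∘ t, ⟨h.1.comp ht, fun j hj i l i' l' h1 h2 h3 h4 => ?_⟩, fun i hi => by simp [t, hi]⟩
  rcases le_or_gt j k with hjk | hjk
  · exact (h.comp ht).2 j hjk i l i' l' h1 h2 h3 h4
  · have e : ∀ x, j ≤ x → (g ∘ t) x = g (s (x - (k + 1)) + (k + 1)) := by
      intro x hx
      have : ¬ x ≤ k := by omega
      simp [t, this]
    rw [e i h1, e l (by omega), e i' h3, e l' (by omega)]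
    exact hs' j hj _ _ _ _ (by omega) (by omega)

theorem exists_hom (k : ℕ) : ∃ g, Hom c k g := by
  obtain ⟨s, hs, h⟩ := exists_homogeneous_le (c := c) k id
  exact ⟨s, hs, fun j hj i l i' l' _ h1 _ h2 => h j hj i l i' l' h1 h2⟩

variable (c) in
theorem exists_lexHom (k : ℕ) : ∃ g, LexHom c k g := by
  refine exists_lex_least (S := {g | Hom c k g}) (exists_hom k) fun g hg => ⟨fun a b hab => ?_, ?_⟩
  · obtain ⟨h, hh, e⟩ := hg (b + 1)
    rw [← e a (by omega), ← e b (by omega)]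
    exact hh.1 hab
  · intro j hj i l i' l' h1 h2 h3 h4
    obtain ⟨h, hh, e⟩ := hg (max l l' + 1)
    rw [← e i (by omega), ← e l (by omega), ← e i' (by omega), ← e l' (by omega)]
    exact hh.2 j hj i l i' l' h1 h2 h3 h4

theorem LexHom.agree {k l : ℕ} (hkl : k ≤ l) {g g' : ℕ → ℕ} (h : LexHom c k g)
    (h' : LexHom c l g') : ∀ i ≤ k, g i = g' i := by
  intro i
  induction i using Nat.strong_induction_on with
  | _ i ih =>
    intro hi
    refine le_antisymm (h.2 g' (h'.1.mono hkl) i fun l hl => (ih l hl (by omega)).symm) ?_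
    obtain ⟨u, hu, hu'⟩ := h.1.exists_extension (l := l)
    rw [← hu' i hi]
    exact h'.2 u hu i fun l hl => (hu' l (by omega)).trans (ih l hl (by omega))

variable (c) in
/-- There is a sequence whose initial segments are those of the lexicographically least
homogeneous sequences. -/
theorem exists_hom_limit : ∃ g, (∀ k, Hom c k g) ∧ ∀ k g', LexHom c k g' → ∀ i ≤ k, g' i = g i := by
  choose f hf using exists_lexHom c
  have key : ∀ k g', LexHom c k g' → ∀ i ≤ k, g' i = f i i := fun k g' h i hi =>
    ((hf i).agree hi h i le_rfl).symm
  refine ⟨fun i => f i i, fun k => ⟨strictMono_nat_of_lt_succ fun i => ?_, ?_⟩, key⟩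
  · rw [← key (i + 1) _ (hf _) i (by omega)]
    exact (hf (i + 1)).1.1 i.lt_succ_self
  · intro j hj i l i' l' h1 h2 h3 h4
    have e := key (max l l' + k) _ (hf _)
    change c j (f i i) (f l l) = c j (f i' i') (f l' l')
    rw [← e i (by omega), ← e l (by omega), ← e i' (by omega), ← e l' (by omega)]
    exact (hf _).1.2 j (by omega) i l i' l' h1 h2 h3 h4

end

/-! ## Classes of points at finite distance -/

section

variable {A : Type} [LinearOrder A]

theorem FinLE.refl (x : A) : FinLE x x := ⟨le_rfl, by simp⟩

theorem FinLE.trans {x y z : A} (h : FinLE x y) (h' : FinLE y z) : FinLE x z :=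
  ⟨h.1.trans h'.1, (h.2.union h'.2).subset (Set.Icc_subset_Icc_union_Icc)⟩

theorem FinLE.left {x y z : A} (h : FinLE x z) (h1 : x ≤ y) (h2 : y ≤ z) : FinLE x y :=
  ⟨h1, h.2.subset (Set.Icc_subset_Icc_right h2)⟩

theorem FinLE.right {x y z : A} (h : FinLE x z) (h1 : x ≤ y) (h2 : y ≤ z) : FinLE y z :=
  ⟨h2, h.2.subset (Set.Icc_subset_Icc_left h1)⟩

/-- The upper part of a class without maximum is enumerated increasingly by the naturals. -/
theorem exists_enum {b : A} (hb : ∀ x, FinLE b x → ∃ y, x < y ∧ FinLE b y) :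
    ∃ e : ℕ → A, StrictMono e ∧ e 0 = b ∧ ∀ x, FinLE b x ↔ ∃ i, e i = x := by
  let W : Set A := {x | FinLE b x}
  have hfin (x y : W) : (Set.Icc x y).Finite := by
    refine Set.Finite.of_finite_image (f := Subtype.val) (y.2.2.subset ?_)
      Subtype.val_injective.injOn
    rintro _ ⟨z, hz, rfl⟩
    exact ⟨z.2.1, hz.2⟩
  let : LocallyFiniteOrder W := LocallyFiniteOrder.ofFiniteIcc hfin
  let : OrderBot W := { bot := ⟨b, .refl b⟩, bot_le := fun x => x.2.1 }
  have : NoMaxOrder W := ⟨fun x => let ⟨y, h, h'⟩ := hb x x.2; ⟨⟨y, h'⟩, h⟩⟩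
  let : SuccOrder W := LinearLocallyFiniteOrder.succOrder W
  let : PredOrder W := LinearLocallyFiniteOrder.predOrder W
  let f := orderIsoNatOfLinearSuccPredArch (ι := W)
  refine ⟨fun i => f.symm i, fun i j h => f.symm.strictMono h, ?_, fun x => ⟨fun hx => ?_, ?_⟩⟩
  · have : f.symm 0 = ⊥ := f.symm.map_bot
    exact congrArg Subtype.val this
  · exact ⟨f ⟨x, hx⟩, by simp⟩
  · rintro ⟨i, rfl⟩
    exact (f.symm i).2

/-- A class without minimum and maximum is enumerated increasingly by the integers. -/
theorem exists_enum_int {c : A} (h1 : ∀ x, FinLE c x → ∃ y, x < y ∧ FinLE c y)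
    (h2 : ∀ x, FinLE x c → ∃ y, y < x ∧ FinLE y c) :
    ∃ e : ℤ → A, StrictMono e ∧ ∀ x, FinLE c x ∨ FinLE x c ↔ ∃ i, e i = x := by
  let W : Set A := {x | FinLE c x ∨ FinLE x c}
  have hc (x : A) (hx : x ∈ W) : FinLE (min x c) c ∧ FinLE c (max x c) := by
    rcases hx with h | h
    · simp [h.1, h, FinLE.refl]
    · simp [h.1, h, FinLE.refl]
  have hfin (x y : W) : (Set.Icc x y).Finite := by
    refine Set.Finite.of_finite_image (f := Subtype.val)
      (((hc x x.2).1.trans (hc y y.2).2).2.subset ?_) Subtype.val_injective.injOn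
    rintro _ ⟨z, hz, rfl⟩
    exact ⟨(min_le_left _ _).trans hz.1, le_trans (b := (y : A)) hz.2 (le_max_left _ _)⟩
  let : LocallyFiniteOrder W := LocallyFiniteOrder.ofFiniteIcc hfin
  have : Nonempty W := ⟨⟨c, .inl (.refl c)⟩⟩
  have : NoMaxOrder W := ⟨fun x => by
    obtain ⟨y, h, h'⟩ := h1 _ (hc x x.2).2
    exact ⟨⟨y, .inl h'⟩, lt_of_le_of_lt (b := max (x : A) c) (le_max_left _ _) h⟩⟩
  have : NoMinOrder W := ⟨fun x => by
    obtain ⟨y, h, h'⟩ := h2 _ (hc x x.2).1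
    exact ⟨⟨y, .inr h'⟩, lt_of_lt_of_le (b := min (x : A) c) h (min_le_left _ _)⟩⟩
  let : SuccOrder W := LinearLocallyFiniteOrder.succOrder W
  let : PredOrder W := LinearLocallyFiniteOrder.predOrder W
  let f := orderIsoIntOfLinearSuccPredArch (ι := W)
  refine ⟨fun i => f.symm i, fun i j h => f.symm.strictMono h, fun x => ⟨fun hx => ?_, ?_⟩⟩
  · exact ⟨f ⟨x, hx⟩, by simp⟩
  · rintro ⟨i, rfl⟩
    exact (f.symm i).2

end

/-! ## Lexicographically least homogeneous subsets of an upper part of a class -/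

section

variable {A : Type} [LinearOrder A] {n : ℕ}

/-- At least `j` elements of `X` lie between `b` and `x`, at finite distance from `b`. -/
def Cnt (b : A) (X : Set A) : ℕ → A → Prop
  | 0, _ => True
  | j + 1, x => ∃ y, y < x ∧ y ∈ X ∧ FinLE b y ∧ Cnt b X j y

/-- `X` is unbounded in the upper part of the class of `b`, and its elements with at least `j`
predecessors are homogeneous for `j`-types, for every `j ≤ k`. -/
def HomAt (P : Fin n → Set A) (k : ℕ) (b : A) (X : Set A) : Prop :=
  (∀ x, FinLE b x → ∃ y, x < y ∧ FinLE b y ∧ y ∈ X) ∧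
  ∀ j < k + 1, ∀ x₁ y₁ x₂ y₂, x₁ ∈ X → FinLE b x₁ → y₁ ∈ X → FinLE b y₁ → x₁ < y₁ →
    Cnt b X j x₁ → x₂ ∈ X → FinLE b x₂ → y₂ ∈ X → FinLE b y₂ → x₂ < y₂ → Cnt b X j x₂ →
    Same P j x₁ y₁ {x₁} x₂ y₂ {x₂}

/-- `X` is lexicographically least among the sets satisfying `HomAt P k b`. -/
def LexAt (P : Fin n → Set A) (k : ℕ) (b : A) (X : Set A) : Prop :=
  HomAt P k b X ∧ ∀ Y, HomAt P k b Y → ∀ z, z ∈ Y → FinLE b z → z ∉ X →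
    ∃ u, u < z ∧ FinLE b u ∧ u ∈ X ∧ u ∉ Y

namespace CD

variable {r : A → A → Prop} {P : Fin n → Set A}

theorem cnt {α : Type} [Primcodable α] (hr : (∀ x y, r x y ↔ x < y) ∨ ∀ x y, r x y ↔ y < x)
    {d : α → ℕ} (hd : Primrec d) :
    CD r P fun a v V => Cnt (v 2) (V 2) (d a) (v 0) := by
  obtain ⟨f, hf, H⟩ := ((lt (P := P) (α := α) hr 1 0).and ((mem 1 2).and (finLE hr 2 1)))
  obtain ⟨f', hf', H'⟩ := (eq (P := P) (α := α) hr 0 1)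
  refine natRec (R := fun a j v V => Cnt (v 2) (V 2) j (v 0)) hd
    (true.congr fun _ _ _ => by simp [Cnt])
    (fun a k φ => .ex1 1 (.and (f a) (.ex1 0 (.and (f' a) φ))))
    (fun a p => Nat.pair 5 (Nat.pair 1 (Nat.pair 4 (Nat.pair (encode (f a))
      (Nat.pair 5 (Nat.pair 0 (Nat.pair 4 (Nat.pair (encode (f' a)) p.2))))))))
    ?_ (fun _ _ _ => rfl) ?_
  · have h1 : Primrec fun q : α × ℕ × ℕ => q.2.2 := Primrec.snd.comp Primrec.snd
    exact primrec_tag₂ 5 (.const 1) (primrec_tag₂ 4 (hf.comp Primrec.fst)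
      (primrec_tag₂ 5 (.const 0) (primrec_tag₂ 4 (hf'.comp Primrec.fst) h1)))
  · intro a k φ _ hφ v V
    simp [Sat, H, H', hφ, Cnt, and_assoc]

theorem homAt (hr : (∀ x y, r x y ↔ x < y) ∨ ∀ x y, r x y ↔ y < x) :
    CD r P fun k v V => HomAt P k (v 2) (V 2) := by
  have hd : Primrec (Prod.snd : ℕ × ℕ → ℕ) := Primrec.snd
  have sing (i j : ℕ) (hi : i ≠ 7) : CD r P fun (_ : ℕ × ℕ) v V => V j = {v i} :=
    (((mem 7 j).iff (eq hr 7 i)).all1 7).congr fun a v V => by simp [hi, Set.ext_iff]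
  have h1 := (((sing 3 3 (by decide)).imp ((sing 5 4 (by decide)).imp
    (same hr hd 3 4 3 5 6 4))).all2 4).all2 3
  have h2 (i : ℕ) : CD r P fun (a : ℕ × ℕ) v V => Cnt (v 2) (V 2) a.2 (v i) :=
    ((cnt hr hd).subst1 hr 0 i).congr fun a v V => by simp
  have h3 (i : ℕ) (hi : i < 50 := by decide) : CD r P fun (_ : ℕ × ℕ) v V => FinLE (v 2) (v i) :=
    finLE hr 2 i (by decide) hi
  have h4 := ((mem 3 2).imp ((h3 3).imp ((mem 4 2).imp ((h3 4).imp ((lt hr 3 4).imp ((h2 3).imp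
    ((mem 5 2).imp ((h3 5).imp ((mem 6 2).imp ((h3 6).imp ((lt hr 5 6).imp ((h2 5).imp
      h1)))))))))))).all1 6 |>.all1 5 |>.all1 4 |>.all1 3
  refine (((finLE hr 2 3).imp (((lt hr 3 4).and ((finLE hr 2 4).and (mem 4 2))).ex1 4)).all1 3).and
    (h4.ball (d := fun k => k + 1) Primrec.succ) |>.congr fun k v V => ?_
  simp [HomAt]

theorem lexAt (hr : (∀ x y, r x y ↔ x < y) ∨ ∀ x y, r x y ↔ y < x) :
    CD r P fun k v V => LexAt P k (v 2) (V 2) := by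
  refine ((homAt hr).and ((((homAt hr).subst2 2 5).imp (((mem 3 5).imp ((finLE hr 2 3).imp
    ((mem 3 2).not.imp (((lt hr 4 3).and ((finLE hr 2 4).and ((mem 4 2).and
      (mem 4 5).not))).ex1 4)))).all1 3)).all2 5)).congr fun k v V => ?_
  simp [LexAt]

end CD

/-- Colouring of pairs of naturals by types of intervals. -/
def col (P : Fin n → Set A) (e : ℕ → A) (j x y : ℕ) : Ty j (n + 1) :=
  tp j (n + 1) (Set.Ico (e x) (e y)) (lab P {e x})

variable {P : Fin n → Set A} {b : A} {e : ℕ → A} (he : StrictMono e)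
  (hb : ∀ x, FinLE b x ↔ ∃ i, e i = x) {g g' : ℕ → ℕ} (hg : StrictMono g) (hg' : StrictMono g')
  {X X' : Set A} (hX : ∀ i, e i ∈ X ↔ ∃ l, g l = i) (hX' : ∀ i, e i ∈ X' ↔ ∃ l, g' l = i) {k : ℕ}

include he hb

include hg hX in
theorem cnt_iff {j i : ℕ} : Cnt b X j (e (g i)) ↔ j ≤ i := by
  induction j generalizing i with
  | zero => simp [Cnt]
  | succ j ih =>
    constructor
    · rintro ⟨y, hy, hyX, hby, hc⟩
      obtain ⟨m, rfl⟩ := (hb y).1 hby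
      obtain ⟨l, rfl⟩ := (hX m).1 hyX
      have := hg.lt_iff_lt.1 (he.lt_iff_lt.1 hy)
      have := ih.1 hc
      omega
    · intro h
      exact ⟨e (g j), he (hg (by omega)), (hX _).2 ⟨_, rfl⟩, (hb _).2 ⟨_, rfl⟩, ih.2 le_rfl⟩

include hg hX in
theorem homAt_iff : HomAt P k b X ↔ Hom (col P e) k g := by
  constructor
  · intro h
    refine ⟨hg, fun j hj i l i' l' h1 h2 h3 h4 => ?_⟩
    have hm : ∀ i, e (g i) ∈ X := fun i => (hX _).2 ⟨_, rfl⟩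
    have hw : ∀ i, FinLE b (e (g i)) := fun i => (hb _).2 ⟨_, rfl⟩
    exact h.2 j (by omega) _ _ _ _ (hm i) (hw i) (hm l) (hw l) (he (hg h2))
      ((cnt_iff he hb hg hX).2 h1) (hm i') (hw i') (hm l') (hw l') (he (hg h4))
      ((cnt_iff he hb hg hX).2 h3)
  · intro h
    refine ⟨fun x hx => ?_, fun j hj x y x' y' h1 h2 h3 h4 h5 h6 h1' h2' h3' h4' h5' h6' => ?_⟩
    · obtain ⟨i, rfl⟩ := (hb x).1 hx
      exact ⟨e (g (i + 1)), he (hg.le_apply.trans_lt (hg i.lt_succ_self)), (hb _).2 ⟨_, rfl⟩,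
        (hX _).2 ⟨_, rfl⟩⟩
    · obtain ⟨m1, rfl⟩ := (hb x).1 h2
      obtain ⟨i, rfl⟩ := (hX m1).1 h1
      obtain ⟨m2, rfl⟩ := (hb y).1 h4
      obtain ⟨l, rfl⟩ := (hX m2).1 h3
      obtain ⟨m3, rfl⟩ := (hb x').1 h2'
      obtain ⟨i', rfl⟩ := (hX m3).1 h1'
      obtain ⟨m4, rfl⟩ := (hb y').1 h4'
      obtain ⟨l', rfl⟩ := (hX m4).1 h3'
      exact h.2 j (by omega) i l i' l' ((cnt_iff he hb hg hX).1 h6)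
        (hg.lt_iff_lt.1 (he.lt_iff_lt.1 h5)) ((cnt_iff he hb hg hX).1 h6')
        (hg.lt_iff_lt.1 (he.lt_iff_lt.1 h5'))

theorem HomAt.exists_seq (h : HomAt P k b X) :
    ∃ g : ℕ → ℕ, StrictMono g ∧ ∀ i, e i ∈ X ↔ ∃ l, g l = i := by
  have hinf : {i | e i ∈ X}.Infinite := by
    refine Set.infinite_of_not_bddAbove fun ⟨N, hN⟩ => ?_
    obtain ⟨y, hy, hby, hyX⟩ := h.1 (e N) ((hb _).2 ⟨_, rfl⟩)
    obtain ⟨m, rfl⟩ := (hb y).1 hby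
    exact absurd (hN hyX) (not_le.2 (he.lt_iff_lt.1 hy))
  exact ⟨Nat.nth fun i => e i ∈ X, Nat.nth_strictMono hinf, fun i =>
    (Set.ext_iff.1 (Nat.range_nth_of_infinite hinf) i).symm⟩

include hg hX in
theorem lexAt_iff : LexAt P k b X ↔ LexHom (col P e) k g := by
  refine and_congr (homAt_iff he hb hg hX) ⟨fun h u hu i hi => ?_, fun h Y hY z hz hbz hzX => ?_⟩
  · by_contra hlt
    rw [not_le] at hlt
    have hY : ∀ i, e i ∈ {x | ∃ l, e (u l) = x} ↔ ∃ l, u l = i := fun i => by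
      simp [he.injective.eq_iff]
    have hnX : e (u i) ∉ X := by
      intro hmem
      obtain ⟨l, hl⟩ := (hX _).1 hmem
      have : l < i := hg.lt_iff_lt.1 (hl.trans_lt hlt)
      rw [← hi l this] at hl
      exact this.ne (hu.1.injective hl)
    obtain ⟨w, hwz, hbw, hwX, hwY⟩ := h _ ((homAt_iff he hb hu.1 hY).2 hu) (e (u i)) ⟨i, rfl⟩
      ((hb _).2 ⟨_, rfl⟩) hnX
    obtain ⟨m, rfl⟩ := (hb w).1 hbw
    obtain ⟨l, rfl⟩ := (hX m).1 hwX
    have : l < i := hg.lt_iff_lt.1 ((he.lt_iff_lt.1 hwz).trans hlt)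
    exact hwY ⟨l, by rw [hi l this]⟩
  · obtain ⟨u, hu, hY'⟩ := hY.exists_seq he hb
    obtain ⟨m, rfl⟩ := (hb z).1 hbz
    obtain ⟨i, rfl⟩ := (hY' m).1 hz
    have hne : ∃ i, u i ≠ g i := ⟨i, fun h' => hzX ((hX _).2 ⟨i, h'.symm⟩)⟩
    classical
    let i0 := Nat.find hne
    have hi0 : u i0 ≠ g i0 := Nat.find_spec hne
    have hlt : ∀ l < i0, u l = g l := fun l hl => not_not.1 (Nat.find_min hne hl)
    have hle := h u ((homAt_iff he hb hu hY').1 hY) i0 hlt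
    have hii : i0 ≤ i := Nat.find_min' hne fun h' => hzX ((hX _).2 ⟨i, h'.symm⟩)
    have hgu : g i0 < u i0 := lt_of_le_of_ne hle hi0.symm
    refine ⟨e (g i0), he (hgu.trans_le (hu.monotone hii)), (hb _).2 ⟨_, rfl⟩, (hX _).2 ⟨_, rfl⟩,
      fun hm => ?_⟩
    obtain ⟨l, hl⟩ := (hY' _).1 hm
    have hl0 : l < i0 := hu.lt_iff_lt.1 (hl.trans_lt hgu)
    rw [hlt l hl0] at hl
    exact hl0.ne (hg.injective hl)

include hg hX in
theorem tp_of_hom (h : Hom (col P e) k g) : tp k (n + 1) {x | FinLE b x} (lab P X) =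
    Ty.mul (tp k (n + 1) {x | FinLE b x ∧ x < e (g k)} (lab P X))
      (Ty.sum k (n + 1) fun _ : ℕ => col P e k (g k) (g (k + 1))) := by
  have hmono : StrictMono fun i => e (g (k + i)) := fun i j hij => he (hg (by omega))
  have h1 : {x | FinLE b x} = {x | FinLE b x ∧ x < e (g k)} ∪
      ⋃ i : ℕ, Set.Ico (e (g (k + i))) (e (g (k + (i + 1)))) := by
    ext x
    simp only [Set.mem_union, Set.mem_iUnion, Set.mem_Ico, Set.mem_ofPred_eq]
    constructor
    · intro hx
      rcases lt_or_ge x (e (g k)) with hlt | hge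
      · exact .inl ⟨hx, hlt⟩
      · right
        obtain ⟨m, rfl⟩ := (hb x).1 hx
        have hex : ∃ i, e m < e (g (k + i)) :=
          ⟨m + 1, he ((show m < k + (m + 1) by omega).trans_le hg.le_apply)⟩
        classical
        have hs := Nat.find_spec hex
        have hpos : Nat.find hex ≠ 0 := fun h0 => by
          rw [h0] at hs
          exact absurd hge (not_le.2 hs)
        obtain ⟨i, hi⟩ := Nat.exists_eq_succ_of_ne_zero hpos
        refine ⟨i, not_lt.1 (Nat.find_min hex (by omega)), ?_⟩
        rw [hi] at hs
        exact hs
    · rintro (hx | ⟨i, hx, hx'⟩)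
      · exact hx.1
      · have hbe : FinLE b (e (g (k + (i + 1)))) := (hb _).2 ⟨_, rfl⟩
        exact hbe.left (((hb (e (g (k + i)))).2 ⟨_, rfl⟩).1.trans hx) hx'.le
  have hdis : ∀ i j : ℕ, i < j → ∀ x ∈ Set.Ico (e (g (k + i))) (e (g (k + (i + 1)))),
      ∀ y ∈ Set.Ico (e (g (k + j))) (e (g (k + (j + 1)))), x < y := fun i j hij x hx y hy =>
    hx.2.trans_le ((hmono.monotone (show i + 1 ≤ j by omega)).trans hy.1)
  rw [h1, tp_union, tp_iUnion _ _ hdis]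
  · congr 2
    funext i
    rw [h.2 k le_rfl k (k + 1) (k + i) (k + (i + 1)) le_rfl (by omega) (by omega) (by omega)]
    refine tp_congr fun l _ x hx => ?_
    by_cases hl : l < n
    · simp [lab, hl]
    · simp only [lab, hl, dite_false, Set.mem_singleton_iff]
      constructor
      · intro hxX
        have hbe : FinLE b (e (g (k + (i + 1)))) := (hb _).2 ⟨_, rfl⟩
        have hbx := hbe.left (((hb (e (g (k + i)))).2 ⟨_, rfl⟩).1.trans hx.1) hx.2.le
        obtain ⟨m, rfl⟩ := (hb x).1 hbx
        obtain ⟨q, rfl⟩ := (hX m).1 hxX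
        have h2 := hg.le_iff_le.1 (he.le_iff_le.1 hx.1)
        have h3 := hg.lt_iff_lt.1 (he.lt_iff_lt.1 hx.2)
        rw [show q = k + i by omega]
      · rintro rfl
        exact (hX _).2 ⟨_, rfl⟩
  · intro x hx y hy
    obtain ⟨i, hi⟩ := Set.mem_iUnion.1 hy
    exact hx.2.trans_le (le_trans (hmono.monotone (Nat.zero_le i)) hi.1)

include hg hg' hX hX' in
theorem tp_eq_of_hom (h : Hom (col P e) k g) (h' : Hom (col P e) k g')
    (hag : ∀ i ≤ k + 1, g i = g' i) :
    tp k (n + 1) {x | FinLE b x} (lab P X) = tp k (n + 1) {x | FinLE b x} (lab P X') := by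
  rw [tp_of_hom he hb hg hX h, tp_of_hom he hb hg' hX' h', hag k (by omega), hag (k + 1) le_rfl]
  congr 1
  refine tp_congr fun l _ x ⟨hx, hxk⟩ => ?_
  by_cases hl : l < n
  · simp [lab, hl]
  · simp only [lab, hl, dite_false]
    obtain ⟨m, rfl⟩ := (hb x).1 hx
    rw [hX, hX']
    have hm := he.lt_iff_lt.1 hxk
    constructor
    · rintro ⟨i, rfl⟩
      rw [← hag k (by omega)] at hm
      exact ⟨i, (hag i (by have := hg.lt_iff_lt.1 hm; omega)).symm⟩
    · rintro ⟨i, rfl⟩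
      exact ⟨i, hag i (by have := hg'.lt_iff_lt.1 hm; omega)⟩

end

/-! ## Expansions of orderings with marked points in classes without maximum -/

section

variable {A : Type} [LinearOrder A] {n : ℕ}

theorem tp_univ_eq_of_marked {P : Fin n → Set A} {B : Set A}
    (hB : ∀ b ∈ B, ∀ b' ∈ B, ∀ x, FinLE b x → FinLE b' x → b = b') {k : ℕ} {X Y : Set A}
    (hX : ∀ x ∈ X, ∃ b ∈ B, FinLE b x) (hY : ∀ x ∈ Y, ∃ b ∈ B, FinLE b x)
    (h : ∀ b ∈ B, tp k (n + 1) {x | FinLE b x} (lab P X) = tp k (n + 1) {x | FinLE b x} (lab P Y)) :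
    tp k (n + 1) Set.univ (lab P X) = tp k (n + 1) Set.univ (lab P Y) := by
  let s : Setoid A :=
    { r := fun x y => x = y ∨ ∃ b ∈ B, FinLE b x ∧ FinLE b y
      iseqv := by
        refine ⟨fun _ => .inl rfl, ?_, ?_⟩
        · rintro x y (rfl | ⟨b, hb, h1, h2⟩)
          exacts [.inl rfl, .inr ⟨b, hb, h2, h1⟩]
        · rintro x y z (rfl | ⟨b, hb, h1, h2⟩) (rfl | ⟨b', hb', h1', h2'⟩)
          · exact .inl rfl
          · exact .inr ⟨b', hb', h1', h2'⟩
          · exact .inr ⟨b, hb, h1, h2⟩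
          · obtain rfl := hB b hb b' hb' y h2 h1'
            exact .inr ⟨b, hb, h1, h2'⟩ }
  refine tp_univ_congr_of_classes s ?_ fun x => ?_
  · rintro x y z hxy hyz (rfl | ⟨b, hb, h1, h2⟩)
    · exact .inl (le_antisymm hxy hyz)
    · exact .inr ⟨b, hb, h1, h2.left (h1.1.trans hxy) hyz⟩
  · by_cases hx : ∃ b ∈ B, FinLE b x
    · obtain ⟨b, hb, hbx⟩ := hx
      have : {y | s y x} = {y | FinLE b y} := by
        ext y
        constructor
        · rintro (rfl | ⟨b', hb', h1, h2⟩)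
          · exact hbx
          · obtain rfl := hB b hb b' hb' x hbx h2
            exact h1
        · exact fun hy => .inr ⟨b, hb, hy, hbx⟩
      rw [this]
      exact h b hb
    · refine tp_congr fun i _ y hy => ?_
      have hy' : ¬ ∃ b ∈ B, FinLE b y := by
        rcases hy with rfl | ⟨b, hb, h1, h2⟩
        exacts [hx, absurd ⟨b, hb, h2⟩ hx]
      by_cases hi : i < n
      · simp [lab, hi]
      · simp only [lab, hi, dite_false]
        exact iff_of_false (fun h => hy' (hX y h)) (fun h => hy' (hY y h))

theorem exists_expansion_of_marked {r : A → A → Prop}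
    (hr : (∀ x y, r x y ↔ x < y) ∨ ∀ x y, r x y ↔ y < x) {P : Fin n → Set A} {B : Set A}
    (hdef : CD r P fun (_ : ℕ) v _ => v 2 ∈ B) (hne : B.Nonempty)
    (hB : ∀ b ∈ B, ∀ x, FinLE b x → ∃ y, x < y ∧ FinLE b y)
    (hB' : ∀ b ∈ B, ∀ b' ∈ B, FinLE b b' → b = b') :
    ∃ Q : Set A, ¬ Definable r P Q ∧
      TuringRed (TheoryCodes r (Fin.snoc P Q)) (TheoryCodes r P) ∧
      (DecidableSet (TheoryCodes r P) → DecidableSet (TheoryCodes r (Fin.snoc P Q))) := by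
  have hdis : ∀ b ∈ B, ∀ b' ∈ B, ∀ x, FinLE b x → FinLE b' x → b = b' := by
    intro b hb b' hb' x h1 h2
    rcases le_total b b' with h | h
    · exact hB' b hb b' hb' (h1.left h h2.1)
    · exact (hB' b' hb' b hb (h2.left h h1.1)).symm
  choose e he he0 hbe using fun b : B => exists_enum (hB b b.2)
  let S (h : B → ℕ → ℕ) : Set A := {x | ∃ b l, e b (h b l) = x}
  have hS (h : B → ℕ → ℕ) (b : B) (i : ℕ) : e b i ∈ S h ↔ ∃ l, h b l = i := by
    constructor
    · rintro ⟨b', l, hl⟩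
      obtain rfl : b' = b := Subtype.ext (hdis b' b'.2 b b.2 (e b i)
        ((hbe b' _).2 ⟨_, hl⟩) ((hbe b _).2 ⟨_, rfl⟩))
      exact ⟨l, (he b').injective hl⟩
    · rintro ⟨l, rfl⟩
      exact ⟨b, l, rfl⟩
  have hSB (h : B → ℕ → ℕ) : ∀ x ∈ S h, ∃ b ∈ B, FinLE b x := by
    rintro _ ⟨b, l, rfl⟩
    exact ⟨b, b.2, (hbe b _).2 ⟨_, rfl⟩⟩
  choose g hg hgl using fun b : B => exists_hom_limit (col P (e b))
  obtain ⟨b0, hb0⟩ := hne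
  have : Nonempty A := ⟨b0⟩
  refine ⟨S g, exists_expansion hr (Ψ := fun k X => (∀ x, x ∈ X → ∃ b, b ∈ B ∧ FinLE b x) ∧
    ∀ b, b ∈ B → LexAt P (k + 1) b X) ?_ ?_ ?_ ?_⟩
  · have h1 := ((CD.lexAt (P := P) hr).comp Primrec.succ).subst2 2 0
    refine (((CD.mem 1 0).imp ((hdef.and (CD.finLE hr 2 1)).ex1 2)).all1 1).and
      ((hdef.imp h1).all1 2) |>.congr fun k v V => ?_
    simp
  · intro k
    choose h hh using fun b : B => exists_lexHom (col P (e b)) (k + 1)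
    exact ⟨S h, hSB h, fun b hb => (lexAt_iff (he ⟨b, hb⟩) (hbe ⟨b, hb⟩) (hh ⟨b, hb⟩).1.1
      (hS h ⟨b, hb⟩)).2 (hh ⟨b, hb⟩)⟩
  · rintro k X ⟨hX, hX'⟩
    refine tp_univ_eq_of_marked hdis hX (hSB g) fun b hb => ?_
    obtain ⟨u, hu, huX⟩ := (hX' b hb).1.exists_seq (he ⟨b, hb⟩) (hbe ⟨b, hb⟩)
    have hlex := (lexAt_iff (he ⟨b, hb⟩) (hbe ⟨b, hb⟩) hu huX).1 (hX' b hb)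
    exact tp_eq_of_hom (he ⟨b, hb⟩) (hbe ⟨b, hb⟩) hu (hg ⟨b, hb⟩ 0).1 huX (hS g ⟨b, hb⟩)
      (hlex.1.mono k.le_succ) (hg ⟨b, hb⟩ k) (hgl ⟨b, hb⟩ _ _ hlex)
  · intro k
    let s : ℕ → ℕ := fun i => if i ≤ k + 1 then i else i + 1
    have hs : StrictMono s := by
      refine strictMono_nat_of_lt_succ fun i => ?_
      simp only [s]
      split_ifs <;> omega
    have hsk : ∀ i, s i ≠ k + 2 := by
      intro i
      simp only [s]
      split_ifs <;> omega
    refine ⟨S fun b => g b ∘ s, fun h => ?_, ?_⟩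
    · have h1 : e ⟨b0, hb0⟩ (g ⟨b0, hb0⟩ (k + 2)) ∈ S g := ⟨_, _, rfl⟩
      rw [← h, hS] at h1
      obtain ⟨l, hl⟩ := h1
      exact hsk l ((hg _ 0).1.injective hl)
    · refine tp_univ_eq_of_marked hdis (hSB _) (hSB _) fun b hb => ?_
      refine tp_eq_of_hom (he ⟨b, hb⟩) (hbe ⟨b, hb⟩) ((hg ⟨b, hb⟩ k).comp hs).1 (hg ⟨b, hb⟩ k).1
        (hS (fun b => g b ∘ s) ⟨b, hb⟩) (hS g ⟨b, hb⟩) ((hg ⟨b, hb⟩ k).comp hs) (hg ⟨b, hb⟩ k)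
        fun i hi => ?_
      simp [s, hi]

end

/-! ## Types of bi-infinite words in which every factor type recurs -/

section Semigroup

variable {S : Type*} [Semigroup S]

/-- Divisibility on the left, up to equality: `x` lies in the right ideal generated by `y`. -/
def RLE (x y : S) : Prop := x = y ∨ ∃ r, x = y * r

theorem RLE.trans {x y z : S} (h : RLE x y) (h' : RLE y z) : RLE x z := by
  rcases h with rfl | ⟨r, rfl⟩
  · exact h'
  · rcases h' with rfl | ⟨s, rfl⟩
    · exact .inr ⟨r, rfl⟩
    · exact .inr ⟨s * r, mul_assoc _ _ _⟩

theorem RLE.idem_mul {x e : S} (h : RLE x e) (he : e * e = e) : e * x = x := by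
  rcases h with rfl | ⟨r, rfl⟩
  · exact he
  · rw [← mul_assoc, he]

/-- A nonempty set in a finite semigroup has an element that is minimal with respect to `RLE`. -/
theorem exists_rle_minimal [Finite S] {T : Set S} (hT : T.Nonempty) :
    ∃ t ∈ T, ∀ p ∈ T, RLE p t → RLE t p := by
  obtain ⟨t, ht, hmin⟩ := T.toFinite.exists_minimalFor (fun t => {p | RLE p t}) T hT
  refine ⟨t, ht, fun p hp hpt => ?_⟩
  exact hmin hp (fun q (hq : RLE q p) => hq.trans hpt) (Or.inl rfl : RLE t t)

/-- Evaluation of a bi-infinite product whose left and right parts are powers of idempotents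
generating the same right ideal. -/
theorem mul_mul_eq_of_rle [Finite S] {W V : S → S} (hW : ∀ a b, W (a * b) = a * W (b * a))
    (hV : ∀ a b, V (a * b) = V (b * a) * b) {a e f m : S} (ha : a * a = a) (he : e * e = e)
    (hf : f * f = f) (hae : RLE a e) (hea : RLE e a) (haf : RLE a f) (hfa : RLE f a)
    (hu : RLE a (f * m * e)) : V f * m * W e = V a * W a := by
  have h1 : a * e = e := hea.idem_mul ha
  have h2 : e * a = a := hae.idem_mul he
  have h3 : a * f = f := hfa.idem_mul ha
  have h4 : f * a = a := haf.idem_mul hf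
  have hWa : a * W a = W a := by
    have := hW a a
    rw [ha] at this
    exact this.symm
  have hWe : W e = a * W a := by
    have := hW a e
    rwa [h1, h2] at this
  have hWe' : W e = e * W e := by
    have := hW e e
    rwa [he] at this
  have hVf : V f = V a * f := by
    have := hV a f
    rwa [h3, h4] at this
  let u := f * m * e * a
  have hau : a * u = u := by simp only [u, ← mul_assoc, h3]
  have hua : u * a = u := by simp only [u, mul_assoc, ha]
  have hue : u * e = f * m * e := by simp only [u, mul_assoc, h1, he]
  obtain ⟨v, hv⟩ : ∃ v, a = u * v := by
    rcases hu with h | ⟨r, h⟩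
    · exact ⟨e * a, by rw [← mul_assoc, hue, ← h, ha]⟩
    · exact ⟨e * r, by rw [← mul_assoc, hue, ← h]⟩
  let w := a * v * a
  have huw : u * w = a := by
    rw [show u * w = u * a * v * a by simp only [w, mul_assoc], hua, ← hv, ha]
  have haw : a * w = w := by simp only [w, ← mul_assoc, ha]
  have hwu : w * u = a := by
    let F : {s : S // a * s = s} → {s : S // a * s = s} := fun s =>
      ⟨u * s, by rw [← mul_assoc, hau]⟩
    have hF : Function.Injective F := by
      refine Finite.injective_iff_surjective.2 fun s => ⟨⟨w * s, by rw [← mul_assoc, haw]⟩, ?_⟩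
      exact Subtype.ext (by simp only [F, ← mul_assoc, huw, s.2])
    have := @hF ⟨w * u, by rw [← mul_assoc, haw]⟩ ⟨a, ha⟩
      (Subtype.ext (by simp only [F, ← mul_assoc, huw, hau, hua]))
    exact congrArg Subtype.val this
  have huW : u * W a = W a := by
    have := hW u w
    rw [huw, hwu] at this
    exact this.symm
  calc V f * m * W e = V a * (f * m * e * a * W a) := by
        rw [hVf, hWe', hWe]; simp only [mul_assoc]
    _ = V a * W a := by rw [show f * m * e * a * W a = W a from huW]

end Semigroup

instance {k m : ℕ} : Semigroup (Ty k m) where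
  mul := Ty.mul
  mul_assoc := Ty.mul_assoc

theorem Ty.sum_nat_const {k m : ℕ} (a b : Ty k m) :
    sum k m (fun _ : ℕ => a * b) = a * sum k m fun _ : ℕ => b * a :=
  sum_nat_mul (fun _ => a) fun _ => b

theorem Ty.sum_natDual_const {k m : ℕ} (a b : Ty k m) :
    sum k m (fun _ : ℕᵒᵈ => a * b) = (sum k m fun _ : ℕᵒᵈ => b * a) * b :=
  sum_natDual_mul (fun _ => b) fun _ => a

section

variable {A : Type} [LinearOrder A] {k m : ℕ}

theorem tp_Ici_eq_sum {U : ℕ → Set A} {C : Set A} (hC : C.OrdConnected) {s : ℕ → A}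
    (hs : StrictMono s) (hsC : ∀ i, s i ∈ C) (hsu : ∀ x ∈ C, ∃ i, x < s i) :
    tp k m {x | x ∈ C ∧ s 0 ≤ x} U =
      Ty.sum k m fun i : ℕ => tp k m (Set.Ico (s i) (s (i + 1))) U := by
  rw [← tp_iUnion _ _ fun i j hij x hx y hy => hx.2.trans_le ((hs.monotone hij).trans hy.1)]
  congr 1
  ext x
  simp only [Set.mem_iUnion, Set.mem_Ico, Set.mem_ofPred_eq]
  constructor
  · rintro ⟨hxC, hx⟩
    have hex := hsu x hxC
    classical
    have hpos : Nat.find hex ≠ 0 := fun h0 => by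
      have := Nat.find_spec hex
      rw [h0] at this
      exact absurd hx (not_le.2 this)
    obtain ⟨i, hi⟩ := Nat.exists_eq_succ_of_ne_zero hpos
    refine ⟨i, not_lt.1 (Nat.find_min hex (by omega)), ?_⟩
    have := Nat.find_spec hex
    rwa [hi] at this
  · rintro ⟨i, h1, h2⟩
    exact ⟨hC.out (hsC i) (hsC (i + 1)) ⟨h1, h2.le⟩, (hs.monotone (Nat.zero_le i)).trans h1⟩

theorem tp_Iio_eq_sum {U : ℕ → Set A} {C : Set A} (hC : C.OrdConnected) {s : ℕ → A}
    (hs : StrictAnti s) (hsC : ∀ i, s i ∈ C) (hsu : ∀ x ∈ C, ∃ i, s i ≤ x) :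
    tp k m {x | x ∈ C ∧ x < s 0} U = Ty.sum k m fun i : ℕᵒᵈ =>
      tp k m (Set.Ico (s (OrderDual.ofDual i + 1)) (s (OrderDual.ofDual i))) U := by
  rw [← tp_iUnion _ _ fun i j hij x hx y hy => hx.2.trans_le
    ((hs.antitone (show OrderDual.ofDual j + 1 ≤ OrderDual.ofDual i from hij)).trans hy.1)]
  congr 1
  ext x
  simp only [Set.mem_iUnion, Set.mem_Ico, Set.mem_ofPred_eq]
  constructor
  · rintro ⟨hxC, hx⟩
    have hex := hsu x hxC
    classical
    have hpos : Nat.find hex ≠ 0 := fun h0 => by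
      have := Nat.find_spec hex
      rw [h0] at this
      exact absurd hx (not_lt.2 this)
    obtain ⟨i, hi⟩ := Nat.exists_eq_succ_of_ne_zero hpos
    refine ⟨OrderDual.toDual i, ?_, not_le.1 (Nat.find_min hex (by
      rw [OrderDual.ofDual_toDual]; omega))⟩
    have := Nat.find_spec hex
    rwa [hi] at this
  · rintro ⟨i, h1, h2⟩
    exact ⟨hC.out (hsC _) (hsC _) ⟨h1, h2.le⟩, h2.trans_le (hs.antitone (Nat.zero_le _))⟩

/-- The set `T` of types contains all types of intervals of the bi-infinite word `w`, and each of
its elements occurs arbitrarily far to the right and to the left. -/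
structure Recur (k m : ℕ) (w : ℤ → A) (U : ℕ → Set A) (T : Set (Ty k m)) : Prop where
  mem : ∀ x y, x < y → tp k m (Set.Ico (w x) (w y)) U ∈ T
  right : ∀ t ∈ T, ∀ z, ∃ x y, z < x ∧ x < y ∧ tp k m (Set.Ico (w x) (w y)) U = t
  left : ∀ t ∈ T, ∀ z, ∃ x y, x < y ∧ y < z ∧ tp k m (Set.Ico (w x) (w y)) U = t

variable {w : ℤ → A} (hw : StrictMono w) (hwc : (Set.range w).OrdConnected) {U U' : ℕ → Set A}
  {T : Set (Ty k m)}

include hw in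
theorem tp_Ico_mul_int (U : ℕ → Set A) {x y z : ℤ} (hxy : x ≤ y) (hyz : y ≤ z) :
    tp k m (Set.Ico (w x) (w y)) U * tp k m (Set.Ico (w y) (w z)) U =
      tp k m (Set.Ico (w x) (w z)) U :=
  (tp_Ico_mul U (hw.monotone hxy) (hw.monotone hyz)).symm

include hw hwc

theorem Recur.exists_right (h : Recur k m w U T) {t : Ty k m} (ht : t ∈ T) :
    ∃ x y, 0 < x ∧ x < y ∧ ∃ e, e * e = e ∧ e ∈ T ∧ RLE e t ∧
      tp k m (Set.Ico (w x) (w y)) U = e ∧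
      tp k m {a | a ∈ Set.range w ∧ w x ≤ a} U = Ty.sum k m fun _ : ℕ => e := by
  choose fx fy h1 h2 h3 using h.right t ht
  let z : ℕ → ℤ := fun i => Nat.rec 0 (fun _ a => fy a) i
  have hz1 : ∀ i, z (i + 1) = fy (z i) := fun _ => rfl
  have hz : StrictMono z := strictMono_nat_of_lt_succ fun i => by
    rw [hz1]
    exact (h1 _).trans (h2 _)
  let x : ℕ → ℤ := fun i => fx (z i)
  have hxz : ∀ i, z i < x i ∧ x i < z (i + 1) := fun i => ⟨h1 _, h2 _⟩
  have hx : StrictMono x := strictMono_nat_of_lt_succ fun i => (hxz i).2.trans (hxz (i + 1)).1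
  obtain ⟨g, hg, e, he⟩ := exists_homogeneous fun i j => tp k m (Set.Ico (w (x i)) (w (x j))) U
  have hxg : StrictMono fun i => x (g i) := hx.comp hg
  have hlow : ∀ i : ℕ, x (g 0) + i ≤ x (g i) := by
    intro i
    induction i with
    | zero => simp
    | succ i ih =>
      have : x (g i) < x (g (i + 1)) := hxg i.lt_succ_self
      push_cast
      omega
  refine ⟨x (g 0), x (g 1), ?_, hxg one_pos, e, ?_, ?_, ?_, he 0 1 one_pos, ?_⟩
  · exact lt_of_le_of_lt (hz.monotone (Nat.zero_le _)) (hxz _).1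
  · nth_rw 1 [← he 0 1 one_pos]
    nth_rw 1 [← he 1 2 one_lt_two]
    rw [tp_Ico_mul_int hw U (hxg one_pos).le (hxg one_lt_two).le, he 0 2 two_pos]
  · rw [← he 0 1 one_pos]
    exact h.mem _ _ (hxg one_pos)
  · right
    refine ⟨tp k m (Set.Ico (w (z (g 0 + 1))) (w (x (g 1)))) U, ?_⟩
    have e1 : t = tp k m (Set.Ico (w (x (g 0))) (w (z (g 0 + 1)))) U := (h3 (z (g 0))).symm
    rw [e1, tp_Ico_mul_int hw U (hxz _).2.le, he 0 1 one_pos]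
    exact (hz.monotone (hg one_pos)).trans (hxz _).1.le
  · rw [tp_Ici_eq_sum hwc (s := fun i => w (x (g i))) (hw.comp hxg) (fun i => ⟨_, rfl⟩)]
    · congr 1
      funext i
      exact he i (i + 1) i.lt_succ_self
    · rintro _ ⟨j, rfl⟩
      refine ⟨(j - x (g 0)).toNat + 1, hw ?_⟩
      have := hlow ((j - x (g 0)).toNat + 1)
      push_cast at this
      have := Int.self_le_toNat (j - x (g 0))
      omega

theorem Recur.exists_left (h : Recur k m w U T) {t : Ty k m} (ht : t ∈ T) :
    ∃ x y, x < y ∧ y < 0 ∧ ∃ f, f * f = f ∧ f ∈ T ∧ RLE f t ∧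
      tp k m (Set.Ico (w x) (w y)) U = f ∧
      tp k m {a | a ∈ Set.range w ∧ a < w y} U = Ty.sum k m fun _ : ℕᵒᵈ => f := by
  choose fx fy h1 h2 h3 using h.left t ht
  let z : ℕ → ℤ := fun i => Nat.rec 0 (fun _ a => fx a) i
  have hz1 : ∀ i, z (i + 1) = fx (z i) := fun _ => rfl
  have hz : StrictAnti z := strictAnti_nat_of_succ_lt fun i => by
    rw [hz1]
    exact (h1 _).trans (h2 _)
  let x : ℕ → ℤ := fun i => z (i + 1)
  have hx : StrictAnti x := fun i j hij => hz (Nat.succ_lt_succ hij)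
  obtain ⟨g, hg, f, hf⟩ := exists_homogeneous fun i j => tp k m (Set.Ico (w (x j)) (w (x i))) U
  have hxg : StrictAnti fun i => x (g i) := fun i j hij => hx (hg hij)
  have hlow : ∀ i : ℕ, x (g i) ≤ x (g 0) - i := by
    intro i
    induction i with
    | zero => simp
    | succ i ih =>
      have : x (g (i + 1)) < x (g i) := hxg i.lt_succ_self
      push_cast
      omega
  refine ⟨x (g 1), x (g 0), hxg one_pos, hz (Nat.succ_pos _), f, ?_, ?_, ?_, hf 0 1 one_pos, ?_⟩
  · nth_rw 1 [← hf 1 2 one_lt_two]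
    nth_rw 1 [← hf 0 1 one_pos]
    rw [tp_Ico_mul_int hw U (hxg one_lt_two).le (hxg one_pos).le, hf 0 2 two_pos]
  · rw [← hf 0 1 one_pos]
    exact h.mem _ _ (hxg one_pos)
  · right
    refine ⟨tp k m (Set.Ico (w (fy (z (g 1)))) (w (x (g 0)))) U, ?_⟩
    have e1 : t = tp k m (Set.Ico (w (x (g 1))) (w (fy (z (g 1))))) U := (h3 (z (g 1))).symm
    rw [e1, tp_Ico_mul_int hw U, hf 0 1 one_pos]
    · exact (h1 _).le
    · exact (h2 _).le.trans (hz.antitone (show g 0 + 1 ≤ g 1 from hg one_pos))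
  · rw [tp_Iio_eq_sum hwc (s := fun i => w (x (g i))) (fun i j hij => hw (hxg hij))
      (fun i => ⟨_, rfl⟩)]
    · congr 1
      funext i
      exact hf _ _ (Nat.lt_succ_self _)
    · rintro _ ⟨j, rfl⟩
      refine ⟨(x (g 0) - j).toNat, hw.monotone ?_⟩
      have := hlow (x (g 0) - j).toNat
      have := Int.self_le_toNat (x (g 0) - j)
      omega

theorem Recur.exists_eq (h : Recur k m w U T) {t : Ty k m} (ht : t ∈ T) :
    ∃ f p e, f * f = f ∧ f ∈ T ∧ RLE f t ∧ e * e = e ∧ e ∈ T ∧ RLE e t ∧ f * p * e ∈ T ∧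
      tp k m (Set.range w) U =
        (Ty.sum k m fun _ : ℕᵒᵈ => f) * p * Ty.sum k m fun _ : ℕ => e := by
  obtain ⟨x, y, hx, hxy, e, h1, h2, h3, h4, h5⟩ := h.exists_right hw hwc ht
  obtain ⟨x', y', hxy', hy', f, h1', h2', h3', h4', h5'⟩ := h.exists_left hw hwc ht
  refine ⟨f, tp k m (Set.Ico (w y') (w x)) U, e, h1', h2', h3', h1, h2, h3, ?_, ?_⟩
  · rw [← h4, ← h4', tp_Ico_mul_int hw U hxy'.le (by omega), tp_Ico_mul_int hw U (by omega) hxy.le]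
    exact h.mem _ _ (by omega)
  · rw [← h5, ← h5']
    have e1 : Set.range w = ({a | a ∈ Set.range w ∧ a < w y'} ∪ Set.Ico (w y') (w x)) ∪
        {a | a ∈ Set.range w ∧ w x ≤ a} := by
      ext a
      simp only [Set.mem_union, Set.mem_Ico, Set.mem_ofPred_eq]
      constructor
      · intro ha
        rcases lt_or_ge a (w y') with h6 | h6
        · exact .inl (.inl ⟨ha, h6⟩)
        · rcases lt_or_ge a (w x) with h7 | h7
          · exact .inl (.inr ⟨h6, h7⟩)
          · exact .inr ⟨ha, h7⟩
      · rintro ((h6 | h6) | h6)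
        · exact h6.1
        · exact hwc.out ⟨y', rfl⟩ ⟨x, rfl⟩ ⟨h6.1, h6.2.le⟩
        · exact h6.1
    conv_lhs => rw [e1]
    rw [tp_union, tp_union]
    · rfl
    · intro a ha b hb
      exact ha.2.trans_le hb.1
    · rintro a (ha | ha) b hb
      · exact ha.2.trans_le ((hw.monotone (by omega)).trans hb.2)
      · exact ha.2.trans_le hb.2

theorem Recur.tp_eq (h : Recur k m w U T) (h' : Recur k m w U' T) :
    tp k m (Set.range w) U = tp k m (Set.range w) U' := by
  obtain ⟨t, ht, hmin⟩ := exists_rle_minimal ⟨_, h.mem 0 1 one_pos⟩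
  obtain ⟨f, p, e, h1, h2, h3, h4, h5, h6, h7, h8⟩ := h.exists_eq hw hwc ht
  obtain ⟨f', p', e', h1', h2', h3', h4', h5', h6', h7', h8'⟩ := h'.exists_eq hw hwc ht
  have key : ∀ f p e' : Ty k m, f * f = f → f ∈ T → RLE f t → e' * e' = e' → e' ∈ T → RLE e' t →
      f * p * e' ∈ T → ((Ty.sum k m fun _ : ℕᵒᵈ => f) * p * Ty.sum k m fun _ : ℕ => e') =
        (Ty.sum k m fun _ : ℕᵒᵈ => e) * Ty.sum k m fun _ : ℕ => e := by
    intro f p e' g1 g2 g3 g4 g5 g6 g7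
    refine mul_mul_eq_of_rle (W := fun a => Ty.sum k m fun _ : ℕ => a)
      (V := fun a => Ty.sum k m fun _ : ℕᵒᵈ => a) Ty.sum_nat_const Ty.sum_natDual_const
      h4 g4 g1 (h6.trans (hmin _ g5 g6)) (g6.trans (hmin _ h5 h6)) (h6.trans (hmin _ g2 g3))
      (g3.trans (hmin _ h5 h6)) (h6.trans (hmin _ g7 ?_))
    exact RLE.trans (.inr ⟨p * e', mul_assoc _ _ _⟩) g3
  rw [h8, h8', key f p e h1 h2 h3 h4 h5 h6 h7, key f' p' e' h1' h2' h3' h4' h5' h6' h7']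

end

/-! ## Generic labellings of classes without endpoints -/

theorem exists_generic {R : Type} [Countable R] [Nonempty R] (O : R → Set (Set ℤ))
    (hO : ∀ r, ∀ X ∈ O r, ∃ N : ℕ, ∀ X' : Set ℤ, (∀ j : ℤ, j.natAbs ≤ N → (j ∈ X' ↔ j ∈ X)) →
      X' ∈ O r)
    (hd : ∀ r, ∀ X : Set ℤ, ∀ N : ℕ,
      ∃ X' ∈ O r, ∀ j : ℤ, j.natAbs ≤ N → (j ∈ X' ↔ j ∈ X)) :
    ∃ X, ∀ r, X ∈ O r := by
  obtain ⟨ρ, hρ⟩ := exists_surjective_nat R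
  have step : ∀ (i : ℕ) (p : Set ℤ × ℕ), ∃ q : Set ℤ × ℕ, p.2 < q.2 ∧
      (∀ j : ℤ, j.natAbs ≤ p.2 → (j ∈ q.1 ↔ j ∈ p.1)) ∧
      ∀ X' : Set ℤ, (∀ j : ℤ, j.natAbs ≤ q.2 → (j ∈ X' ↔ j ∈ q.1)) → X' ∈ O (ρ i) := by
    intro i p
    obtain ⟨X, hX, hXp⟩ := hd (ρ i) p.1 p.2
    obtain ⟨N, hN⟩ := hO _ X hX
    exact ⟨(X, max N (p.2 + 1)), lt_max_of_lt_right p.2.lt_succ_self, hXp, fun X' hX' =>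
      hN X' fun j hj => hX' j (hj.trans (le_max_left _ _))⟩
  choose F h1 h2 h3 using step
  let s : ℕ → Set ℤ × ℕ := fun i => Nat.rec (∅, 0) F i
  have hs : ∀ i, s (i + 1) = F i (s i) := fun _ => rfl
  have hmono : StrictMono fun i => (s i).2 := strictMono_nat_of_lt_succ fun i => by
    rw [hs]
    exact h1 _ _
  have agree : ∀ i i', i ≤ i' → ∀ j : ℤ, j.natAbs ≤ (s i).2 → (j ∈ (s i').1 ↔ j ∈ (s i).1) := by
    intro i i' hi j hj
    induction i', hi using Nat.le_induction with
    | base => rfl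
    | succ i' hi ih =>
      rw [hs, h2 _ _ j (hj.trans (hmono.monotone hi)), ih]
  refine ⟨{j | j ∈ (s j.natAbs).1}, fun r => ?_⟩
  obtain ⟨i, rfl⟩ := hρ r
  refine h3 i (s i) _ fun j hj => ?_
  rw [← hs] at hj ⊢
  rcases le_total (i + 1) j.natAbs with h | h
  · exact agree _ _ h j hj
  · exact (agree _ _ h j hmono.le_apply).symm

section

variable {A : Type} [LinearOrder A] {n : ℕ}

/-- The class of `c` has neither a minimum nor a maximum. -/
def Zeta (c : A) : Prop :=
  (∀ x, FinLE c x → ∃ y, x < y ∧ FinLE c y) ∧ ∀ x, FinLE x c → ∃ y, y < x ∧ FinLE y c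

/-- Some type of an interval starting at `x` is not realized by an interval starting later in the
class of `x`. -/
def RBad (P : Fin n → Set A) (k : ℕ) (x : A) : Prop :=
  ∃ y S, x < y ∧ FinLE x y ∧ ∀ u v T, x < u → FinLE x u → u < v → FinLE u v →
    ¬ Same P k x y S u v T

/-- Some type of an interval ending at `y` is not realized by an interval ending earlier in the
class of `y`. -/
def LBad (P : Fin n → Set A) (k : ℕ) (y : A) : Prop :=
  ∃ x S, x < y ∧ FinLE x y ∧ ∀ u v T, v < y → FinLE v y → u < v → FinLE u v →
    ¬ Same P k x y S u v T

/-- The types of intervals starting at `x` occur in the labelling `X` arbitrarily far to the right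
and to the left in the class of `x`. -/
def RecurAt (P : Fin n → Set A) (k : ℕ) (x : A) (X : Set A) : Prop :=
  ∀ y S z, x < y → FinLE x y → (FinLE x z ∨ FinLE z x) →
    (∃ x' y', z < x' ∧ FinLE z x' ∧ x' < y' ∧ FinLE x' y' ∧ Same P k x y S x' y' X) ∧
    ∃ x' y', x' < y' ∧ FinLE x' y' ∧ y' < z ∧ FinLE y' z ∧ Same P k x y S x' y' X

namespace CD

variable {r : A → A → Prop} {P : Fin n → Set A}

theorem zeta {α : Type} [Primcodable α] (hr : (∀ x y, r x y ↔ x < y) ∨ ∀ x y, r x y ↔ y < x) :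
    CD r P fun (_ : α) v _ => Zeta (v 2) := by
  refine (((finLE hr 2 3).imp (((lt hr 3 4).and (finLE hr 2 4)).ex1 4)).all1 3).and
    (((finLE hr 3 2).imp (((lt hr 4 3).and (finLE hr 4 2)).ex1 4)).all1 3) |>.congr fun a v V => ?_
  simp [Zeta]

theorem rBad {α : Type} [Primcodable α] (hr : (∀ x y, r x y ↔ x < y) ∨ ∀ x y, r x y ↔ y < x)
    (k : ℕ) : CD r P fun (_ : α) v _ => RBad P k (v 2) := by
  have h1 := ((lt hr 2 4).imp ((finLE hr 2 4).imp ((lt hr 4 5).imp ((finLE hr 4 5).imp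
    (same (P := P) (α := α) (d := fun _ => k) hr (.const k) 2 3 2 4 5 3).not)))).all2 3
    |>.all1 5 |>.all1 4
  refine (((lt hr 2 3).and ((finLE hr 2 3).and h1)).ex2 2).ex1 3 |>.congr fun a v V => ?_
  simp [RBad]

theorem lBad {α : Type} [Primcodable α] (hr : (∀ x y, r x y ↔ x < y) ∨ ∀ x y, r x y ↔ y < x)
    (k : ℕ) : CD r P fun (_ : α) v _ => LBad P k (v 2) := by
  have h1 := ((lt hr 5 2).imp ((finLE hr 5 2).imp ((lt hr 4 5).imp ((finLE hr 4 5).imp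
    (same (P := P) (α := α) (d := fun _ => k) hr (.const k) 3 2 2 4 5 3).not)))).all2 3
    |>.all1 5 |>.all1 4
  refine (((lt hr 3 2).and ((finLE hr 3 2).and h1)).ex2 2).ex1 3 |>.congr fun a v V => ?_
  simp [LBad]

theorem recurAt (hr : (∀ x y, r x y ↔ x < y) ∨ ∀ x y, r x y ↔ y < x) :
    CD r P fun k v V => RecurAt P k (v 2) (V 0) := by
  have h0 := same (P := P) (d := id) hr .id 2 3 1 5 6 0
  have h1 := ((lt hr 4 5).and ((finLE hr 4 5).and ((lt hr 5 6).and ((finLE hr 5 6).and h0)))).ex1 6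
    |>.ex1 5
  have h2 := ((lt hr 5 6).and ((finLE hr 5 6).and ((lt hr 6 4).and ((finLE hr 6 4).and h0)))).ex1 6
    |>.ex1 5
  refine ((lt hr 2 3).imp ((finLE hr 2 3).imp (((finLE hr 2 4).or (finLE hr 4 2)).imp
    (h1.and h2)))).all1 4 |>.all2 1 |>.all1 3 |>.congr fun k v V => ?_
  simp [RecurAt]

end CD

/-- The relation of being at finite distance. -/
def finSetoid (A : Type) [LinearOrder A] : Setoid A where
  r x y := FinLE x y ∨ FinLE y x
  iseqv := by
    refine ⟨fun x => .inl (.refl x), fun h => h.symm, ?_⟩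
    rintro x y z (h | h) (h' | h')
    · exact .inl (h.trans h')
    · rcases le_total x z with hxz | hxz
      · exact .inl (h.left hxz h'.1)
      · exact .inr (h'.left hxz h.1)
    · rcases le_total x z with hxz | hxz
      · exact .inl (h'.right h.1 hxz)
      · exact .inr (h.right h'.1 hxz)
    · exact .inr (h'.trans h)

theorem finLE_of_rel {x y : A} (h : finSetoid A x y) (hxy : x ≤ y) : FinLE x y := by
  rcases h with h | h
  · exact h
  · rw [le_antisymm hxy h.1]
    exact .refl y

theorem Zeta.of_rel {x y : A} (h : finSetoid A x y) (hx : Zeta x) : Zeta y := by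
  have up : ∀ z, finSetoid A x z → ∃ u, z < u ∧ finSetoid A x u := by
    intro z hz
    rcases le_total x z with h1 | h1
    · obtain ⟨u, h2, h3⟩ := hx.1 z (finLE_of_rel hz h1)
      exact ⟨u, h2, .inl h3⟩
    · obtain ⟨u, h2, h3⟩ := hx.1 x (.refl x)
      exact ⟨u, h1.trans_lt h2, .inl h3⟩
  have dn : ∀ z, finSetoid A x z → ∃ u, u < z ∧ finSetoid A x u := by
    intro z hz
    rcases le_total z x with h1 | h1
    · obtain ⟨u, h2, h3⟩ := hx.2 z (finLE_of_rel ((finSetoid A).symm' hz) h1)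
      exact ⟨u, h2, .inr h3⟩
    · obtain ⟨u, h2, h3⟩ := hx.2 x (.refl x)
      exact ⟨u, h2.trans_le h1, .inr h3⟩
  refine ⟨fun z hz => ?_, fun z hz => ?_⟩
  · obtain ⟨u, h1, h2⟩ := up z ((finSetoid A).trans' h (.inl hz))
    exact ⟨u, h1, finLE_of_rel ((finSetoid A).trans' ((finSetoid A).symm' h) h2) (hz.1.trans h1.le)⟩
  · obtain ⟨u, h1, h2⟩ := dn z ((finSetoid A).trans' h (.inr hz))
    exact ⟨u, h1, finLE_of_rel ((finSetoid A).trans' ((finSetoid A).symm' h2) h) (h1.le.trans hz.1)⟩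

/-- The types of intervals of `w`, over all labellings. -/
def typesOf (P : Fin n → Set A) (w : ℤ → A) (k : ℕ) : Set (Ty k (n + 1)) :=
  {t | ∃ x y S, x < y ∧ tp k (n + 1) (Set.Ico (w x) (w y)) (lab P S) = t}

theorem tp_lab_congr {P : Fin n → Set A} {k : ℕ} {C X X' : Set A} (h : ∀ x ∈ C, x ∈ X ↔ x ∈ X') :
    tp k (n + 1) C (lab P X) = tp k (n + 1) C (lab P X') := by
  refine tp_congr fun i _ x hx => ?_
  by_cases hi : i < n
  · simp [lab, hi]
  · simpa [lab, hi] using h x hx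

section

variable {P : Fin n → Set A} {c : A} {w : ℤ → A} (hw : StrictMono w)
  (hc : ∀ x, finSetoid A x c ↔ ∃ i, w i = x)

include hc

theorem exists_enum_of_finLE {x : A} {i : ℤ} (h : FinLE x (w i) ∨ FinLE (w i) x) : ∃ j, w j = x :=
  (hc x).1 ((finSetoid A).trans' h ((hc _).2 ⟨i, rfl⟩))

include hw

theorem finLE_enum {i j : ℤ} (h : i ≤ j) : FinLE (w i) (w j) :=
  finLE_of_rel ((finSetoid A).trans' ((hc _).2 ⟨i, rfl⟩) ((finSetoid A).symm' ((hc _).2 ⟨j, rfl⟩)))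
    (hw.monotone h)

theorem range_ordConnected : (Set.range w).OrdConnected := by
  refine ⟨?_⟩
  rintro _ ⟨i, rfl⟩ _ ⟨j, rfl⟩ x ⟨h1, h2⟩
  refine exists_enum_of_finLE (i := i) hc (.inr ?_)
  exact (finLE_enum hw hc (hw.le_iff_le.1 (h1.trans h2))).left h1 h2

theorem mem_Ico_enum {i j : ℤ} {a : A} (h : a ∈ Set.Ico (w i) (w j)) :
    ∃ l, w l = a ∧ i ≤ l ∧ l < j := by
  obtain ⟨l, rfl⟩ := (range_ordConnected hw hc).out ⟨i, rfl⟩ ⟨j, rfl⟩ ⟨h.1, h.2.le⟩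
  exact ⟨l, rfl, hw.le_iff_le.1 h.1, hw.lt_iff_lt.1 h.2⟩

theorem typesOf_right (hbad : ∀ i k, ¬ RBad P k (w i)) {k : ℕ} {t : Ty k (n + 1)}
    (ht : t ∈ typesOf P w k) (z : ℤ) :
    ∃ x y S, z < x ∧ x < y ∧ tp k (n + 1) (Set.Ico (w x) (w y)) (lab P S) = t := by
  obtain ⟨x, y, S, hxy, hS⟩ := ht
  rcases lt_or_ge z x with hz | hz
  · exact ⟨x, y, S, hz, hxy, hS⟩
  · induction z, hz using Int.leInduction with
    | base =>
      have := hbad x k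
      simp only [RBad, not_exists, not_and, not_forall, not_not] at this
      obtain ⟨a, b, S', h1, h2, h3, h4, h5⟩ := this (w y) S (hw hxy) (finLE_enum hw hc hxy.le)
      obtain ⟨i, rfl⟩ := exists_enum_of_finLE hc (.inr h2)
      obtain ⟨j, rfl⟩ := exists_enum_of_finLE hc (.inr h4)
      exact ⟨i, j, S', hw.lt_iff_lt.1 h1, hw.lt_iff_lt.1 h3, h5.symm.trans hS⟩
    | succ z hz ih =>
      obtain ⟨x', y', S', h1, h2, h3⟩ := ih
      rcases eq_or_lt_of_le (show z + 1 ≤ x' from h1) with heq | hlt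
      · have := hbad x' k
        simp only [RBad, not_exists, not_and, not_forall, not_not] at this
        obtain ⟨a, b, S'', h1, h2, h4, h5, h6⟩ := this (w y') S' (hw h2) (finLE_enum hw hc h2.le)
        obtain ⟨i, rfl⟩ := exists_enum_of_finLE hc (.inr h2)
        obtain ⟨j, rfl⟩ := exists_enum_of_finLE hc (.inr h5)
        rw [heq]
        exact ⟨i, j, S'', hw.lt_iff_lt.1 h1, hw.lt_iff_lt.1 h4, h6.symm.trans h3⟩
      · exact ⟨x', y', S', hlt, h2, h3⟩

theorem typesOf_left (hbad : ∀ i k, ¬ LBad P k (w i)) {k : ℕ} {t : Ty k (n + 1)}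
    (ht : t ∈ typesOf P w k) (z : ℤ) :
    ∃ x y S, x < y ∧ y < z ∧ tp k (n + 1) (Set.Ico (w x) (w y)) (lab P S) = t := by
  obtain ⟨x, y, S, hxy, hS⟩ := ht
  have step : ∀ x y S, x < y → ∃ x' y' S', x' < y' ∧ y' < y ∧
      tp k (n + 1) (Set.Ico (w x) (w y)) (lab P S) =
        tp k (n + 1) (Set.Ico (w x') (w y')) (lab P S') := by
    intro x y S hxy
    have := hbad y k
    simp only [LBad, not_exists, not_and, not_forall, not_not] at this
    obtain ⟨a, b, S', h1, h2, h3, h4, h5⟩ := this (w x) S (hw hxy) (finLE_enum hw hc hxy.le)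
    obtain ⟨j, rfl⟩ := exists_enum_of_finLE hc (.inl h2)
    obtain ⟨i, rfl⟩ := exists_enum_of_finLE hc (.inl h4)
    exact ⟨i, j, S', hw.lt_iff_lt.1 h3, hw.lt_iff_lt.1 h1, h5⟩
  rcases lt_or_ge y z with hz | hz
  · exact ⟨x, y, S, hxy, hz, hS⟩
  · induction z, hz using Int.leInductionDown with
    | base =>
      obtain ⟨x', y', S', h1, h2, h3⟩ := step x y S hxy
      exact ⟨x', y', S', h1, h2, h3.symm.trans hS⟩
    | pred z hz ih =>
      obtain ⟨x', y', S', h1, h2, h3⟩ := ih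
      rcases eq_or_lt_of_le (show y' ≤ z - 1 by omega) with heq | hlt
      · obtain ⟨x'', y'', S'', h4, h5, h6⟩ := step x' y' S' h1
        exact ⟨x'', y'', S'', h4, heq ▸ h5, h6.symm.trans h3⟩
      · exact ⟨x', y', S', h1, hlt, h3⟩

theorem exists_recur (hR : ∀ i k, ¬ RBad P k (w i)) (hL : ∀ i k, ¬ LBad P k (w i)) :
    ∃ X : Set A, ∀ k, Recur k (n + 1) w (lab P X) (typesOf P w k) := by
  have hcongr : ∀ {k : ℕ} {x y : ℤ} {X X' : Set A}, (∀ j, x ≤ j → j < y → (w j ∈ X ↔ w j ∈ X')) →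
      tp k (n + 1) (Set.Ico (w x) (w y)) (lab P X) =
        tp k (n + 1) (Set.Ico (w x) (w y)) (lab P X') := by
    intro k x y X X' h
    refine tp_lab_congr fun a ha => ?_
    obtain ⟨l, rfl, h1, h2⟩ := mem_Ico_enum hw hc ha
    exact h l h1 h2
  have hmem : ∀ (X : Set ℤ) j, w j ∈ w '' X ↔ j ∈ X := fun X j => hw.injective.mem_set_image
  have : Nonempty (Σ k, Ty k (n + 1) × ℤ) := ⟨0, tp 0 (n + 1) ∅ (lab P ∅), 0⟩
  obtain ⟨X, hX⟩ := exists_generic (R := Σ k, Ty k (n + 1) × ℤ)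
    (fun q => {X | q.2.1 ∈ typesOf P w q.1 →
      (∃ x y, q.2.2 < x ∧ x < y ∧
        tp q.1 (n + 1) (Set.Ico (w x) (w y)) (lab P (w '' X)) = q.2.1) ∧
      ∃ x y, x < y ∧ y < q.2.2 ∧
        tp q.1 (n + 1) (Set.Ico (w x) (w y)) (lab P (w '' X)) = q.2.1}) (by
    rintro ⟨k, t, z⟩ X hX
    by_cases ht : t ∈ typesOf P w k
    · obtain ⟨⟨x, y, h1, h2, h3⟩, x', y', h4, h5, h6⟩ := hX ht
      refine ⟨x.natAbs + y.natAbs + x'.natAbs + y'.natAbs, fun X' hX' _ =>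
        ⟨⟨x, y, h1, h2, Eq.trans (hcongr fun j hj1 hj2 => ?_) h3⟩,
          x', y', h4, h5, Eq.trans (hcongr fun j hj1 hj2 => ?_) h6⟩⟩
      · rw [hmem, hmem]
        exact hX' j (by omega)
      · rw [hmem, hmem]
        exact hX' j (by omega)
    · exact ⟨0, fun _ _ h => absurd h ht⟩) (by
    rintro ⟨k, t, z⟩ X N
    by_cases ht : t ∈ typesOf P w k
    · obtain ⟨x, y, S, h1, h2, h3⟩ := typesOf_right hw hc hR ht (N + z.natAbs)
      obtain ⟨x', y', S', h4, h5, h6⟩ := typesOf_left hw hc hL ht (-(N + z.natAbs))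
      refine ⟨{j | (x ≤ j ∧ w j ∈ S) ∨ (j < y' ∧ w j ∈ S') ∨ (y' ≤ j ∧ j < x ∧ j ∈ X)}, fun _ =>
        ⟨⟨x, y, show z < x by omega, h2, Eq.trans (hcongr fun j hj1 hj2 => ?_) h3⟩,
          x', y', h4, show y' < z by omega, Eq.trans (hcongr fun j hj1 hj2 => ?_) h6⟩,
          fun j hj => ?_⟩
      · have e1 : ¬ j < y' := by omega
        have e2 : ¬ j < x := by omega
        rw [hmem]
        simp [hj1, e1, e2]
      · have e1 : ¬ x ≤ j := by omega
        have e2 : ¬ y' ≤ j := by omega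
        rw [hmem]
        simp [hj2, e1, e2]
      · have e1 : ¬ x ≤ j := by omega
        have e2 : ¬ j < y' := by omega
        have e3 : y' ≤ j := by omega
        have e4 : j < x := by omega
        simp [e1, e2, e3, e4]
    · exact ⟨X, fun h => absurd h ht, fun _ _ => Iff.rfl⟩)
  exact ⟨w '' X, fun k => ⟨fun x y h => ⟨x, y, _, h, rfl⟩, fun t ht z => (hX ⟨k, t, z⟩ ht).1,
    fun t ht z => (hX ⟨k, t, z⟩ ht).2⟩⟩

theorem recur_congr {X X' : Set A} {k : ℕ} {N : ℕ}
    (h : ∀ j : ℤ, N < j.natAbs → (w j ∈ X ↔ w j ∈ X'))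
    (hX : Recur k (n + 1) w (lab P X) (typesOf P w k)) :
    Recur k (n + 1) w (lab P X') (typesOf P w k) := by
  refine ⟨fun x y h => ⟨x, y, _, h, rfl⟩, fun t ht z => ?_, fun t ht z => ?_⟩
  · obtain ⟨x, y, h1, h2, h3⟩ := hX.right t ht (N + z.natAbs)
    refine ⟨x, y, by omega, h2, Eq.trans (tp_lab_congr fun a ha => ?_) h3⟩
    obtain ⟨l, rfl, h4, h5⟩ := mem_Ico_enum hw hc ha
    exact (h l (by omega)).symm
  · obtain ⟨x, y, h1, h2, h3⟩ := hX.left t ht (-(N + z.natAbs))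
    refine ⟨x, y, h1, by omega, Eq.trans (tp_lab_congr fun a ha => ?_) h3⟩
    obtain ⟨l, rfl, h4, h5⟩ := mem_Ico_enum hw hc ha
    exact (h l (by omega)).symm

theorem recur_iff {X : Set A} {k : ℕ} :
    Recur k (n + 1) w (lab P X) (typesOf P w k) ↔ ∀ i, RecurAt P k (w i) X := by
  constructor
  · intro h i y S z h1 h2 h3
    obtain ⟨j, rfl⟩ := exists_enum_of_finLE hc (.inr h2)
    obtain ⟨l, rfl⟩ := exists_enum_of_finLE hc h3.symm
    have ht : tp k (n + 1) (Set.Ico (w i) (w j)) (lab P S) ∈ typesOf P w k :=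
      ⟨i, j, S, hw.lt_iff_lt.1 h1, rfl⟩
    obtain ⟨x, y, h4, h5, h6⟩ := h.right _ ht l
    obtain ⟨x', y', h4', h5', h6'⟩ := h.left _ ht l
    exact ⟨⟨w x, w y, hw h4, finLE_enum hw hc h4.le, hw h5, finLE_enum hw hc h5.le, h6.symm⟩,
      w x', w y', hw h4', finLE_enum hw hc h4'.le, hw h5', finLE_enum hw hc h5'.le, h6'.symm⟩
  · intro h
    refine ⟨fun x y h => ⟨x, y, _, h, rfl⟩, ?_, ?_⟩
    · rintro t ⟨i, j, S, hij, rfl⟩ z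
      obtain ⟨⟨x, y, h1, h2, h3, h4, h5⟩, -⟩ := h i (w j) S (w z) (hw hij)
        (finLE_enum hw hc hij.le) ((le_total i z).imp (finLE_enum hw hc) (finLE_enum hw hc))
      obtain ⟨x, rfl⟩ := exists_enum_of_finLE hc (.inr h2)
      obtain ⟨y, rfl⟩ := exists_enum_of_finLE hc (.inr h4)
      exact ⟨x, y, hw.lt_iff_lt.1 h1, hw.lt_iff_lt.1 h3, h5.symm⟩
    · rintro t ⟨i, j, S, hij, rfl⟩ z
      obtain ⟨-, x, y, h1, h2, h3, h4, h5⟩ := h i (w j) S (w z) (hw hij)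
        (finLE_enum hw hc hij.le) ((le_total i z).imp (finLE_enum hw hc) (finLE_enum hw hc))
      obtain ⟨y, rfl⟩ := exists_enum_of_finLE hc (.inl h4)
      obtain ⟨x, rfl⟩ := exists_enum_of_finLE hc (.inl h2)
      exact ⟨x, y, hw.lt_iff_lt.1 h1, hw.lt_iff_lt.1 h3, h5.symm⟩

end

theorem Zeta.exists_enum {c : A} (h : Zeta c) :
    ∃ w : ℤ → A, StrictMono w ∧ ∀ x, finSetoid A x c ↔ ∃ i, w i = x := by
  obtain ⟨w, hw, hw'⟩ := exists_enum_int h.1 h.2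
  exact ⟨w, hw, fun x => Iff.trans or_comm (hw' x)⟩

end

/-! ## The main construction -/

section

variable {A : Type} [LinearOrder A] {n : ℕ}

theorem tp_univ_eq_of_zeta {P : Fin n → Set A} {k : ℕ} {X Y : Set A} (hX : ∀ x ∈ X, Zeta x)
    (hY : ∀ x ∈ Y, Zeta x) (h : ∀ c, Zeta c → tp k (n + 1) {y | finSetoid A y c} (lab P X) =
      tp k (n + 1) {y | finSetoid A y c} (lab P Y)) :
    tp k (n + 1) Set.univ (lab P X) = tp k (n + 1) Set.univ (lab P Y) := by
  refine tp_univ_congr_of_classes (finSetoid A) (fun x y z hxy hyz hxz => ?_) fun c => ?_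
  · exact .inl ((finLE_of_rel hxz (hxy.trans hyz)).left hxy hyz)
  · by_cases hc : Zeta c
    · exact h c hc
    · refine tp_lab_congr fun y hy => ?_
      have hy' : ¬ Zeta y := fun h => hc (h.of_rel hy)
      exact iff_of_false (fun h => hy' (hX y h)) fun h => hy' (hY y h)

theorem exists_finLE_no_max {I : Set A} (hI : I.OrdConnected) (e : I ≃o ℕ) :
    ∃ x₀ : A, ∀ x, FinLE x₀ x → ∃ y, x < y ∧ FinLE x₀ y := by
  have hfin : ∀ i j, i ≤ j → FinLE (e.symm i : A) (e.symm j) := by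
    intro i j hij
    refine ⟨e.symm.monotone hij, ?_⟩
    refine ((Set.finite_Icc i j).image fun i => (e.symm i : A)).subset fun x hx => ?_
    have hxI : x ∈ I := hI.out (e.symm i).2 (e.symm j).2 hx
    refine ⟨e ⟨x, hxI⟩, ⟨?_, ?_⟩, by simp⟩
    · exact (e.symm_apply_le).1 hx.1
    · exact (e.le_symm_apply).1 hx.2
  refine ⟨e.symm 0, fun x hx => ?_⟩
  by_contra! hno
  have hle : ∀ j, (e.symm j : A) ≤ x := fun j =>
    not_lt.1 fun h => hno _ h (hfin 0 j (Nat.zero_le j))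
  refine Set.infinite_range_of_injective (f := fun j => (e.symm j : A))
    (Subtype.val_injective.comp e.symm.injective) (hx.2.subset ?_)
  rintro _ ⟨j, rfl⟩
  exact ⟨(hfin 0 j (Nat.zero_le j)).1, hle j⟩

variable {r : A → A → Prop} (hr : (∀ x y, r x y ↔ x < y) ∨ ∀ x y, r x y ↔ y < x)
  {P : Fin n → Set A}

include hr

theorem exists_expansion_of_recurrent {x₀ : A} (h₀ : Zeta x₀)
    (hR : ∀ c : A, Zeta c → ∀ k, ¬ RBad P k c) (hL : ∀ c : A, Zeta c → ∀ k, ¬ LBad P k c) :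
    ∃ Q : Set A, ¬ Definable r P Q ∧
      TuringRed (TheoryCodes r (Fin.snoc P Q)) (TheoryCodes r P) ∧
      (DecidableSet (TheoryCodes r P) → DecidableSet (TheoryCodes r (Fin.snoc P Q))) := by
  have : Nonempty A := ⟨x₀⟩
  have hG : ∀ c : A, ∃ X : Set A, Zeta c → ∀ (w : ℤ → A), StrictMono w →
      (∀ x, finSetoid A x c ↔ ∃ i, w i = x) → ∀ k,
        Recur k (n + 1) w (lab P X) (typesOf P w k) := by
    intro c
    by_cases hc : Zeta c
    · obtain ⟨w, hw, hwc⟩ := hc.exists_enum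
      have hz : ∀ i, Zeta (w i) := fun i => hc.of_rel ((finSetoid A).symm' ((hwc _).2 ⟨i, rfl⟩))
      obtain ⟨X, hX⟩ := exists_recur hw hwc (fun i => hR _ (hz i)) fun i => hL _ (hz i)
      refine ⟨X, fun _ w' hw' hwc' k => (recur_iff hw' hwc').2 fun i => ?_⟩
      obtain ⟨j, hj⟩ := (hwc _).1 ((hwc' _).2 ⟨i, rfl⟩)
      rw [← hj]
      exact (recur_iff hw hwc).1 (hX k) j
    · exact ⟨∅, fun h => absurd h hc⟩
  choose G hG using hG
  let rep : A → A := fun a => (Quotient.mk (finSetoid A) a).out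
  have hrep : ∀ a, finSetoid A (rep a) a := fun a => Quotient.mk_out a
  have hrep' : ∀ a b, finSetoid A a b → rep a = rep b := fun a b h =>
    congrArg Quotient.out (Quotient.sound h)
  let Q : Set A := {a | Zeta a ∧ a ∈ G (rep a)}
  have hQ : ∀ c, Zeta c → ∀ w : ℤ → A, StrictMono w → (∀ x, finSetoid A x c ↔ ∃ i, w i = x) →
      ∀ k, Recur k (n + 1) w (lab P Q) (typesOf P w k) := by
    intro c hc w hw hwc k
    refine recur_congr (X := G (rep c)) (N := 0) hw hwc (fun j _ => ?_)
      (hG _ (hc.of_rel ((finSetoid A).symm' (hrep c))) w hw (fun x => ?_) k)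
    · have hj := (hwc _).2 ⟨j, rfl⟩
      have h1 : Zeta (w j) := hc.of_rel ((finSetoid A).symm' hj)
      simp only [Q, Set.mem_ofPred_eq, h1, true_and, hrep' _ _ hj]
    · rw [← hwc]
      exact ⟨fun h => (finSetoid A).trans' h (hrep c),
        fun h => (finSetoid A).trans' h ((finSetoid A).symm' (hrep c))⟩
  have hcls : ∀ X : Set A, ∀ k, (∀ x ∈ X, Zeta x) → (∀ c, Zeta c → ∀ w : ℤ → A, StrictMono w →
      (∀ x, finSetoid A x c ↔ ∃ i, w i = x) → Recur k (n + 1) w (lab P X) (typesOf P w k)) →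
      tp k (n + 1) Set.univ (lab P X) = tp k (n + 1) Set.univ (lab P Q) := by
    intro X k h1 h2
    refine tp_univ_eq_of_zeta h1 (fun x hx => hx.1) fun c hc => ?_
    obtain ⟨w, hw, hwc⟩ := hc.exists_enum
    have : {y | finSetoid A y c} = Set.range w := Set.ext hwc
    rw [this]
    exact (h2 c hc w hw hwc).tp_eq hw (range_ordConnected hw hwc) (hQ c hc w hw hwc k)
  refine ⟨Q, exists_expansion hr
    (Ψ := fun k X => (∀ x, x ∈ X → Zeta x) ∧ ∀ x, Zeta x → RecurAt P k x X) ?_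
    (fun k => ⟨Q, fun x hx => hx.1, fun x hx => ?_⟩) (fun k X hX => ?_) fun k => ?_⟩
  · refine ((((CD.mem 2 0).imp (CD.zeta hr)).all1 2).and
      (((CD.zeta hr).imp (CD.recurAt hr)).all1 2)).congr fun k v V => ?_
    simp
  · obtain ⟨w, hw, hwc⟩ := hx.exists_enum
    obtain ⟨i, rfl⟩ := (hwc x).1 ((finSetoid A).refl' x)
    exact (recur_iff hw hwc).1 (hQ _ hx w hw hwc k) i
  · refine hcls X k hX.1 fun c hc w hw hwc => (recur_iff hw hwc).2 fun i => hX.2 _ ?_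
    exact hc.of_rel ((finSetoid A).symm' ((hwc _).2 ⟨i, rfl⟩))
  · refine ⟨symmDiff Q {x₀}, fun h => ?_, hcls _ k (fun x hx => ?_) fun c hc w hw hwc => ?_⟩
    · have : x₀ ∈ symmDiff Q {x₀} ↔ x₀ ∈ Q := by rw [h]
      simp [Set.mem_symmDiff] at this
    · rcases (Set.mem_symmDiff).1 hx with h | h
      · exact h.1.1
      · rw [h.1]
        exact h₀
    · have key : ∃ N : ℕ, ∀ j : ℤ, N < j.natAbs → w j ≠ x₀ := by
        by_cases hj : ∃ j, w j = x₀
        · obtain ⟨j, rfl⟩ := hj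
          refine ⟨j.natAbs, fun i hi h => ?_⟩
          rw [hw.injective h] at hi
          exact lt_irrefl _ hi
        · exact ⟨0, fun j _ h => hj ⟨j, h⟩⟩
      obtain ⟨N, hN⟩ := key
      refine recur_congr hw hwc (N := N) (fun j hj => ?_) (hQ c hc w hw hwc k)
      simp [Set.mem_symmDiff, hN j hj]

theorem exists_expansion_of_lower_finite {L : Set A}
    (hdef : CD r P fun (_ : ℕ) v _ => v 2 ∈ L) (hne : L.Nonempty)
    (hL : ∀ b ∈ L, ∀ x, FinLE b x → ∃ y, x < y ∧ FinLE b y)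
    (hfin : ∀ c ∈ L, {x | x ∈ L ∧ FinLE x c}.Finite) :
    ∃ Q : Set A, ¬ Definable r P Q ∧
      TuringRed (TheoryCodes r (Fin.snoc P Q)) (TheoryCodes r P) ∧
      (DecidableSet (TheoryCodes r P) → DecidableSet (TheoryCodes r (Fin.snoc P Q))) := by
  have hdef' : CD r P fun (_ : ℕ) v _ => v 3 ∈ L := by
    simpa using CD.subst1 hr 2 3 hdef
  refine exists_expansion_of_marked hr (B := {b | b ∈ L ∧ ∀ b', b' < b → FinLE b' b → b' ∉ L})
    ?_ ?_ (fun b hb => hL b hb.1) fun b hb b' hb' h => ?_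
  · refine (hdef.and (((CD.lt hr 3 2).imp ((CD.finLE hr 3 2).imp hdef'.not)).all1 3)).congr
      fun a v V => ?_
    simp
  · obtain ⟨c, hc⟩ := hne
    obtain ⟨b, hb, hmin⟩ := (hfin c hc).exists_minimal ⟨c, hc, .refl c⟩
    refine ⟨b, hb.1, fun b' h1 h2 h3 => ?_⟩
    exact h1.not_ge (hmin ⟨h3, h2.trans hb.2⟩ h1.le)
  · by_contra hne
    exact hb'.2 b (lt_of_le_of_ne h.1 hne) h hb.1

theorem exists_expansion_of_rBad {c : A} {k : ℕ} (hc : Zeta c) (h : RBad P k c) :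
    ∃ Q : Set A, ¬ Definable r P Q ∧
      TuringRed (TheoryCodes r (Fin.snoc P Q)) (TheoryCodes r P) ∧
      (DecidableSet (TheoryCodes r P) → DecidableSet (TheoryCodes r (Fin.snoc P Q))) := by
  refine exists_expansion_of_lower_finite hr (L := {x | Zeta x ∧ RBad P k x})
    ((CD.zeta hr).and (CD.rBad hr k)) ⟨c, hc, h⟩ (fun b hb => hb.1.1) fun c _ => ?_
  have : ∀ x, ∃ y S, RBad P k x → x < y ∧ FinLE x y ∧
      ∀ x' y' S', x < x' → FinLE x x' → x' < y' → FinLE x' y' → ¬ Same P k x y S x' y' S' := by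
    intro x
    by_cases hx : RBad P k x
    · obtain ⟨y, S, h⟩ := hx
      exact ⟨y, S, fun _ => h⟩
    · exact ⟨x, ∅, fun h => absurd h hx⟩
  choose f S hf using this
  refine Set.Finite.of_finite_image
    (f := fun x => tp k (n + 1) (Set.Ico x (f x)) (lab P (S x))) (Set.toFinite _) ?_
  have key : ∀ x x', (Zeta x ∧ RBad P k x) ∧ FinLE x c → (Zeta x' ∧ RBad P k x') ∧ FinLE x' c →
      tp k (n + 1) (Set.Ico x (f x)) (lab P (S x)) =
        tp k (n + 1) (Set.Ico x' (f x')) (lab P (S x')) → ¬ x < x' :=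
    fun x x' hx hx' heq hlt => (hf x hx.1.2).2.2 x' _ _ hlt (hx.2.left hlt.le hx'.2.1)
      (hf x' hx'.1.2).1 (hf x' hx'.1.2).2.1 heq
  intro x hx x' hx' heq
  exact le_antisymm (not_lt.1 (key _ _ hx' hx heq.symm)) (not_lt.1 (key _ _ hx hx' heq))

theorem exists_expansion_of_lBad {c : A} {k : ℕ} (hc : Zeta c) (h : LBad P k c) :
    ∃ Q : Set A, ¬ Definable r P Q ∧
      TuringRed (TheoryCodes r (Fin.snoc P Q)) (TheoryCodes r P) ∧
      (DecidableSet (TheoryCodes r P) → DecidableSet (TheoryCodes r (Fin.snoc P Q))) := by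
  refine exists_expansion_of_lower_finite hr (L := {x | Zeta x ∧ LBad P k x})
    ((CD.zeta hr).and (CD.lBad hr k)) ⟨c, hc, h⟩ (fun b hb => hb.1.1) fun c _ => ?_
  have : ∀ y, ∃ x S, LBad P k y → x < y ∧ FinLE x y ∧
      ∀ x' y' S', y' < y → FinLE y' y → x' < y' → FinLE x' y' → ¬ Same P k x y S x' y' S' := by
    intro y
    by_cases hy : LBad P k y
    · obtain ⟨x, S, h⟩ := hy
      exact ⟨x, S, fun _ => h⟩
    · exact ⟨y, ∅, fun h => absurd h hy⟩
  choose f S hf using this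
  refine Set.Finite.of_finite_image
    (f := fun y => tp k (n + 1) (Set.Ico (f y) y) (lab P (S y))) (Set.toFinite _) ?_
  have key : ∀ y y', (Zeta y ∧ LBad P k y) ∧ FinLE y c → (Zeta y' ∧ LBad P k y') ∧ FinLE y' c →
      tp k (n + 1) (Set.Ico (f y) y) (lab P (S y)) =
        tp k (n + 1) (Set.Ico (f y') y') (lab P (S y')) → ¬ y' < y :=
    fun y y' hy hy' heq hlt => (hf y hy.1.2).2.2 _ y' _ hlt (hy'.2.left hlt.le hy.2.1)
      (hf y' hy'.1.2).1 (hf y' hy'.1.2).2.1 heq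
  intro y hy y' hy' heq
  exact le_antisymm (not_lt.1 (key _ _ hy hy' heq)) (not_lt.1 (key _ _ hy' hy heq.symm))

theorem exists_expansion_of_no_max {x₀ : A} (h₀ : ∀ x, FinLE x₀ x → ∃ y, x < y ∧ FinLE x₀ y) :
    ∃ Q : Set A, ¬ Definable r P Q ∧
      TuringRed (TheoryCodes r (Fin.snoc P Q)) (TheoryCodes r P) ∧
      (DecidableSet (TheoryCodes r P) → DecidableSet (TheoryCodes r (Fin.snoc P Q))) := by
  let L : Set A := {b | (∀ x, FinLE b x → ∃ y, x < y ∧ FinLE b y) ∧ ∀ x, FinLE x b → ¬ x < b}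
  by_cases hL : L.Nonempty
  · refine exists_expansion_of_lower_finite hr (L := L) ?_ hL (fun b hb => hb.1) fun c hc => ?_
    · refine ((((CD.finLE hr 2 3).imp (((CD.lt hr 3 4).and (CD.finLE hr 2 4)).ex1 4)).all1 3).and
        (((CD.finLE hr 3 2).imp (CD.lt hr 3 2).not).all1 3)).congr fun a v V => ?_
      simp [L]
    · refine (Set.finite_singleton c).subset fun x hx => ?_
      exact le_antisymm hx.2.1 (not_lt.1 (hc.2 x hx.2))
  have hz : Zeta x₀ := by
    refine ⟨h₀, fun x hx => ?_⟩
    by_contra! hno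
    refine hL ⟨x, fun z hz => ?_, fun z hz hlt => hno z hlt (hz.trans hx)⟩
    rcases le_total x₀ z with h | h
    · obtain ⟨y, h1, h2⟩ := h₀ z (hz.right hx.1 h)
      exact ⟨y, h1, hx.trans h2⟩
    · obtain ⟨y, h1, h2⟩ := h₀ x₀ (.refl x₀)
      exact ⟨y, h.trans_lt h1, hx.trans h2⟩
  by_cases hR : ∃ c, Zeta c ∧ ∃ k, RBad P k c
  · obtain ⟨c, hc, k, h⟩ := hR
    exact exists_expansion_of_rBad hr hc h
  by_cases hL' : ∃ c, Zeta c ∧ ∃ k, LBad P k c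
  · obtain ⟨c, hc, k, h⟩ := hL'
    exact exists_expansion_of_lBad hr hc h
  exact exists_expansion_of_recurrent hr hz (fun c hc k h => hR ⟨c, hc, k, h⟩)
    fun c hc k h => hL' ⟨c, hc, k, h⟩

end

end Paper

/-- Main theorem: let `M = (A, <, P₁, …, Pₙ)` be a labelled linear ordering
containing an interval of order type `ω` or `-ω` (an order-connected subset
order-isomorphic to `ℕ` or to `ℕ` with the reversed order).  Then there is a
set `Q ⊆ A`, not MSO-definable in `M`, such that the MSO theory of the
expansion `M' = (A, <, P₁, …, Pₙ, Q)` is recursive in the MSO theory of `M`;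
in particular if `MSO(M)` is decidable then so is `MSO(M')`. -/
theorem stmt_17 {A : Type} [LinearOrder A] {n : ℕ} (P : Fin n → Set A)
    (I : Set A) (hI : I.OrdConnected)
    (hiso : Nonempty (I ≃o ℕ) ∨ Nonempty (I ≃o ℕᵒᵈ)) :
    ∃ Q : Set A,
      ¬ MSO.Definable (fun x y : A => x < y) P Q ∧
      TuringRed (MSO.TheoryCodes (fun x y : A => x < y) (Fin.snoc P Q))
        (MSO.TheoryCodes (fun x y : A => x < y) P) ∧
      (DecidableSet (MSO.TheoryCodes (fun x y : A => x < y) P) →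
        DecidableSet (MSO.TheoryCodes (fun x y : A => x < y) (Fin.snoc P Q))) := by
  rcases hiso with ⟨⟨e⟩⟩ | ⟨⟨e⟩⟩
  · obtain ⟨x₀, h₀⟩ := exists_finLE_no_max hI e
    exact exists_expansion_of_no_max (.inl fun _ _ => Iff.rfl) h₀
  · let I' : Set Aᵒᵈ := OrderDual.ofDual ⁻¹' I
    have hI' : I'.OrdConnected := hI.dual
    let e' : I' ≃o ℕ :=
      { toFun := fun x => OrderDual.ofDual (e ⟨OrderDual.ofDual x.1, x.2⟩)
        invFun := fun i => ⟨OrderDual.toDual (e.symm (OrderDual.toDual i)).1, (e.symm _).2⟩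
        left_inv := fun x => by
          ext
          simp
        right_inv := fun i => by simp
        map_rel_iff' := fun {x y} =>
          e.map_rel_iff' (a := ⟨OrderDual.ofDual y.1, y.2⟩) (b := ⟨OrderDual.ofDual x.1, x.2⟩) }
    obtain ⟨x₀, h₀⟩ := exists_finLE_no_max hI' e'
    exact exists_expansion_of_no_max (A := Aᵒᵈ) (r := fun x y : A => x < y)
      (.inr fun _ _ => Iff.rfl) h₀
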